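/- Let f, g, c ∈ ℂ[x] be polynomials such that c is not an iterate of f and c is not an iterate of g (i.e. c ≠ f^n and c ≠ g^n as polynomials for every n ≥ 1). Suppose f and g are compositionally independent, i.e. any two distinct nonempty finite words in the letters f and g yield distinct composite functions ℂ → ℂ. Then the set of λ ∈ ℂ for which there exist integers m, n ≥ 1 with f^m(λ) = g^n(λ) and g^n(λ) = c(λ) is finite. -/

import Mathlib

section StmtHelpers
open Polynomial Cardinal


section SetupSection

/-- evaluation of a word in `f` and `g` -/
def wd (f g : ℂ[X]) (w : List Bool) : ℂ → ℂ :=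
  (w.map fun b => if b then (fun x => f.eval x) else (fun x => g.eval x)).foldr (· ∘ ·) id

theorem wd_nil (f g : ℂ[X]) : wd f g [] = id := rfl
theorem wd_true (f g : ℂ[X]) (w : List Bool) : wd f g (true :: w) = (fun x => f.eval x) ∘ wd f g w := rfl
theorem wd_false (f g : ℂ[X]) (w : List Bool) : wd f g (false :: w) = (fun x => g.eval x) ∘ wd f g w := rfl

theorem wd_append (f g : ℂ[X]) (w w' : List Bool) : wd f g (w ++ w') = wd f g w ∘ wd f g w' := by
  induction w with
  | nil => rfl
  | cons b w ih => cases b <;> simp [wd_true, wd_false, ih, Function.comp_assoc]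

theorem wd_rep_true (f g : ℂ[X]) (k : ℕ) : wd f g (List.replicate k true) = (fun x => f.eval x)^[k] := by
  induction k with
  | zero => rfl
  | succ k ih => rw [List.replicate_succ, wd_true, ih, Function.iterate_succ']

theorem wd_rep_false (f g : ℂ[X]) (k : ℕ) : wd f g (List.replicate k false) = (fun x => g.eval x)^[k] := by
  induction k with
  | zero => rfl
  | succ k ih => rw [List.replicate_succ, wd_false, ih, Function.iterate_succ']

theorem wd_swap (f g : ℂ[X]) (w : List Bool) : wd g f w = wd f g (w.map not) := by
  induction w with
  | nil => rfl
  | cons b w ih => cases b <;> simp [wd_true, wd_false, ih]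

/-- polynomial of a word -/
noncomputable def wdp (f g : ℂ[X]) : List Bool → ℂ[X]
  | [] => X
  | b :: w => (if b then f else g).comp (wdp f g w)

theorem wdp_eval (f g : ℂ[X]) (w : List Bool) (z : ℂ) : (wdp f g w).eval z = wd f g w z := by
  induction w with
  | nil => simp [wdp, wd_nil]
  | cons b w ih => cases b <;> simp [wdp, wd_true, wd_false, ih]

structure Hyp (f g c : ℂ[X]) : Prop where
  fin_f : ∀ m, 1 ≤ m → {l : ℂ | (fun x => f.eval x)^[m] l = c.eval l}.Finite
  fin_g : ∀ m, 1 ≤ m → {l : ℂ | (fun x => g.eval x)^[m] l = c.eval l}.Finite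
  free : ∀ w₁ w₂ : List Bool, w₁ ≠ [] → w₂ ≠ [] → w₁ ≠ w₂ → wd f g w₁ ≠ wd f g w₂

def SolM (M : ℕ) (f g c : ℂ[X]) : Set ℂ :=
  {l | ∃ m n : ℕ, M ≤ m ∧ M ≤ n ∧ (fun x => f.eval x)^[m] l = c.eval l ∧ (fun x => g.eval x)^[n] l = c.eval l}

theorem Hyp.symm {f g c : ℂ[X]} (h : Hyp f g c) : Hyp g f c where
  fin_f := h.fin_g
  fin_g := h.fin_f
  free := by
    intro w₁ w₂ h1 h2 h3
    rw [wd_swap, wd_swap f g w₂]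
    refine h.free _ _ (by simpa using h1) (by simpa using h2) fun h4 => h3 ?_
    exact List.map_injective_iff.2 (fun a b hab => by simpa using hab) h4

theorem SolM_symm (M : ℕ) (f g c : ℂ[X]) : SolM M g f c = SolM M f g c := by
  ext l
  constructor
  · rintro ⟨m, n, h1, h2, h3, h4⟩; exact ⟨n, m, h2, h1, h4, h3⟩
  · rintro ⟨m, n, h1, h2, h3, h4⟩; exact ⟨n, m, h2, h1, h4, h3⟩

theorem Hyp.reduce {f g c : ℂ[X]} (h : Hyp f g c) (M : ℕ) (hM : (SolM M f g c).Finite) :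
    (SolM 1 f g c).Finite := by
  have h1 : (⋃ m ∈ Set.Icc 1 M, {l : ℂ | (fun x => f.eval x)^[m] l = c.eval l}).Finite :=
    (Set.finite_Icc 1 M).biUnion fun m hm => h.fin_f m hm.1
  have h2 : (⋃ m ∈ Set.Icc 1 M, {l : ℂ | (fun x => g.eval x)^[m] l = c.eval l}).Finite :=
    (Set.finite_Icc 1 M).biUnion fun m hm => h.fin_g m hm.1
  refine (hM.union (h1.union h2)).subset ?_
  rintro l ⟨m, n, hm, hn, h3, h4⟩
  by_cases hm' : M ≤ m
  · by_cases hn' : M ≤ n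
    · exact Or.inl ⟨m, n, hm', hn', h3, h4⟩
    · exact Or.inr (Or.inr (Set.mem_biUnion (x := n) ⟨hn, by omega⟩ h4))
  · exact Or.inr (Or.inl (Set.mem_biUnion (x := m) ⟨hm, by omega⟩ h3))

theorem iter_conj (A : ℂ ≃ ℂ) (f f' : ℂ → ℂ) (h : ∀ z, A (f' z) = f (A z)) (n : ℕ) (z : ℂ) :
    A (f'^[n] z) = f^[n] (A z) := by
  induction n generalizing z with
  | zero => rfl
  | succ n ih => rw [Function.iterate_succ_apply, Function.iterate_succ_apply, ih, h]

theorem wd_conj (A : ℂ ≃ ℂ) (f g f' g' : ℂ[X]) (hf : ∀ z, A (f'.eval z) = f.eval (A z))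
    (hg : ∀ z, A (g'.eval z) = g.eval (A z)) (w : List Bool) (z : ℂ) :
    A (wd f' g' w z) = wd f g w (A z) := by
  induction w with
  | nil => rfl
  | cons b w ih =>
    cases b
    · rw [wd_false, wd_false, Function.comp_apply, Function.comp_apply, hg, ih]
    · rw [wd_true, wd_true, Function.comp_apply, Function.comp_apply, hf, ih]

theorem Hyp.conj {f g c f' g' c' : ℂ[X]} (h : Hyp f g c) (A : ℂ ≃ ℂ) (hf : ∀ z, A (f'.eval z) = f.eval (A z))
    (hg : ∀ z, A (g'.eval z) = g.eval (A z)) (hc : ∀ z, A (c'.eval z) = c.eval (A z)) : Hyp f' g' c' where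
  fin_f := by
    intro m hm
    refine ((h.fin_f m hm).preimage A.injective.injOn).subset ?_
    intro l hl
    simp only [Set.mem_setOf_eq, Set.mem_preimage] at hl ⊢
    rw [← iter_conj A _ _ hf, hl, hc]
  fin_g := by
    intro m hm
    refine ((h.fin_g m hm).preimage A.injective.injOn).subset ?_
    intro l hl
    simp only [Set.mem_setOf_eq, Set.mem_preimage] at hl ⊢
    rw [← iter_conj A _ _ hg, hl, hc]
  free := by
    intro w₁ w₂ h1 h2 h3 h4
    refine h.free w₁ w₂ h1 h2 h3 ?_
    funext z
    have := congrFun h4 (A.symm z)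
    have := congrArg A this
    rwa [wd_conj A f g f' g' hf hg, wd_conj A f g f' g' hf hg, A.apply_symm_apply] at this

theorem SolM_conj {f g c f' g' c' : ℂ[X]} (A : ℂ ≃ ℂ) (hf : ∀ z, A (f'.eval z) = f.eval (A z))
    (hg : ∀ z, A (g'.eval z) = g.eval (A z)) (hc : ∀ z, A (c'.eval z) = c.eval (A z)) (M : ℕ)
    (h : (SolM M f' g' c').Finite) : (SolM M f g c).Finite := by
  refine (h.image A).subset ?_
  rintro l ⟨m, n, hm, hn, h1, h2⟩
  refine ⟨A.symm l, ⟨m, n, hm, hn, ?_, ?_⟩, A.apply_symm_apply l⟩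
  · apply A.injective
    rw [iter_conj A (fun x => f.eval x) _ hf, hc, A.apply_symm_apply, h1]
  · apply A.injective
    rw [iter_conj A (fun x => g.eval x) _ hg, hc, A.apply_symm_apply, h2]

/-- affine equivalence -/
noncomputable def affEquiv (α β : ℂ) (hα : α ≠ 0) : ℂ ≃ ℂ where
  toFun z := α * z + β
  invFun z := α⁻¹ * (z - β)
  left_inv z := by field_simp; ring
  right_inv z := by field_simp; ring

/-- conjugated polynomial -/
noncomputable def cjp (α β : ℂ) (f : ℂ[X]) : ℂ[X] := C α⁻¹ * (f.comp (C α * X + C β) - C β)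

theorem cjp_spec (α β : ℂ) (hα : α ≠ 0) (f : ℂ[X]) (z : ℂ) :
    affEquiv α β hα ((cjp α β f).eval z) = f.eval (affEquiv α β hα z) := by
  simp [affEquiv, cjp]
  field_simp
  ring

theorem Hyp.cj {f g c : ℂ[X]} (h : Hyp f g c) (α β : ℂ) (hα : α ≠ 0) :
    Hyp (cjp α β f) (cjp α β g) (cjp α β c) :=
  h.conj (affEquiv α β hα) (cjp_spec α β hα f) (cjp_spec α β hα g) (cjp_spec α β hα c)

theorem SolM_cj {f g c : ℂ[X]} (α β : ℂ) (hα : α ≠ 0) (M : ℕ)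
    (h : (SolM M (cjp α β f) (cjp α β g) (cjp α β c)).Finite) : (SolM M f g c).Finite :=
  SolM_conj (affEquiv α β hα) (cjp_spec α β hα f) (cjp_spec α β hα g) (cjp_spec α β hα c) M h

theorem Hyp.natDegree_pos {f g c : ℂ[X]} (h : Hyp f g c) : 1 ≤ f.natDegree := by
  by_contra hd
  have hd0 : f.natDegree = 0 := by omega
  refine h.free [true] [true, true] (by simp) (by simp) (by simp) ?_
  rw [eq_C_of_natDegree_eq_zero hd0]
  funext z
  simp [wd_true, wd_nil]

theorem natDegree_cjp (α β : ℂ) (hα : α ≠ 0) (f : ℂ[X]) (hf : 1 ≤ f.natDegree) :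
    (cjp α β f).natDegree = f.natDegree := by
  have h1 : (C α * X + C β : ℂ[X]).natDegree = 1 := natDegree_linear hα
  rw [cjp, natDegree_C_mul (inv_ne_zero hα), natDegree_sub_C, natDegree_comp, h1, mul_one]

theorem stmt_of_hyp (f g c : ℂ[X])
    (hcf : ∀ n : ℕ, 1 ≤ n → c ≠ (fun q : ℂ[X] => q.comp f)^[n] X)
    (hcg : ∀ n : ℕ, 1 ≤ n → c ≠ (fun q : ℂ[X] => q.comp g)^[n] X)
    (hfree : ∀ w₁ w₂ : List Bool, w₁ ≠ [] → w₂ ≠ [] → w₁ ≠ w₂ → wd f g w₁ ≠ wd f g w₂) : Hyp f g c := by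
  have ev : ∀ (p : ℂ[X]) (n : ℕ) (z : ℂ), ((fun q : ℂ[X] => q.comp p)^[n] X).eval z = (fun x => p.eval x)^[n] z := by
    intro p n
    induction n with
    | zero => intro z; simp
    | succ n ih => intro z; rw [Function.iterate_succ_apply', Function.iterate_succ_apply, eval_comp, ih]
  have fin : ∀ (p : ℂ[X]) (n : ℕ), c ≠ (fun q : ℂ[X] => q.comp p)^[n] X →
      {l : ℂ | (fun x => p.eval x)^[n] l = c.eval l}.Finite := by
    intro p n hne
    have h0 : c - (fun q : ℂ[X] => q.comp p)^[n] X ≠ 0 := sub_ne_zero.2 hne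
    refine (finite_setOf_isRoot h0).subset ?_
    intro l hl
    simp only [Set.mem_setOf_eq] at hl ⊢
    rw [IsRoot.def, eval_sub, ev, hl, sub_self]
  exact ⟨fun m hm => fin f m (hcf m hm), fun m hm => fin g m (hcg m hm), hfree⟩

end SetupSection


theorem kl_exists_hom_aux {E K L : Type} [Field E] [Countable E] [Field K] [Field L] [Algebra E K]
    [Algebra E L] [IsAlgClosed K] [IsAlgClosed L] (hK : ℵ₀ < #K) (hKL : #K = #L) :
    ∃ φ : K →+* L, φ.comp (algebraMap E K) = algebraMap E L := by
  obtain ⟨ι, v, hv⟩ := exists_isTranscendenceBasis' E K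
  obtain ⟨κ, w, hw⟩ := exists_isTranscendenceBasis' E L
  have hE : #E ≤ ℵ₀ := Cardinal.mk_le_aleph0
  have h1 := IsAlgClosed.cardinal_eq_cardinal_transcendence_basis_of_aleph0_lt v hv hE hK
  have h2 := IsAlgClosed.cardinal_eq_cardinal_transcendence_basis_of_aleph0_lt w hw hE (hKL ▸ hK)
  simp only [Cardinal.lift_id] at h1 h2
  have h3 : #ι = #κ := by rw [← h1, ← h2, hKL]
  obtain ⟨e⟩ := Cardinal.eq.1 h3
  let ψ : Algebra.adjoin E (Set.range v) →ₐ[E] L :=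
    ((MvPolynomial.aeval w).comp (MvPolynomial.rename e)).comp hv.1.aevalEquiv.symm.toAlgHom
  have hψ : Function.Injective ψ := by
    have hw1 : Function.Injective (MvPolynomial.aeval w : MvPolynomial κ E →ₐ[E] L) := hw.1
    have : Function.Injective (((MvPolynomial.aeval w).comp (MvPolynomial.rename e) :
        MvPolynomial ι E →ₐ[E] L)) := hw1.comp (MvPolynomial.rename_injective e e.injective)
    exact this.comp hv.1.aevalEquiv.symm.injective
  letI : Algebra (Algebra.adjoin E (Set.range v)) L := ψ.toRingHom.toAlgebra
  haveI : FaithfulSMul (Algebra.adjoin E (Set.range v)) L :=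
    (faithfulSMul_iff_algebraMap_injective _ _).2 hψ
  haveI : Algebra.IsAlgebraic (Algebra.adjoin E (Set.range v)) K := hv.isAlgebraic
  let Φ : K →ₐ[Algebra.adjoin E (Set.range v)] L := IsAlgClosed.lift
  refine ⟨Φ.toRingHom, ?_⟩
  ext x
  have : Φ (algebraMap (Algebra.adjoin E (Set.range v)) K
    (algebraMap E (Algebra.adjoin E (Set.range v)) x)) = ψ (algebraMap E _ x) := Φ.commutes _
  rw [ψ.commutes] at this
  exact this

theorem kl_exists_hom {E : Type} [Field E] [Countable E] (i j : E →+* ℂ) :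
    ∃ φ : ℂ →+* ℂ, φ.comp i = j := by
  have hK : ℵ₀ < #ℂ := by rw [Cardinal.mk_complex]; exact Cardinal.aleph0_lt_continuum
  exact @kl_exists_hom_aux E ℂ ℂ _ _ _ _ i.toAlgebra j.toAlgebra _ _ hK rfl

/-- Lifting roots of the minimal polynomial. -/
theorem kl_lift {R : Type} [CommRing R] [IsDomain R] [IsIntegrallyClosed R] [Countable R]
    (i : R →+* ℂ) (hi : Function.Injective i) (Y : Set ℂ) (hY : Y.Finite)
    (hYalg : ∀ y ∈ Y, ∃ p : R[X], p ≠ 0 ∧ p.eval₂ i y = 0) :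
    ∃ h : ℕ, ∀ (w : ℂ), i.IsIntegralElem w →
     ∀ k : ℕ, (∃ q : ℂ[X], q ≠ 0 ∧ q.natDegree ≤ k ∧ (∀ n, q.coeff n ∈ Subfield.closure Y) ∧
        q.eval w = 0) → 
    ∃ p : R[X], p.Monic ∧ p.eval₂ i w = 0 ∧ p.natDegree ≤ h * k ∧
      ∀ j : R →+* ℂ, Function.Injective j → ∀ w' : ℂ, p.eval₂ j w' = 0 →
        ∃ φ : ℂ →+* ℂ, φ.comp i = j ∧ φ w = w' := by
  letI : Algebra R ℂ := i.toAlgebra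
  have hia : algebraMap R ℂ = i := rfl
  haveI : FaithfulSMul R ℂ := (faithfulSMul_iff_algebraMap_injective _ _).2 hi
  let F := FractionRing R
  letI : Algebra F ℂ := FractionRing.liftAlgebra R ℂ
  haveI : IsScalarTower R F ℂ := inferInstance
  let L := IntermediateField.adjoin F Y
  have hYint : ∀ y ∈ Y, IsIntegral F y := by
    intro y hy
    obtain ⟨p, hp0, hp⟩ := hYalg y hy
    refine IsAlgebraic.isIntegral ⟨p.map (algebraMap R F), ?_, ?_⟩
    · exact (Polynomial.map_ne_zero_iff (IsFractionRing.injective R F)).2 hp0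
    · rw [Polynomial.aeval_map_algebraMap]; exact hp
  haveI : Finite Y := hY
  haveI : FiniteDimensional F L := IntermediateField.finiteDimensional_adjoin hYint
  refine ⟨Module.finrank F L, ?_⟩
  intro w hw k hk
  have hwR : IsIntegral R w := hw
  have hwF : IsIntegral F w := hwR.tower_top
  have hmin : minpoly F w = (minpoly R w).map (algebraMap R F) :=
    minpoly.isIntegrallyClosed_eq_field_fractions' F hwR
  refine ⟨minpoly R w, minpoly.monic hwR, minpoly.aeval R w, ?_, ?_⟩
  · obtain ⟨q, hq0, hqk, hqc, hqw⟩ := hk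
    have hwL : IsIntegral L w := hwF.tower_top
    have hcl : ∀ x ∈ Subfield.closure Y, x ∈ L.toSubfield := by
      intro x hx
      exact (Subfield.closure_le.2 (by
        intro y hy; exact IntermediateField.subset_adjoin F Y hy)) hx
    have hlift : ∃ q' : L[X], q'.map (algebraMap L ℂ) = q := by
      have : q ∈ Polynomial.lifts (algebraMap L ℂ) := by
        rw [Polynomial.lifts_iff_coeff_lifts]
        intro n
        exact ⟨⟨q.coeff n, hcl _ (hqc n)⟩, rfl⟩
      exact this
    obtain ⟨q', hq'⟩ := hlift
    have hq'0 : q' ≠ 0 := by rintro rfl; simp at hq'; exact hq0 hq'.symm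
    have hq'w : aeval w q' = 0 := by
      rw [← Polynomial.aeval_map_algebraMap ℂ, hq']; simpa [Polynomial.aeval_def] using hqw
    have hd1 : (minpoly L w).natDegree ≤ k := by
      calc (minpoly L w).natDegree ≤ q'.natDegree := Polynomial.natDegree_le_natDegree (minpoly.degree_le_of_ne_zero _ _ hq'0 hq'w)
        _ = q.natDegree := by rw [← hq', Polynomial.natDegree_map]
        _ ≤ k := hqk
    let M := IntermediateField.adjoin L {w}
    haveI : FiniteDimensional L M := IntermediateField.adjoin.finiteDimensional hwL
    haveI : FiniteDimensional F M := FiniteDimensional.trans F L M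
    have hd2 : Module.finrank L M = (minpoly L w).natDegree := IntermediateField.adjoin.finrank hwL
    have hwM : w ∈ M := IntermediateField.mem_adjoin_simple_self L w
    have hd3 : (minpoly F w).natDegree ≤ Module.finrank F M := by
      haveI : IsScalarTower F M ℂ := by
        refine IsScalarTower.of_algebraMap_eq fun x => ?_
        rfl
      have : minpoly F w = minpoly F (⟨w, hwM⟩ : M) := by
        rw [← minpoly.algebraMap_eq (algebraMap M ℂ).injective (⟨w, hwM⟩ : M)]; rfl
      rw [this]; exact minpoly.natDegree_le _
    have hd4 := Module.finrank_mul_finrank F L M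
    rw [hmin, Polynomial.natDegree_map_eq_of_injective (IsFractionRing.injective R F)] at hd3
    calc _ ≤ _ := hd3
      _ = _ := hd4.symm
      _ ≤ _ := by rw [hd2]; exact Nat.mul_le_mul_left _ hd1
  · intro j hj w' hw'
    let P : F[X] := minpoly F w
    haveI : Fact (Irreducible P) := ⟨minpoly.irreducible hwF⟩
    let jF : F →+* ℂ := IsFractionRing.lift hj
    have hjF : ∀ r, jF (algebraMap R F r) = j r := fun r => IsFractionRing.lift_algebraMap hj r
    have hj2 : P.eval₂ jF w' = 0 := by
      show (minpoly F w).eval₂ jF w' = 0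
      rw [hmin, Polynomial.eval₂_map]
      convert hw' using 2
      ext r; simp [hjF]
    have hi2 : P.eval₂ (algebraMap F ℂ) w = 0 := minpoly.aeval F w
    haveI : Countable F := by
      have hs : Function.Surjective (fun x : R × R => algebraMap R F x.1 / algebraMap R F x.2) := by
        intro z
        obtain ⟨x, y, _, h⟩ := IsFractionRing.div_surjective (A := R) z
        exact ⟨(x, y), h⟩
      exact hs.countable
    haveI : Countable (AdjoinRoot P) := by
      have : Countable F[X] := by
        apply Cardinal.mk_le_aleph0_iff.1
        refine Polynomial.cardinalMk_le_max.trans ?_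
        simp [Cardinal.mk_le_aleph0_iff, ‹Countable F›]
      exact (AdjoinRoot.mk_surjective (g := P)).countable
    let I : AdjoinRoot P →+* ℂ := AdjoinRoot.lift (algebraMap F ℂ) w hi2
    let J : AdjoinRoot P →+* ℂ := AdjoinRoot.lift jF w' hj2
    obtain ⟨φ, hφ⟩ := kl_exists_hom I J
    refine ⟨φ, ?_, ?_⟩
    · ext r
      have := congrArg (fun f => f (AdjoinRoot.of P (algebraMap R F r))) hφ
      have hI : I (AdjoinRoot.of P (algebraMap R F r)) = i r := by
        rw [AdjoinRoot.lift_of hi2, ← IsScalarTower.algebraMap_apply R F ℂ]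
        rfl
      have hJ : J (AdjoinRoot.of P (algebraMap R F r)) = j r := by
        rw [AdjoinRoot.lift_of hj2, hjF]
      simp only [RingHom.comp_apply, hI, hJ] at this
      exact this
    · have := congrArg (fun f => f (AdjoinRoot.root P)) hφ
      have hI : I (AdjoinRoot.root P) = w := AdjoinRoot.lift_root hi2
      have hJ : J (AdjoinRoot.root P) = w' := AdjoinRoot.lift_root hj2
      simp only [RingHom.comp_apply, hI, hJ] at this
      exact this


theorem kl_aeval_cons {r : ℕ} (t : Fin r → ℂ) (y : ℂ) (D : MvPolynomial (Fin (r+1)) ℤ) :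
    MvPolynomial.aeval (Fin.cons y t : Fin (r+1) → ℂ) D =
      ((MvPolynomial.finSuccEquiv ℤ r D).map
        (MvPolynomial.aeval t : MvPolynomial (Fin r) ℤ →ₐ[ℤ] ℂ).toRingHom).eval y := by
  induction D using MvPolynomial.induction_on with
  | C a => simp [MvPolynomial.finSuccEquiv_apply]
  | add p q hp hq => simp [hp, hq]
  | mul_X p i hp =>
    rw [map_mul, hp, map_mul, Polynomial.map_mul, Polynomial.eval_mul]
    congr 1
    refine Fin.cases ?_ (fun j => ?_) i
    · simp [MvPolynomial.finSuccEquiv_X_zero]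
    · simp [MvPolynomial.finSuccEquiv_X_succ]

/-- Cauchy estimate for polynomials. -/
theorem kl_cauchy (P : ℂ[X]) (ρ R : ℝ) (hρ : 0 < ρ) (h : ∀ y : ℂ, ‖y‖ = ρ → ‖P.eval y‖ ≤ R)
    (j : ℕ) : ‖P.coeff j‖ ≤ R / ρ ^ j := by
  have hd : ∀ n : ℕ, iteratedDeriv n (fun z => P.eval z) = fun z => (derivative^[n] P).eval z := by
    intro n
    induction n with
    | zero => simp
    | succ n ih =>
      rw [iteratedDeriv_succ, ih, Function.iterate_succ_apply']
      ext z; exact Polynomial.deriv _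
  have h1 := Complex.norm_iteratedDeriv_le_of_forall_mem_sphere_norm_le (c := 0) (C := R)
    (f := fun z => P.eval z) j hρ (P.differentiable.diffContOnCl)
    (fun z hz => h z (by simpa using hz))
  rw [hd] at h1
  have h2 : eval 0 (derivative^[j] P) = (j.factorial : ℂ) * P.coeff j := by
    rw [← Polynomial.coeff_zero_eq_eval_zero, Polynomial.coeff_iterate_derivative]
    simp [Nat.descFactorial_self]
  simp only [h2, norm_mul, Complex.norm_natCast, mul_div_assoc] at h1
  exact le_of_mul_le_mul_left h1 (by exact_mod_cast Nat.factorial_pos j)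

def klGen {r : ℕ} (t : Fin r → ℂ) : Prop :=
  Function.Injective (MvPolynomial.aeval t : MvPolynomial (Fin r) ℤ →ₐ[ℤ] ℂ)

theorem kl_gen_step {r : ℕ} (t : Fin r → ℂ) (ht : klGen t) :
    {y : ℂ | ¬ klGen (Fin.cons y t : Fin (r+1) → ℂ)}.Countable := by
  have hsub : {y : ℂ | ¬ klGen (Fin.cons y t : Fin (r+1) → ℂ)} ⊆
      ⋃ D : {D : MvPolynomial (Fin (r+1)) ℤ // D ≠ 0},
        {y | ((MvPolynomial.finSuccEquiv ℤ r D.1).map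
        (MvPolynomial.aeval t : MvPolynomial (Fin r) ℤ →ₐ[ℤ] ℂ).toRingHom).IsRoot y} := by
    intro y hy
    simp only [klGen, injective_iff_map_eq_zero, Set.mem_setOf_eq, not_forall] at hy
    obtain ⟨D, hD, hD0⟩ := hy
    refine Set.mem_iUnion.2 ⟨⟨D, hD0⟩, ?_⟩
    rw [kl_aeval_cons] at hD
    exact hD
  refine Set.Countable.mono hsub ?_
  haveI : Countable (MvPolynomial (Fin (r+1)) ℤ) := by
    apply Cardinal.mk_le_aleph0_iff.1
    exact MvPolynomial.cardinalMk_le_max.trans (by simp)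
  refine Set.countable_iUnion fun D => Set.Finite.countable ?_
  refine Polynomial.finite_setOfPred_isRoot ?_
  rw [Polynomial.map_ne_zero_iff ht]
  simpa using D.2

theorem kl_dense_circle (ρ : ℝ) (hρ : 0 < ρ) (S : Set ℂ) (hS : S.Countable) (F : ℂ → ℝ)
    (hF : Continuous F) (R : ℝ) (h : ∀ y, ‖y‖ = ρ → y ∉ S → F y ≤ R) :
    ∀ y, ‖y‖ = ρ → F y ≤ R := by
  have hc : (circleMap 0 ρ ⁻¹' S).Countable := hS.preimage_circleMap 0 hρ.ne'
  have hd := hc.dense_compl ℝ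
  have : ∀ θ : ℝ, F (circleMap 0 ρ θ) ≤ R := by
    have hcl : IsClosed {θ : ℝ | F (circleMap 0 ρ θ) ≤ R} :=
      isClosed_le (hF.comp (continuous_circleMap 0 ρ)) continuous_const
    intro θ
    have : closure ((circleMap 0 ρ ⁻¹' S)ᶜ) ⊆ {θ : ℝ | F (circleMap 0 ρ θ) ≤ R} := by
      refine closure_minimal ?_ hcl
      intro x hx
      exact h _ (by simp [abs_of_pos hρ]) hx
    exact this (hd θ)
  intro y hy
  have := this (Complex.arg y)
  rwa [show circleMap 0 ρ (Complex.arg y) = y by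
    rw [circleMap, zero_add, ← hy]; exact Complex.norm_mul_exp_arg_mul_I y] at this

theorem kl_exists_gen (r : ℕ) (ρ : Fin r → ℝ) (hρ : ∀ i, 0 < ρ i) :
    ∃ t : Fin r → ℂ, klGen t ∧ ∀ i, ‖t i‖ = ρ i := by
  induction r with
  | zero =>
    refine ⟨Fin.elim0, ?_, fun i => i.elim0⟩
    intro a b h
    rw [MvPolynomial.eq_C_of_isEmpty a, MvPolynomial.eq_C_of_isEmpty b] at h ⊢
    simp at h
    rw [h]
  | succ r ih =>
    obtain ⟨t, ht, htρ⟩ := ih (fun i => ρ i.succ) (fun i => hρ _)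
    have hc := kl_gen_step t ht
    have : ∃ y : ℂ, ‖y‖ = ρ 0 ∧ klGen (Fin.cons y t : Fin (r+1) → ℂ) := by
      by_contra hcon
      push Not at hcon
      have := kl_dense_circle (ρ 0) (hρ 0) _ hc (fun _ => 1) continuous_const 0
        (fun y hy hy2 => absurd (hcon y hy) hy2) (ρ 0 : ℂ) (by simp [abs_of_pos (hρ 0)])
      norm_num at this
    obtain ⟨y, hy, hg⟩ := this
    refine ⟨Fin.cons y t, hg, fun i => ?_⟩
    refine Fin.cases ?_ (fun j => ?_) i
    · simpa using hy
    · simpa using htρ j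

theorem kl_finite (r : ℕ) : ∀ (ρ : Fin r → ℝ) (_ : ∀ i, 1 < ρ i) (R : ℝ),
    {D : MvPolynomial (Fin r) ℤ | ∀ t : Fin r → ℂ, klGen t → (∀ i, ‖t i‖ = ρ i) →
      ‖MvPolynomial.aeval t D‖ ≤ R}.Finite := by
  induction r with
  | zero =>
    intro ρ hρ R
    obtain ⟨t, ht, htρ⟩ := kl_exists_gen 0 ρ (fun i => i.elim0)
    have hf : {n : ℤ | ‖n‖ ≤ R}.Finite := by
      have := (isCompact_closedBall (0:ℤ) R).finite_of_discrete
      refine this.subset ?_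
      intro n hn; simpa using hn
    refine (hf.image (MvPolynomial.C : ℤ → MvPolynomial (Fin 0) ℤ)).subset ?_
    intro D hD
    have := hD t ht htρ
    refine ⟨MvPolynomial.coeff 0 D, ?_, (MvPolynomial.eq_C_of_isEmpty D).symm⟩
    rw [MvPolynomial.eq_C_of_isEmpty D] at this
    simpa [Int.norm_eq_abs] using this
  | succ r ih =>
    intro ρ hρ R
    wlog hR : 0 ≤ R generalizing R
    · refine (this 0 le_rfl).subset ?_
      intro D hD t ht htρ
      exact (hD t ht htρ).trans (le_of_not_ge hR)
    let S : Set (MvPolynomial (Fin r) ℤ) := {D | ∀ t : Fin r → ℂ, klGen t →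
      (∀ i, ‖t i‖ = ρ i.succ) → ‖MvPolynomial.aeval t D‖ ≤ R}
    have hS : S.Finite := ih (fun i => ρ i.succ) (fun i => hρ _) R
    have hρ0 : 0 < ρ 0 := zero_lt_one.trans (hρ 0)
    obtain ⟨J, hJ⟩ := pow_unbounded_of_one_lt ((S.ncard : ℝ) + 1) (hρ 0)
    have hcoef : ∀ D : MvPolynomial (Fin (r+1)) ℤ, (∀ t : Fin (r+1) → ℂ, klGen t →
        (∀ i, ‖t i‖ = ρ i) → ‖MvPolynomial.aeval t D‖ ≤ R) → ∀ j, ∀ t : Fin r → ℂ, klGen t →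
      (∀ i, ‖t i‖ = ρ i.succ) →
      ‖MvPolynomial.aeval t ((MvPolynomial.finSuccEquiv ℤ r D).coeff j)‖ ≤ R / ρ 0 ^ j := by
      intro D hD j t ht htρ
      set P := ((MvPolynomial.finSuccEquiv ℤ r D).map
        (MvPolynomial.aeval t : MvPolynomial (Fin r) ℤ →ₐ[ℤ] ℂ).toRingHom) with hP
      have h1 : ∀ y, ‖y‖ = ρ 0 → ‖P.eval y‖ ≤ R := by
        refine kl_dense_circle (ρ 0) hρ0 _ (kl_gen_step t ht) (fun y => ‖P.eval y‖)
          (P.continuous.norm) R ?_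
        intro y hy hyS
        have hg : klGen (Fin.cons y t : Fin (r+1) → ℂ) := by simpa using hyS
        have := hD _ hg (fun i => by
          refine Fin.cases ?_ (fun j => ?_) i
          · simpa using hy
          · simpa using htρ j)
        rwa [kl_aeval_cons] at this
      have h2 := kl_cauchy P (ρ 0) R hρ0 h1 j
      rw [hP, Polynomial.coeff_map] at h2
      exact h2
    have hS2 : ∀ D, (∀ t : Fin (r+1) → ℂ, klGen t →
        (∀ i, ‖t i‖ = ρ i) → ‖MvPolynomial.aeval t D‖ ≤ R) → ∀ j,
        (MvPolynomial.finSuccEquiv ℤ r D).coeff j ∈ S := by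
      intro D hD j t ht htρ
      exact (hcoef D hD j t ht htρ).trans (div_le_self hR (one_le_pow₀ (hρ 0).le))
    have hzero : ∀ D, (∀ t : Fin (r+1) → ℂ, klGen t →
        (∀ i, ‖t i‖ = ρ i) → ‖MvPolynomial.aeval t D‖ ≤ R) → ∀ j, J ≤ j →
        (MvPolynomial.finSuccEquiv ℤ r D).coeff j = 0 := by
      intro D hD j hj
      by_contra hne
      set A := (MvPolynomial.finSuccEquiv ℤ r D).coeff j with hA
      have hmem : ∀ k ∈ Finset.range (S.ncard + 1), (k : MvPolynomial (Fin r) ℤ) * A ∈ S := by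
        intro k hk t ht htρ
        have h1 := hcoef D hD j t ht htρ
        rw [map_mul, norm_mul, map_natCast, Complex.norm_natCast]
        have hk1 : (k : ℝ) ≤ S.ncard + 1 := by
          have := Finset.mem_range.1 hk
          exact_mod_cast this.le
        have hk2 : (k : ℝ) ≤ ρ 0 ^ j := by
          calc (k:ℝ) ≤ _ := hk1
            _ ≤ ρ 0 ^ J := hJ.le
            _ ≤ ρ 0 ^ j := pow_le_pow_right₀ (hρ 0).le hj
        calc (k:ℝ) * _ ≤ ρ 0 ^ j * (R / ρ 0 ^ j) := by gcongr
          _ = R := by field_simp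
      have hinj : Set.InjOn (fun k : ℕ => (k : MvPolynomial (Fin r) ℤ) * A)
          (Finset.range (S.ncard + 1)) := by
        intro a _ b _ hab
        exact_mod_cast mul_right_cancel₀ hne hab
      have hcard := Finset.card_le_card_of_injOn (s := Finset.range (S.ncard + 1))
        (t := hS.toFinset) (fun k : ℕ => (k : MvPolynomial (Fin r) ℤ) * A)
        (fun k hk => by simpa using hmem k hk) hinj
      rw [Finset.card_range, ← Set.ncard_eq_toFinset_card S hS] at hcard
      omega
    -- finite by injecting into functions
    have hfin : (Set.pi Set.univ (fun _ : Fin J => S)).Finite := Set.Finite.pi' (fun _ => hS) |>.subset (by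
      intro x hx; simpa using hx)
    refine Set.Finite.of_finite_image (f := fun D => fun j : Fin J =>
      (MvPolynomial.finSuccEquiv ℤ r D).coeff j) (hfin.subset ?_) ?_
    · rintro _ ⟨D, hD, rfl⟩
      intro j _
      exact hS2 D hD j
    · intro D hD D' hD' hDD
      apply (MvPolynomial.finSuccEquiv ℤ r).injective
      ext1 j
      rcases lt_or_ge j J with hj | hj
      · exact congrFun hDD ⟨j, hj⟩
      · rw [hzero D hD j hj, hzero D' hD' j hj]

theorem kl_torus_bdd {r : ℕ} (ρ : Fin r → ℝ) (D : MvPolynomial (Fin r) ℤ) :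
    ∃ B : ℝ, 0 ≤ B ∧ ∀ t : Fin r → ℂ, (∀ i, ‖t i‖ = ρ i) → ‖MvPolynomial.aeval t D‖ ≤ B := by
  refine ⟨∑ m ∈ D.support, ‖((MvPolynomial.coeff m D : ℤ):ℂ)‖ * ∏ i, |ρ i| ^ m i, ?_, ?_⟩
  · exact Finset.sum_nonneg fun m _ => by positivity
  intro t ht
  rw [MvPolynomial.aeval_def, MvPolynomial.eval₂_eq']
  refine (norm_sum_le _ _).trans ?_
  refine Finset.sum_le_sum fun m _ => ?_
  rw [norm_mul, norm_prod]
  refine mul_le_mul (by simp) (le_of_eq ?_) (by positivity) (by positivity)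
  refine Finset.prod_congr rfl fun i _ => ?_
  rw [norm_pow, ht i, ← ht i, abs_norm]

/-- radii such that `s` is bounded below on the torus -/
theorem kl_radii (r : ℕ) : ∀ (s : MvPolynomial (Fin r) ℤ), s ≠ 0 →
    ∃ ρ : Fin r → ℝ, (∀ i, 1 < ρ i) ∧ ∃ δ > 0, ∀ t : Fin r → ℂ, (∀ i, ‖t i‖ = ρ i) →
      δ ≤ ‖MvPolynomial.aeval t s‖ := by
  induction r with
  | zero =>
    intro s hs
    refine ⟨Fin.elim0, fun i => i.elim0, 1, one_pos, fun t _ => ?_⟩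
    rw [MvPolynomial.eq_C_of_isEmpty s] at hs ⊢
    have h0 : MvPolynomial.coeff 0 s ≠ 0 := by
      intro h; rw [h] at hs; simp at hs
    simp only [MvPolynomial.aeval_C]
    have := Int.one_le_abs h0
    simp
    exact_mod_cast this
  | succ r ih =>
    intro s hs
    set q := MvPolynomial.finSuccEquiv ℤ r s with hq
    have hq0 : q ≠ 0 := by simpa [hq] using hs
    obtain ⟨ρ', hρ', δ, hδ, hb⟩ := ih q.leadingCoeff (by simpa using hq0)
    choose B hB0 hB using fun j => kl_torus_bdd ρ' (q.coeff j)
    set M := ∑ j ∈ Finset.range q.natDegree, B j with hM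
    have hM0 : 0 ≤ M := Finset.sum_nonneg fun j _ => hB0 j
    set ρ0 : ℝ := (M + 1) / δ + 2 with hρ0
    have hρ01 : 1 < ρ0 := by have : 0 ≤ (M+1)/δ := by positivity
                             linarith
    refine ⟨Fin.cons ρ0 ρ', ?_, min δ 1, by positivity, ?_⟩
    · intro i
      refine Fin.cases ?_ (fun j => ?_) i
      · simpa using hρ01
      · simpa using hρ' j
    · intro t ht
      have ht0 : ‖t 0‖ = ρ0 := by simpa using ht 0
      have ht' : ∀ i, ‖Fin.tail t i‖ = ρ' i := fun i => by simpa [Fin.tail] using ht i.succ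
      rw [← Fin.cons_self_tail t, kl_aeval_cons, ← hq, Polynomial.eval_map, Polynomial.eval₂_eq_sum_range,
        Finset.sum_range_succ]
      have hlead : δ * ρ0 ^ q.natDegree ≤ ‖(MvPolynomial.aeval (Fin.tail t) :
          MvPolynomial (Fin r) ℤ →ₐ[ℤ] ℂ).toRingHom (q.coeff q.natDegree) * t 0 ^ q.natDegree‖ := by
        rw [norm_mul, norm_pow, ht0]
        have := hb _ ht'
        gcongr
        exact this
      have hρpow : ρ0 ^ (q.natDegree - 1) ≤ ρ0 ^ q.natDegree :=
        pow_le_pow_right₀ hρ01.le (Nat.sub_le _ _)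
      have hrest : ‖∑ j ∈ Finset.range q.natDegree, (MvPolynomial.aeval (Fin.tail t) :
          MvPolynomial (Fin r) ℤ →ₐ[ℤ] ℂ).toRingHom (q.coeff j) * t 0 ^ j‖ ≤
          M * ρ0 ^ (q.natDegree - 1) := by
        refine (norm_sum_le _ _).trans ?_
        rw [hM, Finset.sum_mul]
        refine Finset.sum_le_sum fun j hj => ?_
        rw [norm_mul, norm_pow, ht0]
        have h1 := hB j _ ht'
        have : j ≤ q.natDegree - 1 := by have := Finset.mem_range.1 hj; omega
        exact mul_le_mul h1 (pow_le_pow_right₀ hρ01.le this) (by positivity) (hB0 j)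
      set U := ∑ j ∈ Finset.range q.natDegree, (MvPolynomial.aeval (Fin.tail t) :
          MvPolynomial (Fin r) ℤ →ₐ[ℤ] ℂ).toRingHom (q.coeff j) * t 0 ^ j with hU
      set W := (MvPolynomial.aeval (Fin.tail t) :
          MvPolynomial (Fin r) ℤ →ₐ[ℤ] ℂ).toRingHom (q.coeff q.natDegree) * t 0 ^ q.natDegree
      rcases Nat.eq_zero_or_pos q.natDegree with hd | hd
      · have hU0 : U = 0 := by rw [hU, hd]; simp
        rw [hU0, zero_add]
        rw [hd, pow_zero, mul_one] at hlead
        exact (min_le_left _ _).trans hlead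
      · have e : ρ0 ^ q.natDegree = ρ0 * ρ0 ^ (q.natDegree - 1) := by
          rw [← pow_succ', Nat.sub_add_cancel hd]
        rw [e] at hlead
        have h1 : 1 ≤ ρ0 ^ (q.natDegree - 1) := one_le_pow₀ hρ01.le
        have h2 : M + 1 ≤ δ * ρ0 := by
          rw [hρ0, mul_add, mul_div_cancel₀ _ hδ.ne']; linarith
        have h3 : (M + 1) * ρ0 ^ (q.natDegree - 1) ≤ δ * (ρ0 * ρ0 ^ (q.natDegree - 1)) := by
          rw [← mul_assoc]; gcongr
        have h4 : ‖W‖ - ‖U‖ ≤ ‖U + W‖ := by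
          have := norm_sub_le (U + W) U
          rw [add_sub_cancel_left] at this
          linarith
        refine (min_le_right _ _).trans ?_
        change 1 ≤ ‖U + W‖
        nlinarith


theorem kl_gen_injective {r : ℕ} {t : Fin r → ℂ} (ht : klGen t) : Function.Injective t := by
  intro a b hab
  have : (MvPolynomial.X a : MvPolynomial (Fin r) ℤ) = MvPolynomial.X b := ht (by simpa using hab)
  exact MvPolynomial.X_injective this

theorem kl_basis (Y : Set ℂ) (hY : Y.Finite) : ∃ (r : ℕ) (t : Fin r → ℂ), klGen t ∧ (∀ i, t i ∈ Y) ∧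
    (∀ y ∈ Y, ∃ p : (MvPolynomial (Fin r) ℤ)[X], p ≠ 0 ∧
      p.eval₂ (MvPolynomial.aeval t : MvPolynomial (Fin r) ℤ →ₐ[ℤ] ℂ).toRingHom y = 0) ∧
    ∃ s : MvPolynomial (Fin r) ℤ, s ≠ 0 ∧ ∀ y ∈ Y,
      (MvPolynomial.aeval t : MvPolynomial (Fin r) ℤ →ₐ[ℤ] ℂ).toRingHom.IsIntegralElem
        (MvPolynomial.aeval t s * y) := by
  classical
  let Q : ℕ → Prop := fun r => ∃ t : Fin r → ℂ, klGen t ∧ ∀ i, t i ∈ Y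
  have hQ0 : Q 0 := by
    obtain ⟨t, ht, _⟩ := kl_exists_gen 0 (fun _ => 1) (fun _ => one_pos)
    exact ⟨t, ht, fun i => i.elim0⟩
  have hQb : ∀ r, Q r → r ≤ hY.toFinset.card := by
    rintro r ⟨t, ht, htY⟩
    have := Finset.card_le_card_of_injOn (s := Finset.univ) (t := hY.toFinset) t
      (fun i _ => by simpa using htY i) ((kl_gen_injective ht).injOn)
    simpa using this
  obtain ⟨r, ⟨t, ht, htY⟩, hmax⟩ : ∃ r, Q r ∧ ¬ Q (r+1) := by
    by_contra hcon
    push Not at hcon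
    have : ∀ n, Q n := fun n => Nat.rec hQ0 (fun n h => hcon n h) n
    have := hQb _ (this (hY.toFinset.card + 1))
    omega
  have halg : ∀ y ∈ Y, ∃ p : (MvPolynomial (Fin r) ℤ)[X], p ≠ 0 ∧
      p.eval₂ (MvPolynomial.aeval t : MvPolynomial (Fin r) ℤ →ₐ[ℤ] ℂ).toRingHom y = 0 := by
    intro y hy
    have : ¬ klGen (Fin.cons y t : Fin (r+1) → ℂ) := by
      intro h
      refine hmax ⟨_, h, fun i => ?_⟩
      refine Fin.cases ?_ (fun j => ?_) i
      · simpa using hy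
      · simpa using htY j
    simp only [klGen, injective_iff_map_eq_zero, not_forall] at this
    obtain ⟨D, hD, hD0⟩ := this
    rw [kl_aeval_cons, Polynomial.eval_map] at hD
    exact ⟨_, by simpa using hD0, hD⟩
  refine ⟨r, t, ht, htY, halg, ?_⟩
  let i := (MvPolynomial.aeval t : MvPolynomial (Fin r) ℤ →ₐ[ℤ] ℂ).toRingHom
  letI : Algebra (MvPolynomial (Fin r) ℤ) ℂ := i.toAlgebra
  have h1 : ∀ y : Y, ∃ a : MvPolynomial (Fin r) ℤ, a ≠ 0 ∧ i.IsIntegralElem (i a * y.1) := by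
    intro y
    obtain ⟨p, hp, hp0⟩ := halg y.1 y.2
    have : IsAlgebraic (MvPolynomial (Fin r) ℤ) y.1 := ⟨p, hp, hp0⟩
    obtain ⟨a, ha, h⟩ := this.exists_integral_multiple
    refine ⟨a, ha, ?_⟩
    rw [Algebra.smul_def] at h
    exact h
  choose a ha hintg using h1
  haveI : Fintype Y := hY.fintype
  refine ⟨∏ y : Y, a y, Finset.prod_ne_zero_iff.2 fun y _ => ha y, ?_⟩
  intro y hy
  have : (MvPolynomial.aeval t (∏ y : Y, a y) * y : ℂ) =
      i (∏ z ∈ Finset.univ.erase ⟨y, hy⟩, a z) * (i (a ⟨y, hy⟩) * y) := by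
    rw [← Finset.mul_prod_erase Finset.univ a (Finset.mem_univ (⟨y, hy⟩ : Y)), map_mul]
    change i _ * i _ * y = _
    ring
  rw [this]
  exact RingHom.IsIntegralElem.mul i (RingHom.isIntegralElem_map i) (hintg ⟨y, hy⟩)

/-- The arithmetic toolbox. -/
structure KL (Y : Set ℂ) (O : Subring ℂ) (s : ℂ) (T : Set (ℂ →+* ℂ)) (B : ℝ) : Prop where
  s_ne : s ≠ 0
  s_mem : s ∈ O
  s_cl : s ∈ Subfield.closure Y
  y_mem : ∀ y ∈ Y, s * y ∈ O
  val : ∀ z : ℂ, (∀ V : ValuationSubring ℂ, O ≤ V.toSubring → z ∈ V) → z ∈ O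
  one_le : 1 ≤ B
  y_le : ∀ φ ∈ T, ∀ y ∈ Y, ‖φ y‖ ≤ B
  s_le : ∀ φ ∈ T, ‖φ s‖ ≤ B
  s_inv_le : ∀ φ ∈ T, ‖φ s⁻¹‖ ≤ B
  nonempty : T.Nonempty
  northcott : ∀ (k C : ℕ) (R : ℝ), {z : ℂ | s ^ C * z ∈ O ∧ (∀ φ ∈ T, ‖φ z‖ ≤ R) ∧
    ∃ q : ℂ[X], q ≠ 0 ∧ q.natDegree ≤ k ∧ (∀ n, q.coeff n ∈ Subfield.closure Y) ∧
      q.eval z = 0}.Finite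

theorem kl_integral_bdd {r : ℕ} (t : Fin r → ℂ) (ρ : Fin r → ℝ) (z : ℂ)
    (hz : (MvPolynomial.aeval t : MvPolynomial (Fin r) ℤ →ₐ[ℤ] ℂ).toRingHom.IsIntegralElem z) :
    ∃ B : ℝ, ∀ φ : ℂ →+* ℂ, (∀ i, ‖φ (t i)‖ = ρ i) → ‖φ z‖ ≤ B := by
  obtain ⟨p, hp, hpz⟩ := hz
  choose B hB0 hB using fun j => kl_torus_bdd ρ (p.coeff j)
  refine ⟨1 + ∑ j ∈ Finset.range p.natDegree, B j, ?_⟩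
  intro φ hφ
  set M := ∑ j ∈ Finset.range p.natDegree, B j with hM
  have hM0 : 0 ≤ M := Finset.sum_nonneg fun j _ => hB0 j
  by_contra hcon
  push Not at hcon
  have hcomp : ∀ D : MvPolynomial (Fin r) ℤ, φ (MvPolynomial.aeval t D) =
      MvPolynomial.aeval (fun i => φ (t i)) D := by
    intro D
    induction D using MvPolynomial.induction_on with
    | C a => simp
    | add p q hp hq => simp [hp, hq]
    | mul_X p i hp => simp [hp]
  have h1 : φ z ^ p.natDegree = - ∑ j ∈ Finset.range p.natDegree,
      MvPolynomial.aeval (fun i => φ (t i)) (p.coeff j) * φ z ^ j := by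
    have := congrArg φ hpz
    rw [Polynomial.eval₂_eq_sum_range, Finset.sum_range_succ, hp.coeff_natDegree, map_add,
      map_one, one_mul, map_sum, map_zero, map_pow] at this
    rw [eq_neg_iff_add_eq_zero, add_comm, ← this]
    congr 1
    refine Finset.sum_congr rfl fun j _ => ?_
    rw [map_mul, map_pow, ← hcomp]
    rfl
  have hz1 : 1 < ‖φ z‖ := by linarith
  rcases Nat.eq_zero_or_pos p.natDegree with hd | hd
  · rw [hd] at h1; simp at h1
  have h2 : ‖φ z‖ ^ p.natDegree ≤ M * ‖φ z‖ ^ (p.natDegree - 1) := by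
    rw [← norm_pow, h1, norm_neg]
    refine (norm_sum_le _ _).trans ?_
    rw [hM, Finset.sum_mul]
    refine Finset.sum_le_sum fun j hj => ?_
    rw [norm_mul, norm_pow]
    have : j ≤ p.natDegree - 1 := by have := Finset.mem_range.1 hj; omega
    exact mul_le_mul (hB j _ hφ) (pow_le_pow_right₀ hz1.le this) (by positivity) (hB0 j)
  have e : ‖φ z‖ ^ p.natDegree = ‖φ z‖ * ‖φ z‖ ^ (p.natDegree - 1) := by
    rw [← pow_succ', Nat.sub_add_cancel hd]
  rw [e] at h2
  have := le_of_mul_le_mul_right h2 (by positivity)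
  linarith

theorem exists_KL (Y : Set ℂ) (hY : Y.Finite) : ∃ O s T B, KL Y O s T B := by
  obtain ⟨r, t, ht, htY, halg, s, hs, hsY⟩ := kl_basis Y hY
  obtain ⟨ρ, hρ, δ, hδ, hδs⟩ := kl_radii r s hs
  set i := (MvPolynomial.aeval t : MvPolynomial (Fin r) ℤ →ₐ[ℤ] ℂ).toRingHom with hi
  have hinj : Function.Injective i := ht
  haveI : Countable (MvPolynomial (Fin r) ℤ) := by
    apply Cardinal.mk_le_aleph0_iff.1
    exact MvPolynomial.cardinalMk_le_max.trans (by simp)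
  letI : Algebra (MvPolynomial (Fin r) ℤ) ℂ := i.toAlgebra
  let O : Subring ℂ := (integralClosure (MvPolynomial (Fin r) ℤ) ℂ).toSubring
  have hO : ∀ z, z ∈ O ↔ i.IsIntegralElem z := fun z => Iff.rfl
  let T : Set (ℂ →+* ℂ) := {φ | ∀ j, ‖φ (t j)‖ = ρ j}
  have hcomp : ∀ (φ : ℂ →+* ℂ) (D : MvPolynomial (Fin r) ℤ), φ (i D) =
      MvPolynomial.aeval (fun i => φ (t i)) D := by
    intro φ D
    change φ (MvPolynomial.aeval t D) = _
    induction D using MvPolynomial.induction_on with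
    | C a => simp
    | add p q hp hq => simp [hp, hq]
    | mul_X p i hp => simp [hp]
  have hbd : ∀ y : Y, ∃ B : ℝ, ∀ φ ∈ T, ‖φ (i s * y)‖ ≤ B := fun y => 
    kl_integral_bdd t ρ _ (hsY y.1 y.2)
  choose B1 hB1 using hbd
  obtain ⟨B2, hB20, hB2⟩ := kl_torus_bdd ρ s
  haveI : Fintype Y := hY.fintype
  have hsinv : ∀ φ ∈ T, ‖φ (i s)⁻¹‖ ≤ δ⁻¹ := by
    intro φ hφ
    rw [map_inv₀, norm_inv, hcomp]
    exact inv_anti₀ hδ (hδs _ hφ)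
  have his : i s ≠ 0 := by simpa using (map_ne_zero_iff i hinj).2 hs
  set B : ℝ := 1 + B2 + δ⁻¹ + ∑ y : Y, δ⁻¹ * |B1 y| with hB
  have hsum : 0 ≤ ∑ y : Y, δ⁻¹ * |B1 y| := Finset.sum_nonneg fun y _ => by positivity
  have hδ' : 0 < δ⁻¹ := by positivity
  have hsle : ∀ φ ∈ T, ‖φ (i s)‖ ≤ B := by
    intro φ hφ
    rw [hcomp]
    have := hB2 _ hφ
    linarith
  refine ⟨O, i s, T, B, his, ?_, ?_, ?_, ?_, by linarith, ?_, hsle, ?_, ?_, ?_⟩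
  · exact (hO _).2 (RingHom.isIntegralElem_map i)
  · have : ∀ D : MvPolynomial (Fin r) ℤ, i D ∈ Subfield.closure Y := by
      intro D
      change MvPolynomial.aeval t D ∈ _
      induction D using MvPolynomial.induction_on with
      | C a => simp
      | add p q hp hq => rw [map_add]; exact add_mem hp hq
      | mul_X p i hp =>
        rw [map_mul, MvPolynomial.aeval_X]
        exact mul_mem hp (Subfield.subset_closure (htY i))
    exact this s
  · intro y hy; exact (hO _).2 (hsY y hy)
  · intro z hz
    have h1 : z ∈ (⨅ V : {V : ValuationSubring ℂ // (O : Set ℂ) ⊆ V.toSubring}, V.1.toSubring) := by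
      rw [Subring.mem_iInf]
      rintro ⟨V, hV⟩
      exact hz V hV
    rw [iInf_valuationSubring_superset] at h1
    have h2 : IsIntegral (Subring.closure (O : Set ℂ)) z := h1
    have h3 : IsIntegral (integralClosure (MvPolynomial (Fin r) ℤ) ℂ) z := by
      obtain ⟨p, hp, hpz⟩ := h2
      have hle : Subring.closure (O : Set ℂ) ≤ O := by rw [Subring.closure_eq]
      refine ⟨p.map (Subring.inclusion hle : _ →+* O), hp.map _, ?_⟩
      rw [Polynomial.eval₂_map]
      exact hpz
    exact isIntegral_trans (R := MvPolynomial (Fin r) ℤ) _ h3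
  · intro φ hφ y hy
    have h1 := hB1 ⟨y, hy⟩ φ hφ
    have h2 : φ y = φ (i s)⁻¹ * φ (i s * y) := by
      rw [← map_mul, inv_mul_cancel_left₀ his]
    rw [h2, norm_mul]
    calc _ ≤ δ⁻¹ * |B1 ⟨y, hy⟩| := by
          gcongr
          · exact hsinv φ hφ
          · exact h1.trans (le_abs_self _)
      _ ≤ ∑ y : Y, δ⁻¹ * |B1 y| := Finset.single_le_sum (f := fun y : Y => δ⁻¹ * |B1 y|)
          (fun y _ => by positivity) (Finset.mem_univ _)
      _ ≤ B := by linarith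
  · intro φ hφ
    exact (hsinv φ hφ).trans (by linarith)
  · obtain ⟨t', ht', htρ⟩ := kl_exists_gen r ρ (fun i => zero_lt_one.trans (hρ i))
    obtain ⟨h, hh⟩ := kl_lift i hinj Y hY halg
    obtain ⟨p, _, hp1, _, hp⟩ := hh 1 (i.isIntegralElem_one) 1 ⟨X - C 1, X_sub_C_ne_zero 1, (natDegree_X_sub_C _).le, by
      intro n
      rw [coeff_sub, coeff_X, coeff_C]
      refine sub_mem ?_ ?_ <;> split_ifs <;> first | exact one_mem _ | exact zero_mem _, by simp⟩
    obtain ⟨φ, hφ, _⟩ := hp (MvPolynomial.aeval t' : MvPolynomial (Fin r) ℤ →ₐ[ℤ] ℂ).toRingHom ht' 1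
      (by
        rw [Polynomial.eval₂_at_one] at hp1 ⊢
        rw [map_eq_zero_iff i hinj] at hp1
        rw [hp1, map_zero])
    refine ⟨φ, fun j => ?_⟩
    have := congrArg (fun f => f (MvPolynomial.X j)) hφ
    have h2 : φ (t j) = t' j := by simpa [hi] using this
    rw [h2, htρ]
  · intro k C R
    have hY' : (insert (i s) Y).Finite := hY.insert _
    obtain ⟨h, hh⟩ := kl_lift i hinj (insert (i s) Y) hY' (by
      intro y hy
      rcases Set.mem_insert_iff.1 hy with rfl | hy
      · exact ⟨X - Polynomial.C s, X_sub_C_ne_zero s, by simp⟩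
      · exact halg y hy)
    set R' : ℝ := B ^ C * R with hR'
    set M : ℝ := max R' 1 ^ (h * k) * (h * k).choose (h * k / 2) with hM
    have hS := kl_finite r ρ hρ M
    have hfin := Polynomial.bUnion_roots_finite i (h * k) hS
    refine Set.Finite.of_finite_image (f := fun z => i s ^ C * z) (hfin.subset ?_) ?_
    · rintro _ ⟨z, ⟨hzO, hzφ, q, hq0, hqk, hqc, hqz⟩, rfl⟩
      have hle : Subfield.closure Y ≤ Subfield.closure (insert (i s) Y) :=
        Subfield.closure_mono (Set.subset_insert _ _)
      have hsm : i s ∈ Subfield.closure (insert (i s) Y) :=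
        Subfield.subset_closure (Set.mem_insert _ _)
      obtain ⟨p, hpm, hpw, hpd, hp⟩ := hh (i s ^ C * z) hzO k ⟨q.scaleRoots (i s ^ C),
        scaleRoots_ne_zero hq0 _, by rwa [natDegree_scaleRoots], by
          intro n
          rw [coeff_scaleRoots]
          exact mul_mem (hle (hqc n)) (pow_mem (pow_mem hsm _) _), by
          have := scaleRoots_eval₂_mul (p := q) (RingHom.id ℂ) (i s ^ C) (r := z)
          simp only [RingHom.id_apply] at this
          rw [← Polynomial.eval₂_id, this, Polynomial.eval₂_id, hqz, mul_zero]⟩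
      refine Set.mem_biUnion (x := p) ⟨hpd, ?_⟩ ?_
      · intro n t' ht' htρ
        have hinj' : Function.Injective
          (MvPolynomial.aeval t' : MvPolynomial (Fin r) ℤ →ₐ[ℤ] ℂ).toRingHom := ht'
        have := Polynomial.coeff_bdd_of_roots_le (B := R') (d := h * k) (RingHom.id ℂ)
          (p := p.map (MvPolynomial.aeval t' : MvPolynomial (Fin r) ℤ →ₐ[ℤ] ℂ).toRingHom)
          (hpm.map _) (IsAlgClosed.splits _) (natDegree_map_le.trans hpd) (by
            intro w' hw'
            rw [Polynomial.map_id, mem_roots (hpm.map _).ne_zero, IsRoot, eval_map] at hw'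
            obtain ⟨φ, hφ, hφw⟩ := hp _ hinj' w' hw'
            have hφT : φ ∈ T := by
              intro j
              have := congrArg (fun f => f (MvPolynomial.X j)) hφ
              have h2 : φ (t j) = t' j := by simpa [hi] using this
              rw [h2, htρ]
            rw [← hφw, map_mul, map_pow, norm_mul, norm_pow]
            have h1 := hsle φ hφT
            have h2 := hzφ φ hφT
            rw [hR']
            gcongr) n
        rw [Polynomial.map_id, coeff_map] at this
        exact this
      · simp only [Finset.mem_coe, Multiset.mem_toFinset]
        rw [mem_roots (hpm.map _).ne_zero, IsRoot, eval_map]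
        exact hpw
    · intro a _ b _ hab
      exact mul_left_cancel₀ (pow_ne_zero _ his) hab

theorem KL.small {Y : Set ℂ} {O : Subring ℂ} {s : ℂ} {T : Set (ℂ →+* ℂ)} {B : ℝ} (h : KL Y O s T B)
    (Λ : Set ℂ) (hΛ : Λ.Finite) (halg : ∀ l ∈ Λ, ∃ q : ℂ[X], q ≠ 0 ∧
      (∀ n, q.coeff n ∈ Subfield.closure Y) ∧ q.eval l = 0) (Z : ℂ)
    (hZ : Z ∈ Subfield.closure (Y ∪ Λ)) (hZO : Z ∈ O) (hZT : ∀ φ ∈ T, ‖φ Z‖ ≤ 1 / 2) : Z = 0 := by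
  by_contra hZ0
  let F := Subfield.closure Y
  let M := IntermediateField.adjoin F Λ
  have hintg : ∀ l ∈ Λ, IsIntegral F l := by
    intro l hl
    obtain ⟨q, hq0, hqc, hql⟩ := halg l hl
    have : q ∈ Polynomial.lifts (algebraMap F ℂ) := by
      rw [Polynomial.lifts_iff_coeff_lifts]
      intro n
      exact ⟨⟨q.coeff n, hqc n⟩, rfl⟩
    obtain ⟨q', hq'⟩ := this
    refine IsAlgebraic.isIntegral ⟨q', ?_, ?_⟩
    · rintro rfl; simp at hq'; exact hq0 hq'.symm
    · rw [← Polynomial.aeval_map_algebraMap ℂ]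
      change aeval l (Polynomial.mapRingHom (algebraMap F ℂ) q') = 0
      rw [hq']; simpa [Polynomial.aeval_def] using hql
  haveI : Finite Λ := hΛ
  haveI : FiniteDimensional F M := IntermediateField.finiteDimensional_adjoin hintg
  have hZM : Z ∈ M.toSubfield := by
    refine (Subfield.closure_le.2 ?_) hZ
    rintro y (hy | hy)
    · exact M.algebraMap_mem ⟨y, Subfield.subset_closure hy⟩
    · exact IntermediateField.subset_adjoin F Λ hy
  have hfin := h.northcott (Module.finrank F M) 0 1
  have hmem : ∀ n : ℕ, Z ^ n ∈ {z : ℂ | s ^ 0 * z ∈ O ∧ (∀ φ ∈ T, ‖φ z‖ ≤ 1) ∧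
    ∃ q : ℂ[X], q ≠ 0 ∧ q.natDegree ≤ Module.finrank F M ∧
      (∀ n, q.coeff n ∈ Subfield.closure Y) ∧ q.eval z = 0} := by
    intro n
    refine ⟨by simpa using pow_mem hZO n, ?_, ?_⟩
    · intro φ hφ
      rw [map_pow, norm_pow]
      exact pow_le_one₀ (norm_nonneg _) ((hZT φ hφ).trans (by norm_num))
    · let w : M := ⟨Z, hZM⟩ ^ n
      refine ⟨(minpoly F w).map (algebraMap F ℂ), ?_, ?_, ?_, ?_⟩
      · exact Polynomial.map_ne_zero (minpoly.ne_zero (Algebra.IsIntegral.isIntegral w))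
      · rw [Polynomial.natDegree_map]; exact minpoly.natDegree_le w
      · intro m; rw [coeff_map]; exact ((minpoly F w).coeff m).2
      · rw [eval_map_algebraMap]
        have h1 := minpoly.aeval F w
        have h2 := congrArg (algebraMap M ℂ) h1
        rw [← Polynomial.aeval_algebraMap_apply, map_zero] at h2
        exact h2
  have : ¬ Function.Injective (fun n : ℕ => Z ^ n) := by
    intro hinj
    exact Set.infinite_of_injective_forall_mem hinj hmem hfin
  simp only [Function.Injective, not_forall] at this
  obtain ⟨a, b, hab, hne⟩ := this
  obtain ⟨φ, hφ⟩ := h.nonempty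
  have h1 := congrArg (fun z => ‖φ z‖) hab
  simp only [map_pow, norm_pow] at h1
  have hφ0 : 0 < ‖φ Z‖ := norm_pos_iff.2 ((map_ne_zero φ).2 hZ0)
  have hφ1 := hZT φ hφ
  exact hne (pow_right_injective₀ hφ0 (by linarith [hφ1] : ‖φ Z‖ ≠ 1) h1)


noncomputable section PadeSection

/-- the functional `∫₀¹` on polynomials -/
def padeL (K : Type*) [Field K] : K[X] →ₗ[K] K :=
  Polynomial.lsum (fun k => (LinearMap.id : K →ₗ[K] K).smulRight ((k + 1 : K)⁻¹))

variable {K : Type*} [Field K] [CharZero K]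

theorem padeL_monomial (k : ℕ) (a : K) : padeL K (monomial k a) = a * ((k + 1 : K)⁻¹) := by
  simp [padeL, Polynomial.lsum_apply]

theorem padeL_X_pow (k : ℕ) : padeL K (X ^ k) = ((k + 1 : K)⁻¹) := by
  rw [← monomial_one_right_eq_X_pow, padeL_monomial, one_mul]

theorem padeL_C_mul (a : K) (p : K[X]) : padeL K (C a * p) = a * padeL K p := by
  rw [← smul_eq_C_mul, map_smul, smul_eq_mul]

theorem padeL_beta (a b : ℕ) : padeL K (X ^ a * (1 - X) ^ b) =
    (a.factorial * b.factorial : K) / (a + b + 1).factorial := by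
  induction b generalizing a with
  | zero =>
    simp only [pow_zero, mul_one, padeL_X_pow, Nat.factorial_zero, Nat.cast_one, add_zero]
    rw [Nat.factorial_succ]
    have h1 : (a.factorial : K) ≠ 0 := by exact_mod_cast a.factorial_ne_zero
    have h2 : (a + 1 : K) ≠ 0 := by exact_mod_cast a.succ_ne_zero
    push_cast
    field_simp
  | succ b ih =>
    have : (X ^ a * (1 - X) ^ (b + 1) : K[X]) = X ^ a * (1 - X) ^ b - X ^ (a + 1) * (1 - X) ^ b := by
      ring
    rw [this, map_sub, ih, ih]
    have e1 : a + 1 + b + 1 = (a + b + 1) + 1 := by ring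
    have e2 : a + (b + 1) + 1 = (a + b + 1) + 1 := by ring
    rw [e1, e2, Nat.factorial_succ (a + b + 1), Nat.factorial_succ a, Nat.factorial_succ b]
    have h1 : ((a + b + 1).factorial : K) ≠ 0 := by exact_mod_cast Nat.factorial_ne_zero _
    have h2 : ((a + b + 1 + 1 : ℕ) : K) ≠ 0 := Nat.cast_ne_zero.2 (by omega)
    push_cast at h2 ⊢
    field_simp
    ring

theorem padeL_sub_aux (w : K) (k : ℕ) :
    w * padeL K ((1 - C w * X) ^ k) * (k + 1) = 1 - (1 - w) ^ (k + 1) := by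
  have h1 : ((1 - C w * X) ^ k : K[X]) = ∑ j ∈ Finset.range (k + 1),
      C ((-w) ^ j * (k.choose j : K)) * X ^ j := by
    rw [sub_eq_add_neg, add_comm, add_pow]
    refine Finset.sum_congr rfl fun j _ => ?_
    simp only [one_pow, mul_one, map_mul, map_pow, map_neg, map_natCast]
    ring
  have h2 : (1 - w) ^ (k + 1) = ∑ j ∈ Finset.range (k + 2), (-w) ^ j * ((k+1).choose j : K) := by
    rw [sub_eq_add_neg, add_comm, add_pow]
    simp
  rw [Finset.sum_range_succ'] at h2
  rw [h1, h2, map_sum, Finset.mul_sum, Finset.sum_mul]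
  simp only [pow_zero, Nat.choose_zero_right, Nat.cast_one, mul_one]
  rw [sub_add_cancel_right, ← Finset.sum_neg_distrib]
  refine Finset.sum_congr rfl fun j _ => ?_
  rw [padeL_C_mul, padeL_X_pow]
  have h3 : ((k + 1 : ℕ) : K) * (k.choose j : K) = ((k + 1).choose (j + 1) : K) * (j + 1 : ℕ) := by
    exact_mod_cast Nat.add_one_mul_choose_eq k j
  have h4 : (j + 1 : K) ≠ 0 := by exact_mod_cast j.succ_ne_zero
  push_cast at h3
  field_simp
  rw [show ((k:K) + 1) = (k+1 : K) from rfl]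
  linear_combination (w * (-w) ^ j) * h3

theorem padeL_split (z : K) (P : K[X]) :
    z * padeL K (P.comp (C z * X)) + (1 - z) * padeL K (P.comp (1 - C (1 - z) * X)) = padeL K P := by
  induction P using Polynomial.induction_on' with
  | add p q hp hq => simp only [add_comp, map_add, mul_add]; rw [← hp, ← hq]; ring
  | monomial k a =>
    rw [← C_mul_X_pow_eq_monomial]
    simp only [mul_comp, C_comp, pow_comp, X_comp, padeL_C_mul, padeL_X_pow, mul_pow, ← map_pow C]
    have h1 := padeL_sub_aux (1 - z) k
    have h4 : (k + 1 : K) ≠ 0 := by exact_mod_cast k.succ_ne_zero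
    rw [sub_sub_cancel] at h1
    field_simp
    linear_combination a * h1

/-- coefficients -/
def padeA (p q r : ℕ) : ℤ[X] := ∑ k ∈ Finset.range (q + 1),
  C ((-1) ^ k * ((p + k).choose k * (p + q + r + 1).choose (q - k) : ℤ)) * X ^ k
def padeB (p q r : ℕ) : ℤ[X] := ∑ k ∈ Finset.range (p + 1),
  C ((-1) ^ r * ((-1) ^ k * ((q + k).choose k * (p + q + r + 1).choose (p - k) : ℤ))) * X ^ k
def padeC (p q r : ℕ) : ℤ[X] := ∑ k ∈ Finset.range (r + 1),
  C ((-1) ^ (r - k) * ((p + r - k).choose p * (p + q + r + 1).choose k : ℤ)) * X ^ k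

theorem pade_fact1 (p q r k : ℕ) (hk : k ≤ q) :
    ((p + q + r + 1).factorial : K) / (p.factorial * q.factorial * r.factorial) *
      ((q.choose k : K) * (((p + k).factorial * r.factorial : K) / (p + k + r + 1).factorial)) =
    ((p + k).choose k : K) * (p + q + r + 1).choose (q - k) := by
  have e : (p + q + r + 1) - (q - k) = p + k + r + 1 := by omega
  rw [Nat.cast_choose K hk, Nat.cast_choose K (Nat.le_add_left k p),
    Nat.cast_choose K (show q - k ≤ p + q + r + 1 by omega), e, Nat.add_sub_cancel]
  have hf : ∀ n : ℕ, (n.factorial : K) ≠ 0 := fun n => by exact_mod_cast n.factorial_ne_zero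
  have := hf p; have := hf q; have := hf r; have := hf k; have := hf (q-k)
  have := hf (p+k+r+1)
  field_simp

theorem pade_fact2 (p q r k : ℕ) (hk : k ≤ r) :
    ((p + q + r + 1).factorial : K) / (p.factorial * q.factorial * r.factorial) *
      ((r.choose k : K) * (((p + (r - k)).factorial * q.factorial : K) /
        (p + (r - k) + q + 1).factorial)) =
    ((p + r - k).choose p : K) * (p + q + r + 1).choose k := by
  have e : (p + q + r + 1) - k = p + (r - k) + q + 1 := by omega
  have e2 : p + r - k = p + (r - k) := by omega
  rw [Nat.cast_choose K hk, e2, Nat.cast_choose K (Nat.le_add_right p (r-k)),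
    Nat.cast_choose K (show k ≤ p + q + r + 1 by omega), e, Nat.add_sub_cancel_left]
  have hf : ∀ n : ℕ, (n.factorial : K) ≠ 0 := fun n => by exact_mod_cast n.factorial_ne_zero
  have := hf p; have := hf q; have := hf r; have := hf k; have := hf (r-k)
  have := hf (p+(r-k)+q+1)
  field_simp

theorem pade_sum1 (p q r : ℕ) (z : K) :
    ((p + q + r + 1).factorial : K) / (p.factorial * q.factorial * r.factorial) *
      padeL K (X ^ p * (1 - C z * X) ^ q * (1 - X) ^ r) = aeval z (padeA p q r) := by
  have h1 : (X ^ p * (1 - C z * X) ^ q * (1 - X) ^ r : K[X]) = ∑ k ∈ Finset.range (q + 1),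
      C ((-z) ^ k * (q.choose k : K)) * (X ^ (p + k) * (1 - X) ^ r) := by
    rw [sub_eq_add_neg 1 (C z * X), add_comm 1, add_pow, Finset.mul_sum, Finset.sum_mul]
    refine Finset.sum_congr rfl fun j _ => ?_
    simp only [one_pow, mul_one, map_mul, map_pow, map_neg, map_natCast]
    ring
  rw [h1, map_sum, padeA, map_sum, Finset.mul_sum]
  refine Finset.sum_congr rfl fun k hk => ?_
  have hk' : k ≤ q := by have := Finset.mem_range.1 hk; omega
  rw [padeL_C_mul, padeL_beta]
  have := pade_fact1 (K := K) p q r k hk'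
  simp only [map_mul, map_pow, map_neg, map_one, map_natCast, aeval_X, aeval_C, algebraMap_int_eq,
    eq_intCast, Int.cast_mul, Int.cast_pow, Int.cast_neg, Int.cast_one, Int.cast_natCast]
  rw [neg_pow z]
  linear_combination ((-1) ^ k * z ^ k) * this

theorem pade_sum2 (p q r : ℕ) (z : K) :
    ((p + q + r + 1).factorial : K) / (p.factorial * q.factorial * r.factorial) *
      padeL K (X ^ p * (1 - X) ^ q * (C z - X) ^ r) = aeval z (padeC p q r) := by
  have h1 : (X ^ p * (1 - X) ^ q * (C z - X) ^ r : K[X]) = ∑ k ∈ Finset.range (r + 1),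
      C ((-1) ^ (r - k) * z ^ k * (r.choose k : K)) * (X ^ (p + (r - k)) * (1 - X) ^ q) := by
    rw [sub_eq_add_neg (C z), add_pow, Finset.mul_sum]
    refine Finset.sum_congr rfl fun j _ => ?_
    simp only [map_mul, map_pow, map_neg, map_natCast, map_one]
    rw [neg_pow (X : K[X])]
    ring
  rw [h1, map_sum, padeC, map_sum, Finset.mul_sum]
  refine Finset.sum_congr rfl fun k hk => ?_
  have hk' : k ≤ r := by have := Finset.mem_range.1 hk; omega
  rw [padeL_C_mul, padeL_beta]
  have := pade_fact2 (K := K) p q r k hk'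
  simp only [map_mul, map_pow, map_neg, map_one, map_natCast, aeval_X, aeval_C, algebraMap_int_eq,
    eq_intCast, Int.cast_mul, Int.cast_pow, Int.cast_neg, Int.cast_one, Int.cast_natCast]
  linear_combination ((-1) ^ (r-k) * z ^ k) * this

theorem pade_identity (p q r : ℕ) (z : K) :
    z ^ (p + r + 1) * aeval z (padeA p q r) + (1 - z) ^ (q + r + 1) * aeval (1 - z) (padeB p q r) =
      aeval z (padeC p q r) := by
  rw [← pade_sum2, ← padeL_split z, ← pade_sum1]
  have hB : aeval (1 - z) (padeB p q r) = (-1) ^ r * aeval (1 - z) (padeA q p r) := by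
    rw [padeA, padeB, map_sum, map_sum, Finset.mul_sum]
    refine Finset.sum_congr rfl fun k _ => ?_
    rw [add_comm q p]
    simp
    ring
  rw [hB, ← pade_sum1]
  have e1 : (X ^ p * (1 - X) ^ q * (C z - X) ^ r : K[X]).comp (C z * X) =
      C (z ^ (p + r)) * (X ^ p * (1 - C z * X) ^ q * (1 - X) ^ r) := by
    simp only [mul_comp, pow_comp, X_comp, sub_comp, one_comp, C_comp]
    rw [show (C z - C z * X : K[X]) = C z * (1 - X) by ring, mul_pow, mul_pow, map_pow, pow_add]
    ring
  have e2 : (X ^ p * (1 - X) ^ q * (C z - X) ^ r : K[X]).comp (1 - C (1 - z) * X) =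
      C ((-1) ^ r * (1 - z) ^ (q + r)) * (X ^ q * (1 - C (1-z) * X) ^ p * (1 - X) ^ r) := by
    simp only [mul_comp, pow_comp, X_comp, sub_comp, one_comp, C_comp]
    have : (C z - (1 - C (1 - z) * X) : K[X]) = C (-1) * C (1 - z) * (1 - X) := by
      simp only [map_sub, map_one, map_neg]; ring
    rw [this, mul_pow, mul_pow]
    simp only [map_mul, map_pow, pow_add]
    ring
  rw [e1, e2, padeL_C_mul, padeL_C_mul, add_comm q p]
  ring

end PadeSection


section SUnitCore

theorem av_intCast_le {K : Type*} [Field K] (v : AbsoluteValue K ℝ) (m : ℤ) : v (m : K) ≤ |(m : ℝ)| := by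
  have hn : ∀ n : ℕ, v (n : K) ≤ n := by
    intro n
    induction n with
    | zero => simp
    | succ n ih =>
      push_cast
      calc v ((n : K) + 1) ≤ v n + v 1 := v.add_le _ _
        _ ≤ n + 1 := by rw [v.map_one]; linarith
  obtain ⟨n, rfl | rfl⟩ := m.eq_nat_or_neg
  · simpa using hn n
  · simpa using hn n

theorem av_sum_le {K : Type*} [Field K] (v : AbsoluteValue K ℝ) (d D : ℕ) (hd : d ≤ D) (a : ℕ → ℤ) (Q : ℝ)
    (hQ : ∀ k ≤ d, |(a k : ℝ)| ≤ Q) (z : K) (M : ℝ) (hM : 1 ≤ M) (hz : v z ≤ M) :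
    v (aeval z (∑ k ∈ Finset.range (d + 1), C (a k) * X ^ k : ℤ[X])) ≤ (d + 1) * Q * M ^ D := by
  have hQ0 : 0 ≤ Q := (abs_nonneg _).trans (hQ 0 (Nat.zero_le _))
  rw [map_sum]
  calc v (∑ k ∈ Finset.range (d + 1), aeval z (C (a k) * X ^ k : ℤ[X]))
      ≤ ∑ k ∈ Finset.range (d + 1), v (aeval z (C (a k) * X ^ k : ℤ[X])) := v.sum_le _ _
    _ ≤ ∑ k ∈ Finset.range (d + 1), Q * M ^ D := by
        refine Finset.sum_le_sum fun k hk => ?_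
        have hk' : k ≤ D := by have := Finset.mem_range.1 hk; omega
        have : aeval z (C (a k) * X ^ k : ℤ[X]) = (a k : K) * z ^ k := by simp
        rw [this, map_mul, map_pow]
        have h1 : v z ^ k ≤ M ^ D := (pow_le_pow_left₀ (v.nonneg _) hz k).trans
          (pow_le_pow_right₀ hM hk')
        exact mul_le_mul ((av_intCast_le v _).trans (hQ k (by have := Finset.mem_range.1 hk; omega))) h1 (pow_nonneg (v.nonneg _) _) hQ0
    _ = _ := by simp; ring

theorem choose_le_two_pow' (n k m : ℕ) (h : n ≤ m) : (n.choose k : ℝ) ≤ 2 ^ m := by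
  have h1 : n.choose k ≤ 2 ^ n := Nat.choose_le_two_pow n k
  have h2 : 2 ^ n ≤ 2 ^ m := Nat.pow_le_pow_right (by norm_num) h
  exact_mod_cast h1.trans h2

theorem pade_bd1 (n₁ k₁ n₂ k₂ N : ℕ) (s : ℤ) (hs : |(s : ℝ)| ≤ 1) (h1 : n₁ ≤ 2 * N + 2) (h2 : n₂ ≤ 3 * N + 2) :
    |((s * (n₁.choose k₁ * n₂.choose k₂ : ℤ) : ℤ) : ℝ)| ≤ 2 ^ (5 * N + 4) := by
  push_cast
  rw [abs_mul]
  have e : |((n₁.choose k₁ : ℝ) * n₂.choose k₂)| = (n₁.choose k₁ : ℝ) * n₂.choose k₂ :=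
    abs_of_nonneg (by positivity)
  rw [e]
  have := choose_le_two_pow' n₁ k₁ _ h1
  have := choose_le_two_pow' n₂ k₂ _ h2
  calc |(s : ℝ)| * ((n₁.choose k₁ : ℝ) * n₂.choose k₂) ≤ 1 * (2 ^ (2 * N + 2) * 2 ^ (3 * N + 2)) := by
        gcongr
    _ = 2 ^ (5 * N + 4) := by rw [one_mul, ← pow_add]; congr 1; ring

theorem pade_bd2 (d N : ℕ) (hN : 1 ≤ N) (hd : d ≤ N + 1) : ((d : ℝ) + 1) * 2 ^ (5 * N + 4) ≤ (2 ^ 12) ^ N := by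
  have h0 : (d : ℝ) + 1 ≤ 2 ^ (N + 1) := by
    have : d + 1 ≤ 2 ^ (N + 1) := by
      have : N + 1 < 2 ^ (N + 1) := Nat.lt_two_pow_self
      omega
    exact_mod_cast this
  calc ((d : ℝ) + 1) * 2 ^ (5 * N + 4) ≤ 2 ^ (N + 1) * 2 ^ (5 * N + 4) := by gcongr
    _ = 2 ^ (6 * N + 5) := by rw [← pow_add]; congr 1; ring
    _ ≤ 2 ^ (12 * N) := pow_le_pow_right₀ (by norm_num) (by omega)
    _ = _ := by rw [pow_mul]

theorem abs_neg_one_pow' (k : ℕ) : |(((-1) ^ k : ℤ) : ℝ)| ≤ 1 := by simp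

theorem abs_neg_one_pow'' (k l : ℕ) : |(((-1) ^ l * (-1) ^ k : ℤ) : ℝ)| ≤ 1 := by simp

variable {K : Type*} [Field K]

theorem padeA_le (v : AbsoluteValue K ℝ) (p N : ℕ) (hN : 1 ≤ N) (hp : p ≤ N + 1) (z : K) (M : ℝ) (hM : 1 ≤ M) (hz : v z ≤ M) :
    v (aeval z (padeA p N N)) ≤ (2 ^ 12) ^ N * M ^ N := by
  refine (av_sum_le v N N le_rfl _ (2 ^ (5 * N + 4)) (fun k hk => ?_) z M hM hz).trans ?_
  · exact pade_bd1 _ _ _ _ N _ (abs_neg_one_pow' k) (by omega) (by omega)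
  · exact mul_le_mul_of_nonneg_right (pade_bd2 N N hN (by omega)) (by positivity)

theorem padeB_le (v : AbsoluteValue K ℝ) (p N : ℕ) (hN : 1 ≤ N) (hp : p ≤ N + 1) (z : K) (M : ℝ) (hM : 1 ≤ M) (hz : v z ≤ M) :
    v (aeval z (padeB p N N)) ≤ (2 ^ 12) ^ N * M ^ (N + 1) := by
  refine (av_sum_le v p (N + 1) hp _ (2 ^ (5 * N + 4)) (fun k hk => ?_) z M hM hz).trans ?_
  · rw [← mul_assoc]
    exact pade_bd1 _ _ _ _ N _ (abs_neg_one_pow'' k N) (by omega) (by omega)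
  · exact mul_le_mul_of_nonneg_right (pade_bd2 p N hN hp) (by positivity)

theorem padeC_le (v : AbsoluteValue K ℝ) (p N : ℕ) (hN : 1 ≤ N) (hp : p ≤ N + 1) (z : K) (M : ℝ) (hM : 1 ≤ M) (hz : v z ≤ M) :
    v (aeval z (padeC p N N)) ≤ (2 ^ 12) ^ N * M ^ N := by
  refine (av_sum_le v N N le_rfl _ (2 ^ (5 * N + 4)) (fun k hk => ?_) z M hM hz).trans ?_
  · exact pade_bd1 _ _ _ _ N _ (abs_neg_one_pow' (N - k)) (by omega) (by omega)
  · exact mul_le_mul_of_nonneg_right (pade_bd2 N N hN (by omega)) (by positivity)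

theorem natDegree_sumCX (d : ℕ) (a : ℕ → ℤ) :
    (∑ k ∈ Finset.range (d + 1), C (a k) * X ^ k : ℤ[X]).natDegree ≤ d := by
  refine natDegree_sum_le_of_forall_le _ _ fun k hk => ?_
  refine (natDegree_C_mul_X_pow_le _ _).trans ?_
  have := Finset.mem_range.1 hk; omega

theorem eval0_sumCX (d : ℕ) (a : ℕ → ℤ) :
    (∑ k ∈ Finset.range (d + 1), C (a k) * X ^ k : ℤ[X]).eval 0 = a 0 := by
  rw [Finset.sum_range_succ']
  simp [eval_finsetSum]

theorem pade_det_ne [CharZero K] (N : ℕ) (z : K) :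
    z * aeval z (padeA (N + 1) N N) * aeval (1 - z) (padeB N N N) -
      aeval z (padeA N N N) * aeval (1 - z) (padeB (N + 1) N N) ≠ 0 := by
  let i : ℤ[X] →+* K[X] := mapRingHom (Int.castRingHom K)
  have hi : ∀ (P : ℤ[X]) (w : K), (i P).eval w = aeval w P := by
    intro P w
    simp [i, aeval_def, eval_map]
  let A := i (padeA N N N)
  let A' := X * i (padeA (N + 1) N N)
  let B := (i (padeB N N N)).comp (1 - X)
  let B' := (i (padeB (N + 1) N N)).comp (1 - X)
  let Cc := i (padeC N N N)
  let C' := i (padeC (N + 1) N N)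
  let W := A' * B - A * B'
  have e1 : X ^ (2 * N + 1) * A + (1 - X) ^ (2 * N + 1) * B = Cc := by
    refine Polynomial.funext fun w => ?_
    have := pade_identity N N N w
    rw [show N + N + 1 = 2 * N + 1 by ring] at this
    simp only [A, B, Cc, eval_add, eval_mul, eval_pow, eval_X, eval_sub, eval_one, eval_comp, hi, this]
  have e2 : X ^ (2 * N + 1) * A' + (1 - X) ^ (2 * N + 1) * B' = C' := by
    refine Polynomial.funext fun w => ?_
    have := pade_identity (N + 1) N N w
    rw [show N + 1 + N + 1 = 2 * N + 1 + 1 by ring, show N + N + 1 = 2 * N + 1 by ring] at this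
    simp only [A', B', C', eval_add, eval_mul, eval_pow, eval_X, eval_sub, eval_one, eval_comp, hi, ← this]
    ring
  have e3 : (1 - X) ^ (2 * N + 1) * W = A' * Cc - A * C' := by
    rw [← e1, ← e2]; simp only [W]; ring
  have hd : ∀ P : ℤ[X], (i P).natDegree ≤ P.natDegree := fun P => natDegree_map_le
  have dA : A.natDegree ≤ N := (hd _).trans (natDegree_sumCX _ _)
  have dA' : A'.natDegree ≤ 1 + N := natDegree_mul_le.trans
    (add_le_add natDegree_X_le ((hd _).trans (natDegree_sumCX _ _)))
  have dC : Cc.natDegree ≤ N := (hd _).trans (natDegree_sumCX _ _)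
  have dC' : C'.natDegree ≤ N := (hd _).trans (natDegree_sumCX _ _)
  have dd : ((1 - X) ^ (2 * N + 1) * W).natDegree ≤ 2 * N + 1 := by
    rw [e3]
    refine (natDegree_sub_le _ _).trans (max_le ?_ ?_)
    · refine natDegree_mul_le.trans ?_; omega
    · refine natDegree_mul_le.trans ?_; omega
  have W0 : W.eval 0 ≠ 0 := by
    have h1 : A.eval 0 ≠ 0 := by
      have : (padeA N N N).eval 0 ≠ 0 := by
        rw [padeA, eval0_sumCX]
        simp
        have := Nat.choose_pos (show N ≤ N + N + N + 1 by omega); omega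
      have h : A.eval 0 = ((padeA N N N).eval 0 : ℤ) := by
        simp only [A]
        rw [show (0 : K) = ((0:ℤ):K) by simp, coe_mapRingHom, eval_intCast_map]; simp
      rw [h]; exact_mod_cast this
    have h2 : C'.eval 0 ≠ 0 := by
      have : (padeC (N + 1) N N).eval 0 ≠ 0 := by
        rw [padeC, eval0_sumCX]
        simp
        have := Nat.choose_pos (show N + 1 ≤ N + 1 + N by omega); omega
      have h : C'.eval 0 = ((padeC (N+1) N N).eval 0 : ℤ) := by
        simp only [C']
        rw [show (0 : K) = ((0:ℤ):K) by simp, coe_mapRingHom, eval_intCast_map]; simp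
      rw [h]; exact_mod_cast this
    have h3 : B'.eval 0 = C'.eval 0 := by
      rw [← e2]; simp
    have h4 : A'.eval 0 = 0 := by simp [A']
    simp only [W, eval_sub, eval_mul, h4, h3, zero_mul, zero_sub]
    exact neg_ne_zero.2 (mul_ne_zero h1 h2)
  have Wne : W ≠ 0 := by rintro h; simp [h] at W0
  have h1X : (1 - X : K[X]).natDegree = 1 := by
    rw [← natDegree_neg, neg_sub, ← C_1, natDegree_X_sub_C]
  have h1X0 : (1 - X : K[X]) ≠ 0 := by
    intro h; rw [h] at h1X; simp at h1X
  rw [natDegree_mul (pow_ne_zero _ h1X0) Wne, natDegree_pow, h1X] at dd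
  have W1 : W.natDegree = 0 := by omega
  have W2 : W.eval z = W.eval 0 := by
    rw [eq_C_of_natDegree_eq_zero W1]; simp
  have W3 : W.eval z = z * aeval z (padeA (N + 1) N N) * aeval (1 - z) (padeB N N N) -
      aeval z (padeA N N N) * aeval (1 - z) (padeB (N + 1) N N) := by
    simp only [W, A, A', B, B', eval_sub, eval_mul, eval_X, eval_comp, eval_one, hi]
  rw [← W3, W2]; exact W0

theorem sunit_rho (v : AbsoluteValue K ℝ) (A B Cc x₁ x₂ : K) (n : ℕ) (hx : x₁ ≠ 0) (hy : 1 - x₁ ≠ 0)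
    (h : x₁ ^ n * A + (1 - x₁) ^ n * B = Cc) (Q E : ℝ) (hA : v A ≤ Q) (hB : v B ≤ Q) (hC : v Cc ≤ Q)
    (hE : 1 ≤ E) (hX : v (x₂ / x₁ ^ n) ≤ E) (hY : v ((1 - x₂) / (1 - x₁) ^ n) ≤ E) :
    v (A * ((1 - x₂) / (1 - x₁) ^ n) - B * (x₂ / x₁ ^ n)) * (max 1 (max (v x₁) (v (1 - x₁)))) ^ n ≤
      2 * Q * E := by
  set X := x₂ / x₁ ^ n with hXd
  set Y := (1 - x₂) / (1 - x₁) ^ n with hYd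
  have hX' : X * x₁ ^ n = x₂ := by rw [hXd]; field_simp
  have hY' : Y * (1 - x₁) ^ n = 1 - x₂ := by rw [hYd]; field_simp
  have hQ : 0 ≤ Q := (v.nonneg _).trans hA
  have k1 : (A * Y - B * X) * x₁ ^ n = Cc * Y - B := by
    linear_combination Y * h - B * hY' - B * hX'
  have k2 : (A * Y - B * X) * (1 - x₁) ^ n = A - Cc * X := by
    linear_combination A * hY' + A * hX' - X * h
  have sub_le' : ∀ a b : K, v (a - b) ≤ v a + v b := by
    intro a b
    have := v.sub_le a 0 b
    simpa using this
  have m : ∀ {a b c d : ℝ}, a ≤ c → b ≤ d → 0 ≤ b → 0 ≤ c → a * b ≤ c * d := fun h1 h2 h3 h4 => mul_le_mul h1 h2 h3 h4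
  rcases max_choice 1 (max (v x₁) (v (1 - x₁))) with h1 | h1
  · rw [h1, one_pow, mul_one]
    calc _ ≤ v (A * Y) + v (B * X) := sub_le' _ _
      _ ≤ Q * E + Q * E := by
        rw [map_mul, map_mul]
        exact add_le_add (m hA hY (v.nonneg _) hQ) (m hB hX (v.nonneg _) hQ)
      _ = _ := by ring
  rw [h1]
  rcases max_choice (v x₁) (v (1 - x₁)) with h2 | h2
  · rw [h2, ← map_pow, ← map_mul, k1]
    calc _ ≤ v (Cc * Y) + v B := sub_le' _ _
      _ ≤ Q * E + Q * E := by
        rw [map_mul]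
        exact add_le_add (m hC hY (v.nonneg _) hQ) (hB.trans (le_mul_of_one_le_right hQ hE))
      _ = _ := by ring
  · rw [h2, ← map_pow, ← map_mul, k2]
    calc _ ≤ v A + v (Cc * X) := sub_le' _ _
      _ ≤ Q * E + Q * E := by
        rw [map_mul]
        exact add_le_add (hA.trans (le_mul_of_one_le_right hQ hE)) (m hC hX (v.nonneg _) hQ)
      _ = _ := by ring

end SUnitCore


section SUnitMain

variable {K : Type*} [Field K] [CharZero K]

/-- solutions of the unit equation -/
def unitSol (O : Subring K) : Set K :=
  {x | x ≠ 0 ∧ 1 - x ≠ 0 ∧ x ∈ O ∧ x⁻¹ ∈ O ∧ 1 - x ∈ O ∧ (1 - x)⁻¹ ∈ O}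

theorem aeval_int_mem (O : Subring K) (P : ℤ[X]) (z : K) (hz : z ∈ O) : aeval z P ∈ O := by
  have := (aeval (⟨z, hz⟩ : O) P).2
  have h : (aeval z P : K) = O.subtype (aeval (⟨z, hz⟩ : O) P) := by
    rw [aeval_def, aeval_def, hom_eval₂]
    congr 1
  rw [h]; exact this

variable {ι : Type*} [Fintype ι]

theorem sunit_ineq (v : ι → AbsoluteValue K ℝ) (O : Subring K)
    (H1 : ∀ z ∈ O, z ≠ 0 → 1 ≤ ∏ i, v i z) (x₁ x₂ : K) (h₁ : x₁ ∈ unitSol O) (h₂ : x₂ ∈ unitSol O)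
    (N : ℕ) (hN : 1 ≤ N) (E : ι → ℝ) (hE : ∀ i, 1 ≤ E i)
    (hX : ∀ i, v i (x₂ / x₁ ^ (2 * N + 1)) ≤ E i) (hY : ∀ i, v i ((1 - x₂) / (1 - x₁) ^ (2 * N + 1)) ≤ E i) :
    (∏ i, max 1 (max (v i x₁) (v i (1 - x₁)))) ^ N ≤ ((2 ^ 13) ^ N) ^ Fintype.card ι * ∏ i, E i := by
  obtain ⟨hx0, hy0, hx, hx', hy, hy'⟩ := h₁
  obtain ⟨hx20, hy20, hx2, hx2', hy2, hy2'⟩ := h₂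
  have key : ∀ A B Cc : K, A ∈ O → B ∈ O → x₁ ^ (2 * N + 1) * A + (1 - x₁) ^ (2 * N + 1) * B = Cc →
      (∀ i, v i A ≤ (2 ^ 12) ^ N * (max 1 (max (v i x₁) (v i (1 - x₁)))) ^ (N + 1)) →
      (∀ i, v i B ≤ (2 ^ 12) ^ N * (max 1 (max (v i x₁) (v i (1 - x₁)))) ^ (N + 1)) →
      (∀ i, v i Cc ≤ (2 ^ 12) ^ N * (max 1 (max (v i x₁) (v i (1 - x₁)))) ^ (N + 1)) →
      A * ((1 - x₂) / (1 - x₁) ^ (2 * N + 1)) - B * (x₂ / x₁ ^ (2 * N + 1)) ≠ 0 →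
      (∏ i, max 1 (max (v i x₁) (v i (1 - x₁)))) ^ N ≤ ((2 ^ 13) ^ N) ^ Fintype.card ι * ∏ i, E i := by
    intro A B Cc hA hB hABC bA bB bC hne
    set ρ := A * ((1 - x₂) / (1 - x₁) ^ (2 * N + 1)) - B * (x₂ / x₁ ^ (2 * N + 1)) with hρ
    have hρO : ρ ∈ O := by
      refine O.sub_mem (O.mul_mem hA ?_) (O.mul_mem hB ?_)
      · rw [div_eq_mul_inv, ← inv_pow]; exact O.mul_mem hy2 (O.pow_mem hy' _)
      · rw [div_eq_mul_inv, ← inv_pow]; exact O.mul_mem hx2 (O.pow_mem hx' _)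
    have h1 := H1 ρ hρO hne
    have h2 : ∀ i, v i ρ * (max 1 (max (v i x₁) (v i (1 - x₁)))) ^ N ≤ (2 ^ 13) ^ N * E i := by
      intro i
      set M := max 1 (max (v i x₁) (v i (1 - x₁))) with hM
      have hM1 : 1 ≤ M := le_max_left _ _
      have h3 := sunit_rho (v i) A B Cc x₁ x₂ (2 * N + 1) hx0 hy0 hABC _ (E i) (bA i) (bB i) (bC i)
        (hE i) (hX i) (hY i)
      rw [← hρ, ← hM] at h3
      have h4 : (2 : ℝ) * (2 ^ 12) ^ N ≤ (2 ^ 13) ^ N := by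
        have : ((2 : ℝ) ^ 13) ^ N = 2 ^ N * (2 ^ 12) ^ N := by rw [← mul_pow]; norm_num
        rw [this]
        have : (2:ℝ) ≤ 2 ^ N := le_self_pow₀ (by norm_num) (by omega)
        gcongr
      have h5 : (v i ρ * M ^ N) * M ^ (N + 1) ≤ ((2 ^ 13) ^ N * E i) * M ^ (N + 1) := by
        calc (v i ρ * M ^ N) * M ^ (N + 1) = v i ρ * M ^ (2 * N + 1) := by
              rw [mul_assoc, ← pow_add]; congr 2; ring
          _ ≤ 2 * ((2 ^ 12) ^ N * M ^ (N + 1)) * E i := h3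
          _ = (2 * (2 ^ 12) ^ N) * (E i * M ^ (N + 1)) := by ring
          _ ≤ (2 ^ 13) ^ N * (E i * M ^ (N + 1)) := by
              have := hE i
              gcongr
          _ = _ := by ring
      exact le_of_mul_le_mul_right h5 (by positivity)
    have hM0 : 0 ≤ (∏ i, max 1 (max (v i x₁) (v i (1 - x₁)))) ^ N :=
      pow_nonneg (Finset.prod_nonneg fun i _ => le_trans zero_le_one (le_max_left _ _)) _
    calc (∏ i, max 1 (max (v i x₁) (v i (1 - x₁)))) ^ N
        ≤ (∏ i, v i ρ) * (∏ i, max 1 (max (v i x₁) (v i (1 - x₁)))) ^ N := le_mul_of_one_le_left hM0 h1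
      _ = ∏ i, (v i ρ * (max 1 (max (v i x₁) (v i (1 - x₁)))) ^ N) := by
          rw [Finset.prod_mul_distrib, Finset.prod_pow]
      _ ≤ ∏ i, ((2 ^ 13) ^ N * E i) := Finset.prod_le_prod
          (fun i _ => mul_nonneg ((v i).nonneg _) (pow_nonneg (le_trans zero_le_one (le_max_left _ _)) _)) (fun i _ => h2 i)
      _ = _ := by rw [Finset.prod_mul_distrib, Finset.prod_const, Finset.card_univ]
  have hM1 : ∀ i, 1 ≤ max 1 (max (v i x₁) (v i (1 - x₁))) := fun i => le_max_left _ _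
  have hMx : ∀ i, v i x₁ ≤ max 1 (max (v i x₁) (v i (1 - x₁))) := fun i => le_max_of_le_right (le_max_left _ _)
  have hMy : ∀ i, v i (1 - x₁) ≤ max 1 (max (v i x₁) (v i (1 - x₁))) := fun i => le_max_of_le_right (le_max_right _ _)
  have up : ∀ i, ((2:ℝ) ^ 12) ^ N * (max 1 (max (v i x₁) (v i (1 - x₁)))) ^ N ≤
      (2 ^ 12) ^ N * (max 1 (max (v i x₁) (v i (1 - x₁)))) ^ (N + 1) := fun i =>
    mul_le_mul_of_nonneg_left (pow_le_pow_right₀ (hM1 i) (by omega)) (by positivity)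
  by_cases hc : aeval x₁ (padeA N N N) * ((1 - x₂) / (1 - x₁) ^ (2 * N + 1)) -
      aeval (1 - x₁) (padeB N N N) * (x₂ / x₁ ^ (2 * N + 1)) ≠ 0
  · refine key _ _ (aeval x₁ (padeC N N N)) (aeval_int_mem O _ _ hx) (aeval_int_mem O _ _ hy) ?_ ?_ ?_ ?_ hc
    · have := pade_identity N N N x₁
      rwa [show N + N + 1 = 2 * N + 1 by ring] at this
    · exact fun i => (padeA_le (v i) N N hN (by omega) x₁ _ (hM1 i) (hMx i)).trans (up i)
    · exact fun i => (padeB_le (v i) N N hN (by omega) _ _ (hM1 i) (hMy i))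
    · exact fun i => (padeC_le (v i) N N hN (by omega) x₁ _ (hM1 i) (hMx i)).trans (up i)
  · refine key (x₁ * aeval x₁ (padeA (N + 1) N N)) (aeval (1 - x₁) (padeB (N + 1) N N)) (aeval x₁ (padeC (N + 1) N N))
      (O.mul_mem hx (aeval_int_mem O _ _ hx)) (aeval_int_mem O _ _ hy) ?_ ?_ ?_ ?_ ?_
    · have := pade_identity (N + 1) N N x₁
      rw [show N + N + 1 = 2 * N + 1 by ring, show N + 1 + N + 1 = 2 * N + 1 + 1 by ring, pow_succ] at this
      rw [← this]; ring
    · intro i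
      rw [map_mul, pow_succ]
      have := padeA_le (v i) (N + 1) N hN (by omega) x₁ _ (hM1 i) (hMx i)
      calc _ ≤ max 1 (max (v i x₁) (v i (1 - x₁))) * ((2 ^ 12) ^ N * (max 1 (max (v i x₁) (v i (1 - x₁)))) ^ N) :=
            mul_le_mul (hMx i) this ((v i).nonneg _) (zero_le_one.trans (hM1 i))
        _ = _ := by ring
    · exact fun i => (padeB_le (v i) (N + 1) N hN (by omega) _ _ (hM1 i) (hMy i))
    · exact fun i => (padeC_le (v i) (N + 1) N hN (by omega) x₁ _ (hM1 i) (hMx i)).trans (up i)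
    · intro h0
      rw [not_not] at hc
      refine pade_det_ne N x₁ ?_
      have hX0 : x₂ / x₁ ^ (2 * N + 1) ≠ 0 := div_ne_zero hx20 (pow_ne_zero _ hx0)
      refine mul_right_cancel₀ hX0 ?_
      rw [zero_mul]
      linear_combination (aeval x₁ (padeA N N N)) * h0 - (x₁ * aeval x₁ (padeA (N + 1) N N)) * hc

noncomputable def logVec (v : ι → AbsoluteValue K ℝ) (x : K) : ι ⊕ ι → ℝ :=
  Sum.elim (fun i => Real.log (v i x)) (fun i => Real.log (v i (1 - x)))

theorem sunit_norm_ineq (v : ι → AbsoluteValue K ℝ) (O : Subring K)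
    (H1 : ∀ z ∈ O, z ≠ 0 → 1 ≤ ∏ i, v i z) (x₁ x₂ : K) (h₁ : x₁ ∈ unitSol O) (h₂ : x₂ ∈ unitSol O)
    (N : ℕ) (hN : 1 ≤ N) :
    N * ‖logVec v x₁‖ ≤ N * (Fintype.card ι * Real.log (2 ^ 13)) +
      Fintype.card ι * ‖logVec v x₂ - (2 * N + 1 : ℝ) • logVec v x₁‖ := by
  set D := ‖logVec v x₂ - (2 * N + 1 : ℝ) • logVec v x₁‖ with hD
  have hD0 : 0 ≤ D := norm_nonneg _
  have pos : ∀ i, ∀ z : K, z ≠ 0 → 0 < v i z := fun i z hz => (v i).pos hz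
  have hcmp : ∀ j, (logVec v x₂ - (2 * N + 1 : ℝ) • logVec v x₁) j ≤ D := fun j =>
    (le_abs_self _).trans (norm_le_pi_norm (logVec v x₂ - (2 * N + 1 : ℝ) • logVec v x₁) j)
  have gen : ∀ i (a b : K), a ≠ 0 → b ≠ 0 → Real.log (v i b) - (2 * N + 1 : ℝ) * Real.log (v i a) ≤ D →
      v i (b / a ^ (2 * N + 1)) ≤ Real.exp D := by
    intro i a b ha hb h
    rw [← Real.log_le_iff_le_exp (pos i _ (div_ne_zero hb (pow_ne_zero _ ha))), map_div₀, map_pow,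
      Real.log_div (pos i b hb).ne' (pow_ne_zero _ (pos i a ha).ne'), Real.log_pow]
    push_cast; exact h
  have main := sunit_ineq v O H1 x₁ x₂ h₁ h₂ N hN (fun _ => Real.exp D) (fun _ => Real.one_le_exp hD0)
    (fun i => gen i _ _ h₁.1 h₂.1 (hcmp (Sum.inl i))) (fun i => gen i _ _ h₁.2.1 h₂.2.1 (hcmp (Sum.inr i)))
  set P := ∏ i, max 1 (max (v i x₁) (v i (1 - x₁))) with hP
  have hM1 : ∀ i, 1 ≤ max 1 (max (v i x₁) (v i (1 - x₁))) := fun i => le_max_left _ _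
  have hP1 : 1 ≤ P := Finset.one_le_prod (fun i _ => hM1 i)
  have hlog := Real.log_le_log (by positivity) main
  rw [Real.log_pow, Real.log_mul (by positivity) (Finset.prod_ne_zero_iff.2 fun i _ => (Real.exp_pos _).ne'),
    Real.log_pow, Real.log_pow (2 ^ 13) N, Finset.prod_const, Finset.card_univ, Real.log_pow (Real.exp D) (Fintype.card ι), Real.log_exp] at hlog
  have gen2 : ∀ z : K, z ∈ O → z ≠ 0 → (∀ i, v i z ≤ max 1 (max (v i x₁) (v i (1 - x₁)))) →
      ∀ i, |Real.log (v i z)| ≤ Real.log P := by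
    intro z hz hz0 hle i
    have hlP : Real.log P = ∑ j, Real.log (max 1 (max (v j x₁) (v j (1 - x₁)))) :=
      Real.log_prod (fun j _ => (zero_lt_one.trans_le (hM1 j)).ne')
    have t0 : ∀ j, 0 ≤ Real.log (max 1 (max (v j x₁) (v j (1 - x₁)))) := fun j => Real.log_nonneg (hM1 j)
    have t1 : ∀ j, Real.log (v j z) ≤ Real.log (max 1 (max (v j x₁) (v j (1 - x₁)))) := fun j =>
      Real.log_le_log (pos j z hz0) (hle j)
    have s0 : 0 ≤ ∑ j, Real.log (v j z) := by
      rw [← Real.log_prod (fun j _ => (pos j z hz0).ne')]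
      exact Real.log_nonneg (H1 z hz hz0)
    classical
    rw [abs_le]
    constructor
    · have e1 := Finset.add_sum_erase Finset.univ (fun j => Real.log (v j z)) (Finset.mem_univ i)
      have e2 := Finset.add_sum_erase Finset.univ (fun j => Real.log (max 1 (max (v j x₁) (v j (1 - x₁))))) (Finset.mem_univ i)
      have e3 : ∑ j ∈ Finset.univ.erase i, Real.log (v j z) ≤
        ∑ j ∈ Finset.univ.erase i, Real.log (max 1 (max (v j x₁) (v j (1 - x₁)))) := Finset.sum_le_sum fun j _ => t1 j
      have := t0 i
      rw [hlP]; linarith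
    · rw [hlP]
      exact (t1 i).trans (Finset.single_le_sum (f := fun j => Real.log (max 1 (max (v j x₁) (v j (1 - x₁))))) (fun j _ => t0 j) (Finset.mem_univ i))
  have hnorm : ‖logVec v x₁‖ ≤ Real.log P := by
    rw [pi_norm_le_iff_of_nonneg (Real.log_nonneg hP1)]
    rintro (i | i)
    · exact gen2 x₁ h₁.2.2.1 h₁.1 (fun i => le_max_of_le_right (le_max_left _ _)) i
    · exact gen2 (1 - x₁) h₁.2.2.2.2.1 h₁.2.1 (fun i => le_max_of_le_right (le_max_right _ _)) i
  have := mul_le_mul_of_nonneg_left hnorm (Nat.cast_nonneg (α := ℝ) N)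
  calc _ ≤ (N : ℝ) * Real.log P := this
    _ ≤ _ := hlog
    _ = _ := by push_cast; ring

theorem sunit_gap (v : ι → AbsoluteValue K ℝ) (O : Subring K)
    (H1 : ∀ z ∈ O, z ≠ 0 → 1 ≤ ∏ i, v i z) (x₁ x₂ : K) (h₁ : x₁ ∈ unitSol O) (h₂ : x₂ ∈ unitSol O)
    (k c' : ℝ) (hk : k = Fintype.card ι + 1) (hc' : c' = k * Real.log (2 ^ 13))
    (hb : 4 * c' + 1 ≤ ‖logVec v x₁‖)
    (hcone : ‖‖logVec v x₁‖⁻¹ • logVec v x₁ - ‖logVec v x₂‖⁻¹ • logVec v x₂‖ ≤ 1 / (8 * k)) :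
    ‖logVec v x₂‖ ≤ (4 * k + 4) * ‖logVec v x₁‖ := by
  by_contra hcon
  push Not at hcon
  set L₁ := logVec v x₁ with hL₁
  set L₂ := logVec v x₂ with hL₂
  have hk1 : 1 ≤ k := by rw [hk]; simp
  have hlog : 0 ≤ Real.log (2 ^ 13) := Real.log_nonneg (by norm_num)
  have hc0 : 0 ≤ c' := by rw [hc']; positivity
  have hl1 : 0 < ‖L₁‖ := by linarith
  have hl2 : 0 < ‖L₂‖ := by nlinarith
  set r := ‖L₂‖ / ‖L₁‖ with hr
  have hr1 : 4 * k + 4 < r := by rw [hr, lt_div_iff₀ hl1]; exact hcon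
  set N := ⌊r / 2⌋₊ with hN
  have hr0 : 0 ≤ r / 2 := by linarith
  have N1 : (N : ℝ) ≤ r / 2 := Nat.floor_le hr0
  have N2 : r / 2 < N + 1 := Nat.lt_floor_add_one _
  have N3 : 1 ≤ N := by
    have : (0:ℝ) < N := by linarith
    exact_mod_cast this
  have main := sunit_norm_ineq v O H1 x₁ x₂ h₁ h₂ N N3
  rw [← hL₁, ← hL₂] at main
  have e : L₂ - (2 * N + 1 : ℝ) • L₁ = -‖L₂‖ • (‖L₁‖⁻¹ • L₁ - ‖L₂‖⁻¹ • L₂) + (r - (2 * N + 1 : ℝ)) • L₁ := by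
    rw [smul_sub, smul_smul, smul_smul, sub_smul, neg_mul, neg_mul, mul_inv_cancel₀ hl2.ne', ← div_eq_mul_inv, ← hr]
    simp only [neg_smul, one_smul]
    abel
  have hn : ‖L₂ - (2 * N + 1 : ℝ) • L₁‖ ≤ ‖L₂‖ * (1 / (8 * k)) + ‖L₁‖ := by
    rw [e]
    refine (norm_add_le _ _).trans (add_le_add ?_ ?_)
    · rw [norm_smul, norm_neg, norm_norm]; gcongr
    · rw [norm_smul]
      have : ‖r - (2 * N + 1 : ℝ)‖ ≤ 1 := by
        rw [Real.norm_eq_abs, abs_le]; constructor <;> linarith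
      nlinarith
  have hL2 : ‖L₂‖ = r * ‖L₁‖ := by rw [hr]; field_simp
  have hcard : (Fintype.card ι : ℝ) ≤ k := by rw [hk]; linarith
  have a1 : (N : ℝ) * ‖L₁‖ ≤ N * c' + k * (‖L₂‖ * (1 / (8 * k)) + ‖L₁‖) := by
    refine main.trans (add_le_add ?_ ?_)
    · rw [hc']; gcongr
    · gcongr
  have a2 : k * (‖L₂‖ * (1 / (8 * k)) + ‖L₁‖) = ‖L₁‖ * (r / 8 + k) := by
    rw [hL2]; field_simp
  rw [a2] at a1
  have a3 : (N : ℝ) * c' ≤ N * (‖L₁‖ / 4) := by gcongr; linarith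
  have a4 : ‖L₁‖ * (N : ℝ) ≤ ‖L₁‖ * (N / 4 + r / 8 + k) := by linarith
  have a5 := le_of_mul_le_mul_left a4 hl1
  linarith

theorem sunit_core (v : ι → AbsoluteValue K ℝ) (O : Subring K)
    (H1 : ∀ z ∈ O, z ≠ 0 → 1 ≤ ∏ i, v i z)
    (H2 : ∀ R : ℝ, {z | z ∈ O ∧ ∀ i, v i z ≤ R}.Finite) : (unitSol O).Finite := by
  obtain ⟨k, hk⟩ : ∃ k : ℝ, k = Fintype.card ι + 1 := ⟨_, rfl⟩
  obtain ⟨c', hc'⟩ : ∃ c' : ℝ, c' = k * Real.log (2 ^ 13) := ⟨_, rfl⟩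
  have hk1 : 1 ≤ k := by rw [hk]; simp
  have hlog : 0 ≤ Real.log (2 ^ 13) := Real.log_nonneg (by norm_num)
  have hc0 : 0 ≤ c' := by rw [hc']; positivity
  have fin : ∀ R : ℝ, {x | x ∈ unitSol O ∧ ‖logVec v x‖ ≤ R}.Finite := by
    intro R
    refine (H2 (Real.exp R)).subset ?_
    rintro x ⟨hx, hxR⟩
    refine ⟨hx.2.2.1, fun i => ?_⟩
    rw [← Real.log_le_iff_le_exp ((v i).pos hx.1)]
    exact ((le_abs_self _).trans (norm_le_pi_norm (logVec v x) (Sum.inl i))).trans hxR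
  obtain ⟨t, htf, htc⟩ := Metric.totallyBounded_iff.1
    (isCompact_closedBall (0 : ι ⊕ ι → ℝ) 1).totallyBounded (1 / (16 * k)) (by positivity)
  have fin2 : ∀ y ∈ t, {x | x ∈ unitSol O ∧ 4 * c' + 1 ≤ ‖logVec v x‖ ∧
      ‖logVec v x‖⁻¹ • logVec v x ∈ Metric.ball y (1 / (16 * k))}.Finite := by
    intro y _
    rcases Set.eq_empty_or_nonempty {x | x ∈ unitSol O ∧ 4 * c' + 1 ≤ ‖logVec v x‖ ∧
      ‖logVec v x‖⁻¹ • logVec v x ∈ Metric.ball y (1 / (16 * k))} with h | ⟨x₁, h₁, h₁', h₁''⟩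
    · rw [h]; exact Set.finite_empty
    · refine (fin ((4 * k + 4) * ‖logVec v x₁‖)).subset ?_
      rintro x ⟨hx, hx', hx''⟩
      refine ⟨hx, sunit_gap v O H1 x₁ x h₁ hx k c' hk hc' h₁' ?_⟩
      rw [← dist_eq_norm]
      rw [Metric.mem_ball] at h₁'' hx''
      calc _ ≤ _ + _ := dist_triangle_right _ _ y
        _ ≤ 1 / (16 * k) + 1 / (16 * k) := add_le_add h₁''.le hx''.le
        _ = _ := by field_simp; norm_num
  refine ((fin (4 * c' + 1)).union (htf.biUnion fin2)).subset ?_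
  intro x hx
  rcases le_total ‖logVec v x‖ (4 * c' + 1) with h | h
  · exact Or.inl ⟨hx, h⟩
  · right
    have : ‖logVec v x‖⁻¹ • logVec v x ∈ Metric.closedBall (0 : ι ⊕ ι → ℝ) 1 := by
      rw [mem_closedBall_zero_iff, norm_smul, norm_inv, norm_norm, inv_mul_cancel₀ (by linarith)]
    obtain ⟨y, hy, hy'⟩ := Set.mem_iUnion₂.1 (htc this)
    exact Set.mem_biUnion hy ⟨hx, h, hy'⟩

end SUnitMain


section SUnitNF
open NumberField

theorem fp_integral {K : Type*} [Field K] [NumberField K] (v : FinitePlace K) (p : K[X]) (hp : p.Monic)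
    (hc : ∀ i, v (p.coeff i) ≤ 1) (z : K) (hz : p.eval z = 0) : v z ≤ 1 := by
  let V : ValuationSubring K :=
    { carrier := {x | v x ≤ 1}
      mul_mem' := fun {a b} ha hb => by
        simp only [Set.mem_setOf_eq, map_mul] at *
        exact mul_le_one₀ ha (apply_nonneg v _) hb
      one_mem' := by simp
      add_mem' := fun {a b} ha hb => (v.add_le a b).trans (max_le ha hb)
      zero_mem' := by simp
      neg_mem' := fun {a} ha => by simpa using ha
      mem_or_inv_mem' := fun x => by
        by_cases hx : v x ≤ 1
        · exact Or.inl hx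
        · right
          simp only [Set.mem_setOf_eq, map_inv₀]
          exact inv_le_one_of_one_le₀ (not_le.1 hx).le }
  have hI : IsIntegral V z := by
    have hl : p ∈ Polynomial.lifts V.subtype := by
      rw [Polynomial.lifts_iff_coeff_lifts]
      intro i
      exact ⟨⟨p.coeff i, hc i⟩, rfl⟩
    obtain ⟨q, hq, -, hqm⟩ := Polynomial.lifts_and_natDegree_eq_and_monic hl hp
    refine ⟨q, hqm, ?_⟩
    rw [← eval_map]
    change (q.map V.subtype).eval z = 0
    rw [hq, hz]
  obtain ⟨y, hy⟩ := IsIntegrallyClosed.isIntegral_iff.1 hI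
  have := y.2
  rw [show z = (y : K) from hy.symm]
  exact this

theorem sunit_nf {K : Type*} [Field K] [NumberField K] (Y : Set K) (hY : Y.Finite) :
    ∃ O : Subring K, (∀ y ∈ Y, y ∈ O ∧ y⁻¹ ∈ O) ∧
      (∀ (p : K[X]) (z : K), p.Monic → (∀ i, p.coeff i ∈ O) → p.eval z = 0 → z ∈ O) ∧
      (unitSol O).Finite := by
  classical
  have hS : (⋃ y ∈ Y, {v : FinitePlace K | y ≠ 0 ∧ v y ≠ 1}).Finite := by
    refine hY.biUnion fun y _ => ?_
    by_cases hy : y = 0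
    · simp [hy]
    · refine (FinitePlace.hasFiniteMulSupport hy).subset ?_
      rintro v ⟨-, hv⟩
      exact hv
  obtain ⟨S, hSm⟩ : ∃ S : Finset (FinitePlace K), ∀ v, v ∈ S ↔ v ∈ (⋃ y ∈ Y, {v : FinitePlace K | y ≠ 0 ∧ v y ≠ 1}) :=
    ⟨hS.toFinset, fun v => by simp⟩
  let O : Subring K :=
    { carrier := {x | ∀ v : FinitePlace K, v ∉ S → v x ≤ 1}
      mul_mem' := fun {a b} ha hb v hv => by
        rw [map_mul]
        exact mul_le_one₀ (ha v hv) (apply_nonneg v _) (hb v hv)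
      one_mem' := by simp
      add_mem' := fun {a b} ha hb v hv => (v.add_le a b).trans (max_le (ha v hv) (hb v hv))
      zero_mem' := by simp
      neg_mem' := fun {a} ha v hv => by simpa using ha v hv }
  refine ⟨O, ?_, ?_, ?_⟩
  · intro y hy
    have : ∀ v : FinitePlace K, v ∉ S → v y ≤ 1 ∧ v y⁻¹ ≤ 1 := by
      intro v hv
      by_cases h0 : y = 0
      · simp [h0]
      · have : v y = 1 := by
          by_contra h
          exact hv ((hSm v).2 (Set.mem_biUnion hy ⟨h0, h⟩))
        simp [this]
    exact ⟨fun v hv => (this v hv).1, fun v hv => (this v hv).2⟩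
  · intro p z hp hc hz v hv
    exact fp_integral v p hp (fun i => hc i v hv) z hz
  · let ι := (Σ v : InfinitePlace K, Fin v.mult) ⊕ S
    let w : ι → AbsoluteValue K ℝ := Sum.elim (fun x => x.1.val) (fun x => x.1.val)
    have prodw : ∀ F : AbsoluteValue K ℝ → ℝ, ∏ i, F (w i) =
        (∏ v : InfinitePlace K, F v.val ^ v.mult) * ∏ v ∈ S, F v.val := by
      intro F
      rw [Fintype.prod_sum_type]
      congr 1
      · rw [Fintype.prod_sigma]
        simp [w]
      · exact Finset.prod_coe_sort S (fun v : FinitePlace K => F v.val)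
    refine sunit_core w O ?_ ?_
    · intro z hz hz0
      rw [prodw (fun a => a z)]
      have pf := prod_abs_eq_one hz0
      have hfs := FinitePlace.hasFiniteMulSupport hz0
      have h1 : ∏ᶠ v : FinitePlace K, v z ≤ ∏ v ∈ S, v z := by
        let T := S ∪ Set.Finite.toFinset hfs
        rw [finprod_eq_prod_of_mulSupport_subset (s := T) _ (by
          intro v hv; simp only [T, Finset.coe_union, Set.mem_union]; right; exact Finset.mem_coe.2 ((Set.Finite.mem_toFinset hfs).2 hv))]
        rw [← Finset.prod_sdiff (Finset.subset_union_left : S ⊆ T)]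
        refine mul_le_of_le_one_left (Finset.prod_nonneg fun v _ => apply_nonneg v _) ?_
        refine Finset.prod_le_one (fun v _ => apply_nonneg v _) fun v hv => ?_
        exact hz v (Finset.mem_sdiff.1 hv).2
      calc (1:ℝ) = _ := pf.symm
        _ ≤ _ := mul_le_mul_of_nonneg_left h1 (Finset.prod_nonneg fun v _ => pow_nonneg (apply_nonneg v _) _)
    · intro R
      refine (finite_setOfPred_mulHeight₁_le (K := K) ((max R 1) ^ Fintype.card ι)).subset ?_
      rintro z ⟨hz, hzR⟩
      simp only [Set.mem_setOf_eq]
      rw [NumberField.mulHeight₁_eq]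
      have e : ∏ᶠ v : FinitePlace K, max (v z) 1 = ∏ v ∈ S, max (v z) 1 := by
        refine finprod_eq_prod_of_mulSupport_subset _ ?_
        intro v hv
        by_contra h
        exact hv (max_eq_right (hz v h))
      rw [e]
      have e2 := prodw (fun a => max (a z) 1)
      have e3 : ∏ i, max (w i z) 1 ≤ ∏ i : ι, max R 1 := Finset.prod_le_prod
        (fun i _ => zero_le_one.trans (le_max_right _ _)) (fun i _ => max_le_max (hzR i) le_rfl)
      rw [Finset.prod_const, Finset.card_univ] at e3
      rw [e2] at e3
      exact e3

end SUnitNF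


section EscapeSection

/-- uniform bounds on the coefficients of `F` -/
structure CBd (F : ℂ[X]) (d : ℕ) (B : ℝ) : Prop where
  deg : F.natDegree = d
  le : ∀ j, ‖F.coeff j‖ ≤ B
  lead : B⁻¹ ≤ ‖F.coeff d‖

theorem arch_growth (F : ℂ[X]) (d : ℕ) (B : ℝ) (hB : 1 ≤ B) (hd : 2 ≤ d) (h : CBd F d B) (z : ℂ)
    (hz : 2 * d * B ^ 2 ≤ ‖z‖) : ‖z‖ ^ 2 / (2 * B) ≤ ‖F.eval z‖ := by
  have hd' : (2:ℝ) ≤ d := by exact_mod_cast hd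
  have hB2 : 1 ≤ B ^ 2 := one_le_pow₀ hB
  have hz1 : 1 ≤ ‖z‖ := by nlinarith
  obtain ⟨e, rfl⟩ : ∃ e, d = e + 2 := ⟨d - 2, by omega⟩
  rw [eval_eq_sum_range, h.deg, Finset.sum_range_succ]
  have h1 : ‖∑ j ∈ Finset.range (e + 2), F.coeff j * z ^ j‖ ≤ (e + 2 : ℕ) * (B * ‖z‖ ^ (e + 1)) := by
    refine (norm_sum_le _ _).trans ?_
    refine (Finset.sum_le_card_nsmul _ _ (B * ‖z‖ ^ (e + 1)) fun j hj => ?_).trans (by simp)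
    rw [norm_mul, norm_pow]
    have := Finset.mem_range.1 hj
    exact mul_le_mul (h.le j) (pow_le_pow_right₀ hz1 (by omega)) (by positivity) (by linarith)
  have h2 : B⁻¹ * ‖z‖ ^ (e + 2) ≤ ‖F.coeff (e + 2) * z ^ (e + 2)‖ := by
    rw [norm_mul, norm_pow]
    exact mul_le_mul_of_nonneg_right h.lead (by positivity)
  have h3 : ‖F.coeff (e + 2) * z ^ (e + 2)‖ - ‖∑ j ∈ Finset.range (e + 2), F.coeff j * z ^ j‖ ≤
      ‖∑ j ∈ Finset.range (e + 2), F.coeff j * z ^ j + F.coeff (e + 2) * z ^ (e + 2)‖ := by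
    have := norm_sub_le (∑ j ∈ Finset.range (e + 2), F.coeff j * z ^ j + F.coeff (e + 2) * z ^ (e + 2))
      (∑ j ∈ Finset.range (e + 2), F.coeff j * z ^ j)
    rw [add_sub_cancel_left] at this
    linarith
  refine le_trans ?_ h3
  have h4 : ((e + 2 : ℕ) : ℝ) * B ≤ ‖z‖ / (2 * B) := by
    rw [le_div_iff₀ (by positivity)]; nlinarith
  have h5 : ((e + 2 : ℕ) : ℝ) * (B * ‖z‖ ^ (e + 1)) ≤ ‖z‖ / (2 * B) * ‖z‖ ^ (e + 1) := by
    rw [← mul_assoc]; gcongr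
  have h6 : B⁻¹ * ‖z‖ ^ (e + 2) = 2 * (‖z‖ / (2 * B) * ‖z‖ ^ (e + 1)) := by
    field_simp; ring
  have h7 : ‖z‖ ^ 2 / (2 * B) ≤ ‖z‖ / (2 * B) * ‖z‖ ^ (e + 1) := by
    have : ‖z‖ ^ 1 ≤ ‖z‖ ^ (e + 1) := pow_le_pow_right₀ hz1 (by omega)
    calc ‖z‖ ^ 2 / (2 * B) = ‖z‖ / (2 * B) * ‖z‖ ^ 1 := by ring
      _ ≤ _ := by gcongr
  linarith

theorem arch_iter (G : ℂ → ℂ) (R B : ℝ) (hB : 1 ≤ B) (hR : 4 * B ≤ R)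
    (hG : ∀ z, R ≤ ‖z‖ → ‖z‖ ^ 2 / (2 * B) ≤ ‖G z‖) (z : ℂ) (hz : R ≤ ‖z‖) (n : ℕ) :
    ‖z‖ ≤ ‖G^[n] z‖ ∧ (‖z‖ / (2 * B)) ^ (2 ^ n) ≤ ‖G^[n] z‖ / (2 * B) := by
  induction n with
  | zero => simp
  | succ n ih =>
    obtain ⟨h1, h2⟩ := ih
    rw [Function.iterate_succ_apply']
    have h3 := hG _ (hz.trans h1)
    have hw : 4 * B ≤ ‖G^[n] z‖ := by linarith
    constructor
    · refine h1.trans (le_trans ?_ h3)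
      rw [le_div_iff₀ (by positivity)]
      nlinarith
    · calc (‖z‖ / (2 * B)) ^ (2 ^ (n + 1)) = ((‖z‖ / (2 * B)) ^ (2 ^ n)) ^ 2 := by
            rw [← pow_mul, pow_succ 2 n]
        _ ≤ (‖G^[n] z‖ / (2 * B)) ^ 2 := by gcongr
        _ = (‖G^[n] z‖ ^ 2 / (2 * B)) / (2 * B) := by field_simp
        _ ≤ _ := by gcongr

theorem eval_norm_le (P : ℂ[X]) (k : ℕ) (hk : P.natDegree ≤ k) (B : ℝ) (hP : ∀ j, ‖P.coeff j‖ ≤ B)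
    (z : ℂ) (R : ℝ) (hR : 1 ≤ R) (hz : ‖z‖ ≤ R) : ‖P.eval z‖ ≤ (k + 1) * B * R ^ k := by
  have hB0 : 0 ≤ B := (norm_nonneg _).trans (hP 0)
  rw [eval_eq_sum_range' (Nat.lt_succ_of_le hk)]
  refine (norm_sum_le _ _).trans ?_
  refine (Finset.sum_le_card_nsmul _ _ (B * R ^ k) fun j hj => ?_).trans (by simp [mul_assoc])
  rw [norm_mul, norm_pow]
  have := Finset.mem_range.1 hj
  exact mul_le_mul (hP j) ((pow_le_pow_left₀ (norm_nonneg _) hz j).trans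
    (pow_le_pow_right₀ hR (by omega))) (by positivity) hB0

theorem arch_escape (d k : ℕ) (hd : 2 ≤ d) (B : ℝ) (hB : 1 ≤ B) : ∃ R : ℝ, 1 ≤ R ∧
    ∀ F P : ℂ[X], CBd F d B → P.natDegree ≤ k → (∀ j, ‖P.coeff j‖ ≤ B) →
    ∀ (m : ℕ) (z : ℂ), k + 1 ≤ 2 ^ m → (fun x => F.eval x)^[m] z = P.eval z →
    ∀ i ≤ m, ‖(fun x => F.eval x)^[i] z‖ ≤ R := by
  set R0 : ℝ := max (2 * d * B ^ 2) (4 * B) with hR0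
  set R1 : ℝ := max R0 ((2 * B) * ((k + 1) * (2 * B) ^ k)) with hR1
  set R2 : ℝ := max R1 ((k + 1) * B * R1 ^ k) with hR2
  have h04 : 4 * B ≤ R0 := le_max_right _ _
  have h01 : R0 ≤ R1 := le_max_left _ _
  have h12 : R1 ≤ R2 := le_max_left _ _
  have hR1' : 1 ≤ R1 := by linarith
  refine ⟨R2, by linarith, ?_⟩
  intro F P hF hPd hP m z hm hFP i hi
  have hG : ∀ z, R0 ≤ ‖z‖ → ‖z‖ ^ 2 / (2 * B) ≤ ‖F.eval z‖ := fun z hz =>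
    arch_growth F d B hB hd hF z ((le_max_left _ _).trans hz)
  have hz : ‖z‖ ≤ R1 := by
    by_contra hcon
    push Not at hcon
    have hzR0 : R0 ≤ ‖z‖ := by linarith
    have h1 := (arch_iter _ R0 B hB h04 hG z hzR0 m).2
    have h2 := eval_norm_le P k hPd B hP z ‖z‖ (by linarith) le_rfl
    rw [hFP] at h1
    set u := ‖z‖ / (2 * B) with hu
    have hu1 : 1 ≤ u := by rw [hu, le_div_iff₀ (by positivity)]; linarith
    have hzu : ‖z‖ = 2 * B * u := by rw [hu]; field_simp
    have h3 : u ^ (2 ^ m) ≤ (k + 1) * (2 * B) ^ k * u ^ k := by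
      calc u ^ (2 ^ m) ≤ ‖P.eval z‖ / (2 * B) := h1
        _ ≤ ((k + 1) * B * ‖z‖ ^ k) / (2 * B) := by gcongr
        _ = (k + 1) * ‖z‖ ^ k / 2 := by field_simp
        _ ≤ (k + 1) * ‖z‖ ^ k := by
          have : 0 ≤ (k + 1) * ‖z‖ ^ k := by positivity
          linarith
        _ = _ := by rw [hzu, mul_pow]; ring
    have h4 : u ^ (k + 1) ≤ u ^ (2 ^ m) := pow_le_pow_right₀ hu1 hm
    have h5 : u * u ^ k ≤ ((k + 1) * (2 * B) ^ k) * u ^ k := by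
      rw [pow_succ'] at h4; linarith
    have h6 := le_of_mul_le_mul_right h5 (by positivity)
    have h7 : ‖z‖ ≤ (2 * B) * ((k + 1) * (2 * B) ^ k) := by rw [hzu]; gcongr
    have := le_max_right R0 ((2 * B) * ((k + 1) * (2 * B) ^ k))
    linarith
  have hP2 : ‖P.eval z‖ ≤ R2 := (eval_norm_le P k hPd B hP z R1 hR1' hz).trans (le_max_right _ _)
  by_contra hcon
  push Not at hcon
  have h1 := (arch_iter _ R0 B hB h04 hG ((fun x => F.eval x)^[i] z) (by linarith) (m - i)).1
  rw [← Function.iterate_add_apply, Nat.sub_add_cancel hi, hFP] at h1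
  linarith

end EscapeSection


section EscapeVal

variable {Γ : Type*} [LinearOrderedCommGroupWithZero Γ]

structure VBd (v : Valuation ℂ Γ) (σ : Γ) (F : ℂ[X]) (d : ℕ) : Prop where
  deg : F.natDegree = d
  le : ∀ j, σ * v (F.coeff j) ≤ 1
  lead : σ ≤ v (F.coeff d)

theorem val_growth (v : Valuation ℂ Γ) (σ : Γ) (hσ : σ ≤ 1) (hσ0 : σ ≠ 0) (F : ℂ[X]) (d : ℕ)
    (hd : 2 ≤ d) (h : VBd v σ F d) (z : ℂ) (hz : 1 < σ ^ 2 * v z) : σ * (v z) ^ 2 ≤ v (F.eval z) := by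
  have hσp : 0 < σ := zero_lt_iff.2 hσ0
  have hw1 : 1 ≤ v z := hz.le.trans (mul_le_of_le_one_left' (pow_le_one' hσ 2))
  have hwp : 0 < v z := zero_lt_one.trans_le hw1
  obtain ⟨e, rfl⟩ : ∃ e, d = e + 2 := ⟨d - 2, by omega⟩
  have hl0 : v (F.coeff (e + 2)) ≠ 0 := (hσp.trans_le h.lead).ne'
  rw [eval_eq_sum_range, h.deg, Finset.sum_range_succ]
  have hA : σ * v z ^ (e + 2) ≤ v (F.coeff (e + 2) * z ^ (e + 2)) := by
    rw [map_mul, map_pow]; exact mul_le_mul' h.lead le_rfl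
  have hlt : v (∑ j ∈ Finset.range (e + 2), F.coeff j * z ^ j) < v (F.coeff (e + 2) * z ^ (e + 2)) := by
    refine Valuation.map_sum_lt v ?_ fun j hj => ?_
    · rw [map_mul, map_pow]; exact mul_ne_zero hl0 (pow_ne_zero _ hwp.ne')
    · refine lt_of_lt_of_le ?_ hA
      rw [map_mul, map_pow]
      have hj' := Finset.mem_range.1 hj
      refine lt_of_mul_lt_mul_left (a := σ) ?_ hσp.le
      calc σ * (v (F.coeff j) * v z ^ j) = (σ * v (F.coeff j)) * v z ^ j := by rw [mul_assoc]
        _ ≤ 1 * v z ^ (e + 1) := mul_le_mul' (h.le j) (pow_le_pow_right' hw1 (by omega))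
        _ < (σ ^ 2 * v z) * v z ^ (e + 1) := mul_lt_mul_of_pos_right hz (pow_pos hwp _)
        _ = σ * (σ * v z ^ (e + 2)) := by
          rw [pow_succ' (v z) (e + 1), sq]; simp only [mul_assoc]
  rw [Valuation.map_add_eq_of_lt_right v hlt]
  refine le_trans ?_ hA
  exact mul_le_mul' le_rfl (pow_le_pow_right' hw1 (by omega))

theorem val_iter (v : Valuation ℂ Γ) (σ : Γ) (hσ : σ ≤ 1) (G : ℂ → ℂ)
    (hG : ∀ z, 1 < σ ^ 2 * v z → σ * (v z) ^ 2 ≤ v (G z)) (z : ℂ) (hz : 1 < σ ^ 2 * v z) (n : ℕ) :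
    v z ≤ v (G^[n] z) ∧ (σ * v z) ^ (2 ^ n) ≤ σ * v (G^[n] z) := by
  induction n with
  | zero => simp
  | succ n ih =>
    obtain ⟨h1, h2⟩ := ih
    rw [Function.iterate_succ_apply']
    have hw : 1 < σ ^ 2 * v (G^[n] z) := hz.trans_le (mul_le_mul' le_rfl h1)
    have h3 := hG _ hw
    have hw' : 1 ≤ σ * v (G^[n] z) := hw.le.trans (by
      rw [sq, mul_assoc]; exact mul_le_of_le_one_left' hσ)
    constructor
    · refine h1.trans (le_trans ?_ h3)
      rw [sq, ← mul_assoc]; exact le_mul_of_one_le_left' hw'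
    · calc (σ * v z) ^ (2 ^ (n + 1)) = ((σ * v z) ^ (2 ^ n)) ^ 2 := by
            rw [← pow_mul, pow_succ 2 n]
        _ ≤ (σ * v (G^[n] z)) ^ 2 := pow_le_pow_left' h2 2
        _ = σ * (σ * v (G^[n] z) ^ 2) := by rw [mul_pow, sq σ, mul_assoc]
        _ ≤ _ := mul_le_mul' le_rfl h3

theorem val_eval_le (v : Valuation ℂ Γ) (σ : Γ) (P : ℂ[X]) (k : ℕ) (hk : P.natDegree ≤ k) 
    (hP : ∀ j, σ * v (P.coeff j) ≤ 1) (z : ℂ) (w : Γ) (hw : 1 ≤ w) (hz : v z ≤ w) : σ * v (P.eval z) ≤ w ^ k := by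
  by_cases hσ0 : σ = 0
  · simp [hσ0]
  have hσp : 0 < σ := zero_lt_iff.2 hσ0
  have : v (P.eval z) ≤ σ⁻¹ * w ^ k := by
    rw [eval_eq_sum_range' (Nat.lt_succ_of_le hk)]
    refine Valuation.map_sum_le v fun j hj => ?_
    rw [map_mul, map_pow]
    have hj' := Finset.mem_range.1 hj
    refine mul_le_mul' ?_ ((pow_le_pow_left' hz j).trans (pow_le_pow_right' hw (by omega)))
    refine le_of_mul_le_mul_left (a := σ) ?_ hσp
    rw [mul_inv_cancel₀ hσ0]; exact hP j
  calc σ * v (P.eval z) ≤ σ * (σ⁻¹ * w ^ k) := mul_le_mul' le_rfl this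
    _ = w ^ k := by rw [← mul_assoc, mul_inv_cancel₀ hσ0, one_mul]

theorem val_escape (v : Valuation ℂ Γ) (σ : Γ) (hσ : σ ≤ 1) (hσ0 : σ ≠ 0) (d k : ℕ) (hd : 2 ≤ d)
    (F P : ℂ[X]) (hF : VBd v σ F d) (hPd : P.natDegree ≤ k) (hP : ∀ j, σ * v (P.coeff j) ≤ 1)
    (m : ℕ) (z : ℂ) (hm : k + 1 ≤ 2 ^ m) (hFP : (fun x => F.eval x)^[m] z = P.eval z) :
    ∀ i ≤ m, σ ^ ((k + 2) * k + 2) * v ((fun x => F.eval x)^[i] z) ≤ 1 := by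
  have hσp : 0 < σ := zero_lt_iff.2 hσ0
  have hG : ∀ z, 1 < σ ^ 2 * v z → σ * (v z) ^ 2 ≤ v (F.eval z) := fun z hz =>
    val_growth v σ hσ hσ0 F d hd hF z hz
  have hz : σ ^ (k + 2) * v z ≤ 1 := by
    by_cases hc : 1 < σ ^ 2 * v z
    · have h1 := (val_iter v σ hσ _ hG z hc m).2
      rw [hFP] at h1
      have hw1 : 1 ≤ v z := hc.le.trans (mul_le_of_le_one_left' (pow_le_one' hσ 2))
      have hu1 : 1 ≤ σ * v z := hc.le.trans (by rw [sq, mul_assoc]; exact mul_le_of_le_one_left' hσ)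
      have h2 := val_eval_le v σ P k hPd hP z (v z) hw1 le_rfl
      have h3 : (σ * v z) ^ (k + 1) ≤ v z ^ k := (pow_le_pow_right' hu1 hm).trans (h1.trans h2)
      have h4 : (σ ^ (k + 1) * v z) * v z ^ k ≤ 1 * v z ^ k := by
        rw [mul_pow, pow_succ' (v z)] at h3
        rwa [one_mul, mul_assoc]
      have h5 := le_of_mul_le_mul_right h4 (pow_pos (zero_lt_one.trans_le hw1) k)
      refine le_trans (mul_le_mul' ?_ le_rfl) h5
      exact pow_le_pow_right_of_le_one' hσ (by omega)
    · refine le_trans (mul_le_mul' ?_ le_rfl) (not_lt.1 hc)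
      exact pow_le_pow_right_of_le_one' hσ (by omega)
  have hP2 : σ ^ ((k + 2) * k + 2) * v (P.eval z) ≤ 1 := by
    have hk2 : σ ^ (k + 2) ≠ 0 := pow_ne_zero _ hσ0
    have h1 : v z ≤ (σ ^ (k + 2))⁻¹ := by
      refine le_of_mul_le_mul_left (a := σ ^ (k + 2)) ?_ (pow_pos hσp _)
      rw [mul_inv_cancel₀ hk2]; exact hz
    have h2 : 1 ≤ (σ ^ (k + 2))⁻¹ := (one_le_inv₀ (pow_pos hσp _)).2 (pow_le_one' hσ _)
    have h3 := val_eval_le v σ P k hPd hP z _ h2 h1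
    calc σ ^ ((k + 2) * k + 2) * v (P.eval z) = (σ * σ ^ ((k + 2) * k)) * (σ * v (P.eval z)) := by
          rw [pow_add, sq]; ac_rfl
      _ ≤ (1 * σ ^ ((k + 2) * k)) * ((σ ^ (k + 2))⁻¹) ^ k := mul_le_mul' (mul_le_mul' hσ le_rfl) h3
      _ = 1 := by rw [one_mul, pow_mul, inv_pow, mul_inv_cancel₀ (pow_ne_zero _ hk2)]
  intro i hi
  by_contra hcon
  push Not at hcon
  have hc : 1 < σ ^ 2 * v ((fun x => F.eval x)^[i] z) := hcon.trans_le
    (mul_le_mul' (pow_le_pow_right_of_le_one' hσ (by omega)) le_rfl)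
  have h1 := (val_iter v σ hσ _ hG ((fun x => F.eval x)^[i] z) hc (m - i)).1
  rw [← Function.iterate_add_apply, Nat.sub_add_cancel hi, hFP] at h1
  exact absurd (hcon.trans_le (mul_le_mul' le_rfl h1)) (not_lt.2 hP2)

end EscapeVal


section CaseB

theorem range_coeff_finite (F : ℂ[X]) : (Set.range F.coeff).Finite := by
  refine ((F.coeffs.finite_toSet).insert 0).subset ?_
  rintro _ ⟨j, rfl⟩
  by_cases h : F.coeff j = 0
  · exact Or.inl h
  · exact Or.inr (coeff_mem_coeffs h)

theorem map_iter (φ : ℂ →+* ℂ) (F : ℂ[X]) (i : ℕ) (z : ℂ) :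
    φ ((fun x => F.eval x)^[i] z) = (fun x => (F.map φ).eval x)^[i] (φ z) := by
  induction i generalizing z with
  | zero => rfl
  | succ i ih =>
    rw [Function.iterate_succ_apply, Function.iterate_succ_apply, ih]
    simp [eval_map, eval₂_at_apply]

theorem map_eval_apply (φ : ℂ →+* ℂ) (F : ℂ[X]) (z : ℂ) :
    φ (F.eval z) = (F.map φ).eval (φ z) := by
  simp [eval_map, eval₂_at_apply]

variable {Y : Set ℂ} {O : Subring ℂ} {s : ℂ} {T : Set (ℂ →+* ℂ)} {B : ℝ}

theorem KL.cbd (h : KL Y O s T B) (F : ℂ[X]) (hF : ∀ j, F.coeff j ∈ Y) (hF0 : F ≠ 0)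
    (hl : F.leadingCoeff⁻¹ ∈ Y) (φ : ℂ →+* ℂ) (hφ : φ ∈ T) : CBd (F.map φ) F.natDegree B where
  deg := natDegree_map φ
  le := fun j => by rw [coeff_map]; exact h.y_le φ hφ _ (hF j)
  lead := by
    rw [coeff_map]
    have h1 := h.y_le φ hφ _ hl
    rw [map_inv₀, norm_inv] at h1
    have h2 : 0 < ‖φ F.leadingCoeff‖ := by
      rw [norm_pos_iff]; exact (map_ne_zero φ).2 (leadingCoeff_ne_zero.2 hF0)
    exact inv_le_of_inv_le₀ h2 h1

theorem KL.vbd (h : KL Y O s T B) (F : ℂ[X]) (hF : ∀ j, F.coeff j ∈ Y) (hF0 : F ≠ 0)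
    (hl : F.leadingCoeff⁻¹ ∈ Y) (V : ValuationSubring ℂ) (hV : O ≤ V.toSubring) :
    VBd V.valuation (V.valuation s) F F.natDegree where
  deg := rfl
  le := fun j => by
    rw [← map_mul]
    exact (V.valuation_le_one_iff _).2 (hV (h.y_mem _ (hF j)))
  lead := by
    have h1 := (V.valuation_le_one_iff _).2 (hV (h.y_mem _ hl))
    rw [map_mul, map_inv₀] at h1
    have h2 : V.valuation F.leadingCoeff ≠ 0 := (Valuation.ne_zero_iff _).2 (leadingCoeff_ne_zero.2 hF0)
    have := mul_le_mul_left h1 (V.valuation F.leadingCoeff)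
    rwa [mul_assoc, inv_mul_cancel₀ h2, mul_one, one_mul] at this

theorem KL.esc_arch (h : KL Y O s T B) (F P : ℂ[X]) (hF : ∀ j, F.coeff j ∈ Y)
    (hl : F.leadingCoeff⁻¹ ∈ Y) (hd : 2 ≤ F.natDegree) (hP : ∀ j, P.coeff j ∈ Y) :
    ∃ R : ℝ, 1 ≤ R ∧ ∀ φ ∈ T, ∀ (m : ℕ) (z : ℂ), P.natDegree + 1 ≤ 2 ^ m →
      (fun x => F.eval x)^[m] z = P.eval z → ∀ i ≤ m, ‖φ ((fun x => F.eval x)^[i] z)‖ ≤ R := by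
  have hF0 : F ≠ 0 := by rintro rfl; simp at hd
  obtain ⟨R, hR, H⟩ := arch_escape F.natDegree P.natDegree hd B h.one_le
  refine ⟨R, hR, fun φ hφ m z hm hz i hi => ?_⟩
  rw [map_iter]
  refine H (F.map φ) (P.map φ) (h.cbd F hF hF0 hl φ hφ) (natDegree_map φ).le
    (fun j => by rw [coeff_map]; exact h.y_le φ hφ _ (hP j)) m (φ z) hm ?_ i hi
  rw [← map_iter, hz, map_eval_apply]

theorem KL.esc_val (h : KL Y O s T B) (F P : ℂ[X]) (hF : ∀ j, F.coeff j ∈ Y)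
    (hl : F.leadingCoeff⁻¹ ∈ Y) (hd : 2 ≤ F.natDegree) (hP : ∀ j, P.coeff j ∈ Y) :
    ∃ κ : ℕ, ∀ (m : ℕ) (z : ℂ), P.natDegree + 1 ≤ 2 ^ m →
      (fun x => F.eval x)^[m] z = P.eval z → ∀ i ≤ m, s ^ κ * ((fun x => F.eval x)^[i] z) ∈ O := by
  have hF0 : F ≠ 0 := by rintro rfl; simp at hd
  refine ⟨(P.natDegree + 2) * P.natDegree + 2, fun m z hm hz i hi => h.val _ fun V hV => ?_⟩
  rw [← V.valuation_le_one_iff, map_mul, map_pow]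
  refine val_escape V.valuation (V.valuation s) ((V.valuation_le_one_iff _).2 (hV h.s_mem))
    ((Valuation.ne_zero_iff _).2 h.s_ne) F.natDegree P.natDegree hd F P (h.vbd F hF hF0 hl V hV) le_rfl
    (fun j => by
      rw [← map_mul]; exact (V.valuation_le_one_iff _).2 (hV (h.y_mem _ (hP j)))) m z hm hz i hi

theorem coeff_comp_mem (K : Subfield ℂ) (p q : ℂ[X]) (hp : ∀ n, p.coeff n ∈ K) (hq : ∀ n, q.coeff n ∈ K) :
    ∀ n, (p.comp q).coeff n ∈ K := by
  have key : ∀ r : ℂ[X], (∀ n, r.coeff n ∈ K) ↔ ∃ r' : K[X], r'.map K.subtype = r := by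
    intro r
    have := lifts_iff_coeff_lifts (f := K.subtype) r
    rw [Polynomial.mem_lifts] at this
    rw [this]
    simp
  obtain ⟨p', rfl⟩ := (key p).1 hp
  obtain ⟨q', rfl⟩ := (key q).1 hq
  exact (key _).2 ⟨p'.comp q', by rw [Polynomial.map_comp]⟩

theorem coeff_X_mem (K : Subfield ℂ) : ∀ n, (X : ℂ[X]).coeff n ∈ K := by
  intro n
  rw [coeff_X]; split_ifs
  · exact K.one_mem
  · exact K.zero_mem

/-- iterate as a polynomial -/
noncomputable def itp (f : ℂ[X]) (n : ℕ) : ℂ[X] := (fun q : ℂ[X] => q.comp f)^[n] X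

theorem itp_eval (f : ℂ[X]) (n : ℕ) (z : ℂ) : (itp f n).eval z = (fun x => f.eval x)^[n] z := by
  induction n generalizing z with
  | zero => simp [itp]
  | succ n ih =>
    rw [itp, Function.iterate_succ_apply', Function.iterate_succ_apply, eval_comp]
    exact ih _

theorem itp_coeff_mem (K : Subfield ℂ) (f : ℂ[X]) (hf : ∀ n, f.coeff n ∈ K) (m : ℕ) :
    ∀ n, (itp f m).coeff n ∈ K := by
  induction m with
  | zero => exact coeff_X_mem K
  | succ m ih =>
    rw [itp, Function.iterate_succ_apply']
    exact coeff_comp_mem K _ _ ih hf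

theorem itp_natDegree (f : ℂ[X]) (m : ℕ) : (itp f m).natDegree = f.natDegree ^ m := by
  induction m with
  | zero => simp [itp]
  | succ m ih =>
    rw [itp, Function.iterate_succ_apply', natDegree_comp, pow_succ, ← ih]; rfl

theorem itp_sub_ne (f c : ℂ[X]) (m : ℕ) (h : {l : ℂ | (fun x => f.eval x)^[m] l = c.eval l}.Finite) :
    c - itp f m ≠ 0 := by
  intro h0
  rw [sub_eq_zero] at h0
  refine Set.infinite_univ (α := ℂ) (h.subset ?_)
  intro l _
  simp only [Set.mem_setOf_eq]
  rw [h0, itp_eval]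

theorem exists_pow_two_le (k : ℕ) : ∃ M, 1 ≤ M ∧ ∀ m ≥ M, k + 1 ≤ 2 ^ m :=
  ⟨k + 1, by omega, fun m hm => hm.le.trans Nat.lt_two_pow_self.le⟩

theorem caseB {f g c : ℂ[X]} (h : Hyp f g c) (hf : f.natDegree = 1) (hg : 2 ≤ g.natDegree) :
    (SolM 1 f g c).Finite := by
  set Y : Set ℂ := (Set.range f.coeff ∪ Set.range g.coeff) ∪ (Set.range c.coeff ∪ {g.leadingCoeff⁻¹}) with hY
  have hYf : Y.Finite := ((range_coeff_finite f).union (range_coeff_finite g)).union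
    ((range_coeff_finite c).union (Set.finite_singleton _))
  have yf : ∀ j, f.coeff j ∈ Y := fun j => Or.inl (Or.inl ⟨j, rfl⟩)
  have yg : ∀ j, g.coeff j ∈ Y := fun j => Or.inl (Or.inr ⟨j, rfl⟩)
  have yc : ∀ j, c.coeff j ∈ Y := fun j => Or.inr (Or.inl ⟨j, rfl⟩)
  have yl : g.leadingCoeff⁻¹ ∈ Y := Or.inr (Or.inr rfl)
  clear_value Y
  obtain ⟨O, s, T, B, kl⟩ := exists_KL Y hYf
  obtain ⟨R, hR, H1⟩ := kl.esc_arch g c yg yl hg yc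
  obtain ⟨κ, H2⟩ := kl.esc_val g c yg yl hg yc
  obtain ⟨M, hM1, hM⟩ := exists_pow_two_le c.natDegree
  refine h.reduce M ((kl.northcott (max 1 c.natDegree) κ R).subset ?_)
  rintro l ⟨m, n, hm, hn, h1, h2⟩
  have ss : ∀ y ∈ Y, y ∈ Subfield.closure Y := fun y hy => Subfield.subset_closure hy
  refine ⟨H2 n l (hM n hn) h2 0 (Nat.zero_le _), fun φ hφ => H1 φ hφ n l (hM n hn) h2 0 (Nat.zero_le _),
    c - itp f m, itp_sub_ne f c m (h.fin_f m (hM1.trans hm)), ?_, ?_, ?_⟩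
  · refine (natDegree_sub_le _ _).trans ?_
    rw [itp_natDegree, hf, one_pow, max_comm]
  · intro n
    rw [coeff_sub]
    exact Subfield.sub_mem _ (ss _ (yc n)) (itp_coeff_mem _ f (fun j => ss _ (yf j)) m n)
  · rw [eval_sub, itp_eval, h1, sub_self]

end CaseB


section CaseMono

theorem rep_true_inj (i j : ℕ) (L L' : List Bool)
    (h : List.replicate i true ++ false :: L = List.replicate j true ++ false :: L') : i = j := by
  induction i generalizing j with
  | zero =>
    cases j with
    | zero => rfl
    | succ j => simp [List.replicate_succ] at h
  | succ i ih =>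
    cases j with
    | zero => simp [List.replicate_succ] at h
    | succ j =>
      simp only [List.replicate_succ, List.cons_append, List.cons.injEq, true_and] at h
      rw [ih j h]

theorem X_pow_iter (d m : ℕ) (z : ℂ) : (fun x => (X ^ d : ℂ[X]).eval x)^[m] z = z ^ (d ^ m) := by
  induction m generalizing z with
  | zero => simp
  | succ m ih => rw [Function.iterate_succ_apply, ih]; simp [← pow_mul, pow_succ']

theorem mono_half (d e : ℕ) (hd : 2 ≤ d) (he : 2 ≤ e) (β : ℂ) (hβ : β ≠ 0)
    (hroot : ∀ n, 1 ≤ n → β ^ n ≠ 1) (c : ℂ[X]) :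
    ∃ M, 1 ≤ M ∧ ∀ (_ : ∀ n, M ≤ n → {l : ℂ | β ^ (e ^ n - 1) * l ^ (e ^ n) = c.eval l}.Finite),
      {l : ℂ | ∃ m n, M ≤ m ∧ M ≤ n ∧ e ^ n < d ^ m ∧ l ^ (d ^ m) = c.eval l ∧
        β ^ (e ^ n - 1) * l ^ (e ^ n) = c.eval l}.Finite := by
  set Y : Set ℂ := insert β (insert 0 (insert 1 (Set.range c.coeff))) with hY
  have hYf : Y.Finite := (((range_coeff_finite c).insert _).insert _).insert _
  have yb : β ∈ Y := Or.inl rfl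
  have y0 : (0:ℂ) ∈ Y := Or.inr (Or.inl rfl)
  have y1 : (1:ℂ) ∈ Y := Or.inr (Or.inr (Or.inl rfl))
  have yc : ∀ j, c.coeff j ∈ Y := fun j => Or.inr (Or.inr (Or.inr ⟨j, rfl⟩))
  clear_value Y
  obtain ⟨O, s, T, B, kl⟩ := exists_KL Y hYf
  have yF : ∀ j, (X ^ d : ℂ[X]).coeff j ∈ Y := by
    intro j; rw [coeff_X_pow]; split_ifs
    · exact y1
    · exact y0
  have yl : (X ^ d : ℂ[X]).leadingCoeff⁻¹ ∈ Y := by simpa using y1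
  have hdeg : 2 ≤ (X ^ d : ℂ[X]).natDegree := by simpa using hd
  obtain ⟨R, hR, H1⟩ := kl.esc_arch _ c yF yl hdeg yc
  obtain ⟨κ, H2⟩ := kl.esc_val _ c yF yl hdeg yc
  obtain ⟨M, hM1, hM⟩ := exists_pow_two_le c.natDegree
  refine ⟨M, hM1, fun hfin => ?_⟩
  set S := {z : ℂ | s ^ κ * z ∈ O ∧ (∀ φ ∈ T, ‖φ z‖ ≤ R) ∧
    ∃ q : ℂ[X], q ≠ 0 ∧ q.natDegree ≤ 1 ∧ (∀ n, q.coeff n ∈ Subfield.closure Y) ∧ q.eval z = 0} with hS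
  have hSf : S.Finite := kl.northcott 1 κ R
  have hinj : Function.Injective (fun n : ℕ => β ^ (e ^ n - 1)) := by
    have h1 : Function.Injective (fun n : ℕ => β ^ n) := by
      have key : ∀ a b : ℕ, a < b → β ^ a ≠ β ^ b := by
        intro a b hab heq
        refine hroot (b - a) (by omega) ?_
        have : β ^ b = β ^ a * β ^ (b - a) := by rw [← pow_add]; congr 1; omega
        rw [this] at heq
        exact (mul_right_eq_self₀.1 heq.symm).resolve_right (pow_ne_zero _ hβ)
      intro a b hab
      rcases lt_trichotomy a b with h | h | h
      · exact absurd hab (key a b h)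
      · exact h
      · exact absurd hab.symm (key b a h)
    intro a b hab
    have h2 := h1 hab
    have ha : 1 ≤ e ^ a := Nat.one_le_pow _ _ (by omega)
    have hb : 1 ≤ e ^ b := Nat.one_le_pow _ _ (by omega)
    have h3 : e ^ a = e ^ b := by omega
    exact Nat.pow_right_injective he h3
  have hN : {n : ℕ | M ≤ n ∧ β ^ (e ^ n - 1) ∈ S}.Finite :=
    (hSf.preimage hinj.injOn).subset fun n hn => hn.2
  have hbig := (hN.biUnion (t := fun n => {l : ℂ | β ^ (e ^ n - 1) * l ^ (e ^ n) = c.eval l})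
    fun n hn => hfin n hn.1).insert 0
  refine hbig.subset ?_
  rintro l ⟨m, n, hm, hn, hlt, h1, h2⟩
  by_cases hl : l = 0
  · exact Or.inl hl
  refine Or.inr (Set.mem_biUnion (x := n) ⟨hn, ?_⟩ h2)
  have hFm : (fun x => (X ^ d : ℂ[X]).eval x)^[m] l = c.eval l := by rw [X_pow_iter, h1]
  have hγ : β ^ (e ^ n - 1) = l ^ (d ^ m - e ^ n) := by
    have h3 : l ^ (d ^ m) = l ^ (d ^ m - e ^ n) * l ^ (e ^ n) := by rw [← pow_add]; congr 1; omega
    rw [← h2, h3] at h1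
    exact (mul_right_cancel₀ (pow_ne_zero _ hl) h1).symm
  refine ⟨kl.val _ fun V hV => ?_, fun φ hφ => ?_, X - C (β ^ (e ^ n - 1)), X_sub_C_ne_zero _, (natDegree_X_sub_C _).le, ?_, by simp⟩
  · rw [hγ, ← V.valuation_le_one_iff, map_mul, map_pow, map_pow]
    have hs : V.valuation s ≤ 1 := (V.valuation_le_one_iff _).2 (hV kl.s_mem)
    rcases le_total (V.valuation l) 1 with h | h
    · exact mul_le_one' (pow_le_one' hs _) (pow_le_one' h _)
    · have h4 := (V.valuation_le_one_iff _).2 (hV (H2 m l (hM m hm) hFm m le_rfl))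
      rw [X_pow_iter, map_mul, map_pow, map_pow] at h4
      exact (mul_le_mul' le_rfl (pow_le_pow_right' h (Nat.sub_le _ _))).trans h4
  · rw [hγ, map_pow, norm_pow]
    rcases le_total ‖φ l‖ 1 with h | h
    · exact (pow_le_one₀ (norm_nonneg _) h).trans hR
    · have h4 := H1 φ hφ m l (hM m hm) hFm m le_rfl
      rw [X_pow_iter, map_pow, norm_pow] at h4
      exact (pow_le_pow_right₀ h (Nat.sub_le _ _)).trans h4
  · intro j
    have h5 : β ^ (e ^ n - 1) ∈ Subfield.closure Y := pow_mem (Subfield.subset_closure yb) _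
    rw [coeff_sub, coeff_X, coeff_C]
    refine Subfield.sub_mem _ ?_ ?_
    · split_ifs
      · exact Subfield.one_mem _
      · exact Subfield.zero_mem _
    · split_ifs
      · exact h5
      · exact Subfield.zero_mem _

theorem mono_iter (b β : ℂ) (e : ℕ) (he : 2 ≤ e) (hb : b = β ^ (e - 1)) (hβ : β ≠ 0) (n : ℕ) (z : ℂ) :
    (fun x => (C b * X ^ e : ℂ[X]).eval x)^[n] z = β ^ (e ^ n - 1) * z ^ (e ^ n) := by
  have key : β * (fun x => (C b * X ^ e : ℂ[X]).eval x)^[n] z = (β * z) ^ (e ^ n) := by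
    induction n generalizing z with
    | zero => simp
    | succ n ih =>
      rw [Function.iterate_succ_apply, ih]
      simp only [eval_mul, eval_C, eval_pow, eval_X]
      rw [pow_succ' e n, pow_mul, hb, ← mul_assoc, ← pow_succ', mul_pow]
      rw [Nat.sub_add_cancel (by omega : 1 ≤ e), mul_pow β z, mul_pow]
  apply mul_left_cancel₀ hβ
  rw [key, ← mul_assoc, ← pow_succ', mul_pow, Nat.sub_add_cancel (Nat.one_le_pow _ _ (by omega))]

theorem caseMono {c : ℂ[X]} (d e : ℕ) (b : ℂ) (hd : 2 ≤ d) (he : 2 ≤ e) (hb0 : b ≠ 0)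
    (h : Hyp (X ^ d) (C b * X ^ e) c) : (SolM 1 (X ^ d) (C b * X ^ e) c).Finite := by
  obtain ⟨β, hβ⟩ := IsAlgClosed.exists_pow_nat_eq b (n := e - 1) (by omega)
  have hβ0 : β ≠ 0 := by rintro rfl; apply hb0; rw [← hβ, zero_pow (by omega)]
  by_cases hroot : ∀ n, 1 ≤ n → β ^ n ≠ 1
  · obtain ⟨M1, hM1, H1⟩ := mono_half d e hd he β hβ0 hroot c
    have hroot' : ∀ n, 1 ≤ n → β⁻¹ ^ n ≠ 1 := by
      intro n hn h1; rw [inv_pow, inv_eq_one] at h1; exact hroot n hn h1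
    obtain ⟨M2, hM2, H2⟩ := mono_half e d he hd β⁻¹ (inv_ne_zero hβ0) hroot' (C β * c.comp (C β⁻¹ * X))
    have hconj : ∀ m l, β⁻¹ ^ (d ^ m - 1) * l ^ (d ^ m) = β * (β⁻¹ * l) ^ (d ^ m) := by
      intro m l
      have : 1 ≤ d ^ m := Nat.one_le_pow _ _ (by omega)
      rw [mul_pow, ← mul_assoc]
      congr 1
      obtain ⟨k, hk⟩ : ∃ k, d ^ m = k + 1 := ⟨d ^ m - 1, by omega⟩
      rw [hk, Nat.add_sub_cancel, pow_succ']; field_simp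
    have F1 := H1 fun n hn => by
      have := h.fin_g n (hM1.trans hn)
      simpa only [mono_iter b β e he hβ.symm hβ0] using this
    have F2 := H2 fun m hm => by
      have := h.fin_f m (hM2.trans hm)
      simp only [X_pow_iter] at this
      refine (this.image (fun l => β * l)).subset ?_
      intro l hl
      refine ⟨β⁻¹ * l, ?_, by field_simp⟩
      simp only [Set.mem_setOf_eq, hconj] at hl ⊢
      simp only [eval_mul, eval_C, eval_comp, eval_X] at hl
      exact mul_left_cancel₀ hβ0 hl
    refine h.reduce (max M1 M2) (((F1.union (F2.image (fun l => β⁻¹ * l))).insert 0).subset ?_)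
    rintro l ⟨m, n, hm, hn, h1, h2⟩
    rw [X_pow_iter] at h1
    rw [mono_iter b β e he hβ.symm hβ0] at h2
    rcases lt_trichotomy (e ^ n) (d ^ m) with hlt | heq | hlt
    · exact Or.inr <| Or.inl ⟨m, n, (le_max_left _ _).trans hm, (le_max_left _ _).trans hn, hlt, h1, h2⟩
    · by_cases hl : l = 0
      · exact Or.inl hl
      · exfalso
        rw [← h1, heq] at h2
        have h3 := (mul_eq_right₀ (pow_ne_zero _ hl)).1 h2
        refine hroot _ ?_ h3
        have : d ^ 1 ≤ d ^ m := Nat.pow_le_pow_right (by omega) (hM1.trans ((le_max_left _ _).trans hm))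
        simp at this; omega
    · refine Or.inr <| Or.inr ⟨β * l, ⟨n, m, (le_max_right _ _).trans hn, (le_max_right _ _).trans hm, hlt, ?_, ?_⟩, by field_simp⟩
      · have : 1 ≤ e ^ n := Nat.one_le_pow _ _ (by omega)
        simp only [eval_mul, eval_C, eval_comp, eval_X]
        rw [inv_mul_cancel_left₀ hβ0, ← h2, mul_pow, ← mul_assoc, ← pow_succ', Nat.sub_add_cancel this]
      · rw [hconj]; simp only [eval_mul, eval_C, eval_comp, eval_X]
        rw [inv_mul_cancel_left₀ hβ0, h1]
  · exfalso
    push Not at hroot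
    obtain ⟨r, hr, hβr⟩ := hroot
    have hbr : b ^ r = 1 := by rw [← hβ, ← pow_mul, mul_comm, pow_mul, hβr, one_pow]
    obtain ⟨i, j, hij, hmod⟩ : ∃ i j : Fin (r + 1), i ≠ j ∧ d ^ (i:ℕ) % r = d ^ (j:ℕ) % r := by
      have := Fintype.exists_ne_map_eq_of_card_lt (fun i : Fin (r + 1) => (⟨d ^ (i:ℕ) % r, Nat.mod_lt _ hr⟩ : Fin r)) (by simp)
      obtain ⟨i, j, h1, h2⟩ := this
      exact ⟨i, j, h1, by simpa using h2⟩
    have hw : ∀ i : Fin (r + 1), ∀ z, wd (X ^ d) (C b * X ^ e) (List.replicate i true ++ [false] ++ List.replicate (r - i) true) z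
        = b ^ (d ^ (i:ℕ)) * z ^ (e * d ^ r) := by
      intro i z
      rw [wd_append, wd_append, wd_rep_true, wd_rep_true, Function.comp_apply, Function.comp_apply, X_pow_iter,
        X_pow_iter, wd_false, wd_nil]
      simp only [Function.comp_apply, id, eval_mul, eval_C, eval_pow, eval_X]
      rw [mul_pow, ← pow_mul, ← pow_mul]
      congr 2
      have : r = (r - i) + i := by omega
      conv_rhs => rw [this, pow_add]
      ring
    have hne : (List.replicate (i:ℕ) true ++ [false] ++ List.replicate (r - i) true) ≠
        (List.replicate (j:ℕ) true ++ [false] ++ List.replicate (r - j) true) := by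
      intro heq
      apply hij
      apply Fin.ext
      refine rep_true_inj _ _ (List.replicate (r - i) true) (List.replicate (r - j) true) ?_
      simpa using heq
    refine h.free _ _ (by simp) (by simp) hne ?_
    funext z
    rw [hw, hw]
    congr 1
    rw [← Nat.mod_add_div (d ^ (i:ℕ)) r, ← Nat.mod_add_div (d ^ (j:ℕ)) r, hmod, pow_add, pow_add, pow_mul, pow_mul,
      hbr, one_pow, one_pow]

end CaseMono


section BasisDet

/-- adapted polynomial basis -/
noncomputable def bas (H : ℂ[X]) (η : ℂ) (e : ℕ) : ℕ → ℕ → ℂ[X]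
  | 0, _ => 1
  | J + 1, k => (C η * X) ^ (k % e) * (bas H η e J (k / e)).comp H

theorem bas_deg (H : ℂ[X]) (η : ℂ) (e : ℕ) (he : 2 ≤ e) (hη : η ≠ 0) (hH : H.natDegree = e)
    (hl : H.leadingCoeff = η ^ (e - 1)) (J k : ℕ) (hk : k < e ^ J) :
    (bas H η e J k).natDegree = k ∧ (bas H η e J k).leadingCoeff = η ^ k := by
  induction J generalizing k with
  | zero => obtain rfl : k = 0 := by simpa using hk
            simp [bas]
  | succ J ih =>
    obtain ⟨h1, h2⟩ := ih (k / e) (Nat.div_lt_of_lt_mul (by rwa [pow_succ'] at hk))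
    have hlin : (C η * X : ℂ[X]).natDegree = 1 := natDegree_C_mul_X η hη
    have hl2 : (bas H η e (J + 1) k).leadingCoeff = η ^ k := by
      rw [bas, leadingCoeff_mul, leadingCoeff_comp (by omega), leadingCoeff_pow, leadingCoeff_mul, leadingCoeff_C,
        leadingCoeff_X, mul_one, h2, h1, hl, ← pow_mul, ← pow_add, ← pow_add]
      congr 1
      conv_rhs => rw [← Nat.mod_add_div k e]
      congr 1
      obtain ⟨q, rfl⟩ : ∃ q, e = q + 1 := ⟨e - 1, by omega⟩
      simp; ring
    refine ⟨?_, hl2⟩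
    have hne : bas H η e (J + 1) k ≠ 0 := by
      intro h0; rw [h0] at hl2; exact pow_ne_zero k hη (by simpa using hl2.symm)
    rw [bas] at hne ⊢
    rw [natDegree_mul (left_ne_zero_of_mul hne) (right_ne_zero_of_mul hne), natDegree_pow, hlin, natDegree_comp, h1, hH,
      mul_one, mul_comm, Nat.mod_add_div]

theorem bas_eval_succ (H : ℂ[X]) (η : ℂ) (e J k : ℕ) (z : ℂ) :
    (bas H η e (J + 1) k).eval z = (η * z) ^ (k % e) * (bas H η e J (k / e)).eval (H.eval z) := by
  simp [bas]

theorem bas_norm (H : ℂ[X]) (η : ℂ) (e : ℕ) (he : 2 ≤ e) (A : ℝ) (hA : 1 ≤ A) (J k : ℕ) (z : ℂ)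
    (hz : ∀ i < J, ‖η * (fun x => H.eval x)^[i] z‖ ≤ A) : ‖(bas H η e J k).eval z‖ ≤ A ^ (e * J) := by
  induction J generalizing k z with
  | zero => simp [bas]
  | succ J ih =>
    rw [bas_eval_succ, norm_mul, norm_pow]
    have h1 := ih (k / e) (H.eval z) fun i hi => by
      have := hz (i + 1) (by omega)
      rwa [Function.iterate_succ_apply] at this
    have h0 := hz 0 (by omega)
    have hm : k % e ≤ e := (Nat.mod_lt _ (by omega)).le
    calc _ ≤ A ^ e * A ^ (e * J) := by
          refine mul_le_mul ?_ h1 (norm_nonneg _) (by positivity)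
          exact (pow_le_pow_left₀ (norm_nonneg _) h0 _).trans (pow_le_pow_right₀ hA hm)
      _ = _ := by rw [← pow_add]; congr 1; ring

theorem bas_mem (O : Subring ℂ) (s : ℂ) (hs : s ∈ O) (H : ℂ[X]) (η : ℂ) (e : ℕ) (he : 2 ≤ e) (a J k : ℕ) (z : ℂ)
    (hz : ∀ i < J, s ^ a * (η * (fun x => H.eval x)^[i] z) ∈ O) :
    s ^ (a * (e * J)) * (bas H η e J k).eval z ∈ O := by
  induction J generalizing k z with
  | zero => simp [bas, O.one_mem]
  | succ J ih =>
    rw [bas_eval_succ]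
    have h1 := ih (k / e) (H.eval z) fun i hi => by
      have := hz (i + 1) (by omega)
      rwa [Function.iterate_succ_apply] at this
    have h0 := hz 0 (by omega)
    have hm : k % e ≤ e := (Nat.mod_lt _ (by omega)).le
    obtain ⟨q, hq⟩ := Nat.exists_eq_add_of_le hm
    have h2 := O.mul_mem (O.mul_mem (O.pow_mem h0 (k % e)) h1) (O.pow_mem (O.pow_mem hs a) q)
    convert h2 using 1
    have : a * (e * (J + 1)) = a * (e * J) + a * (k % e) + a * q := by
      conv_lhs => rw [mul_add e, mul_one, mul_add, ]
      conv_lhs => rw [show a * e = a * (k % e + q) by rw [← hq]]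
      ring
    rw [this]
    simp only [Function.iterate_zero, id]
    rw [mul_pow, pow_add, pow_add, pow_mul s a (k % e), pow_mul s a q]
    ring

theorem det_eval_basis {N : ℕ} (v : Fin N → ℂ) (p : Fin N → ℂ[X]) (hd : ∀ i, (p i).natDegree = i) :
    (Matrix.of (fun i j => ((p j).eval (v i)))).det = (∏ i, (p i).leadingCoeff) * (Matrix.vandermonde v).det := by
  rw [Matrix.eval_matrixOfPolynomials_eq_vandermonde_mul_matrixOfPolynomials v p (fun i => (hd i).le), Matrix.det_mul,
    mul_comm]
  congr 1
  rw [Matrix.det_of_isUpperTriangular (Matrix.matrixOfPolynomials_blockTriangular p (fun i => (hd i).le))]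
  refine Finset.prod_congr rfl fun i _ => ?_
  rw [Matrix.of_apply, leadingCoeff, hd]

theorem det_norm_le {N : ℕ} (A : Matrix (Fin N) (Fin N) ℂ) (x : Fin N → ℝ) (h : ∀ i j, ‖A i j‖ ≤ x j) :
    ‖A.det‖ ≤ (N.factorial : ℝ) * ∏ j, x j := by
  rw [Matrix.det_apply]
  refine (norm_sum_le _ _).trans ?_
  refine (Finset.sum_le_card_nsmul _ _ (∏ j, x j) fun σ _ => ?_).trans ?_
  · have : ‖Equiv.Perm.sign σ • ∏ i, A (σ i) i‖ = ‖∏ i, A (σ i) i‖ := by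
      rcases Int.units_eq_one_or (Equiv.Perm.sign σ) with h | h <;> rw [h] <;> simp
    rw [this, norm_prod]
    exact Finset.prod_le_prod (fun i _ => norm_nonneg _) fun i _ => h _ _
  · simp [Fintype.card_perm]

/-- triangular number -/
def tri (N : ℕ) : ℕ := ∑ i ∈ Finset.range N, i

theorem prod_pow_tri (η : ℂ) (N : ℕ) : ∏ i : Fin N, η ^ (i : ℕ) = η ^ tri N := by
  rw [tri, ← Finset.prod_pow_eq_pow_sum, Fin.prod_univ_eq_prod_range (fun i => η ^ i)]

theorem bas_det (H : ℂ[X]) (η : ℂ) (e : ℕ) (he : 2 ≤ e) (hη : η ≠ 0) (hH : H.natDegree = e)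
    (hl : H.leadingCoeff = η ^ (e - 1)) (J : ℕ) (z : Fin (2 ^ J) → ℂ) :
    (Matrix.of (fun i j : Fin (2 ^ J) => ((bas H η e J j).eval (z i)))).det =
      η ^ tri (2 ^ J) * (Matrix.vandermonde z).det := by
  have key : ∀ k : Fin (2 ^ J), (k : ℕ) < e ^ J := fun k => k.2.trans_le (Nat.pow_le_pow_left he J)
  rw [det_eval_basis z (fun j => bas H η e J j) fun i => (bas_deg H η e he hη hH hl J i (key i)).1]
  congr 1
  rw [← prod_pow_tri]
  exact Finset.prod_congr rfl fun i _ => (bas_deg H η e he hη hH hl J i (key i)).2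

theorem fact_le_two_pow (J : ℕ) : ((2 ^ J).factorial : ℝ) ≤ (2:ℝ) ^ (J * 2 ^ J) := by
  have := Nat.factorial_le_pow (2 ^ J)
  rw [← pow_mul] at this
  exact_mod_cast this

theorem bas_det_norm (H : ℂ[X]) (η : ℂ) (e : ℕ) (he : 2 ≤ e) (hη : η ≠ 0) (hH : H.natDegree = e)
    (hl : H.leadingCoeff = η ^ (e - 1)) (J : ℕ) (z : Fin (2 ^ J) → ℂ) (A : ℝ) (hA : 1 ≤ A)
    (hz : ∀ l, ∀ i < J, ‖η * (fun x => H.eval x)^[i] (z l)‖ ≤ A) :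
    ‖η ^ tri (2 ^ J) * (Matrix.vandermonde z).det‖ ≤ (2 * A ^ e) ^ (J * 2 ^ J) := by
  rw [← bas_det H η e he hη hH hl]
  refine (det_norm_le _ (fun _ => A ^ (e * J)) fun i j => ?_).trans ?_
  · exact bas_norm H η e he A hA J j (z i) (hz i)
  · rw [Finset.prod_const, Finset.card_univ, Fintype.card_fin, mul_pow, ← pow_mul, ← pow_mul, mul_assoc]
    exact mul_le_mul_of_nonneg_right (fact_le_two_pow J) (by positivity)

theorem det_mem (O : Subring ℂ) {N : ℕ} (A : Matrix (Fin N) (Fin N) ℂ) (t : ℂ) (h : ∀ i j, t * A i j ∈ O) :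
    t ^ N * A.det ∈ O := by
  have : t ^ N * A.det = (t • A).det := by rw [Matrix.det_smul]; simp
  rw [this, Matrix.det_apply]
  refine Subring.sum_mem _ fun σ _ => ?_
  rw [Units.smul_def]
  exact Subring.zsmul_mem _ (Subring.prod_mem _ fun i _ => h _ _) _

theorem bas_det_mem (O : Subring ℂ) (s : ℂ) (hs : s ∈ O) (H : ℂ[X]) (η : ℂ) (e : ℕ) (he : 2 ≤ e) (hη : η ≠ 0)
    (hH : H.natDegree = e) (hl : H.leadingCoeff = η ^ (e - 1)) (a J : ℕ) (z : Fin (2 ^ J) → ℂ)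
    (hz : ∀ l, ∀ i < J, s ^ a * (η * (fun x => H.eval x)^[i] (z l)) ∈ O) :
    s ^ (a * e * (J * 2 ^ J)) * (η ^ tri (2 ^ J) * (Matrix.vandermonde z).det) ∈ O := by
  rw [← bas_det H η e he hη hH hl]
  have := det_mem O (Matrix.of (fun i j : Fin (2 ^ J) => ((bas H η e J j).eval (z i)))) (s ^ (a * (e * J)))
    fun i j => bas_mem O s hs H η e he a J j (z i) (hz i)
  rw [← pow_mul] at this
  convert this using 3
  ring

end BasisDet


section Fekete

theorem pbas_det_norm (p : ℂ[X]) (hp : p.Monic) (hD : 1 ≤ p.natDegree) (θ R : ℝ) (hθ0 : 0 < θ) (hθ1 : θ ≤ 1)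
    (hR : 1 ≤ R) (J : ℕ) (z : Fin (2 ^ J) → ℂ) (hz : ∀ l, ‖z l‖ ≤ R) (hpz : ∀ l, ‖p.eval (z l)‖ ≤ θ ^ p.natDegree) :
    ‖(Matrix.vandermonde z).det‖ ≤ θ ^ tri (2 ^ J) * (2 * (R / θ) ^ p.natDegree) ^ ((J + 1) * 2 ^ J) := by
  set D := p.natDegree with hDd
  set b : Fin (2 ^ J) → ℂ[X] := fun k => p ^ ((k:ℕ) / D) * X ^ ((k:ℕ) % D) with hb
  have hbm : ∀ k, (b k).Monic := fun k => (hp.pow _).mul (monic_X_pow _)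
  have hbd : ∀ k, (b k).natDegree = k := by
    intro k
    rw [hb]; simp only
    rw [(hp.pow _).natDegree_mul (monic_X_pow _), hp.natDegree_pow, natDegree_X_pow, mul_comm, ← hDd, Nat.div_add_mod]
  rw [Matrix.det_eval_matrixOfPolynomials_eq_det_vandermonde z b hbd hbm]
  have hRθ : 1 ≤ R / θ := by rw [le_div_iff₀ hθ0]; linarith
  refine (det_norm_le _ (fun k => θ ^ (k:ℕ) * (R / θ) ^ D) fun i j => ?_).trans ?_
  · rw [Matrix.of_apply]
    simp only [hb, eval_mul, eval_pow, eval_X, norm_mul, norm_pow]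
    have hm : (j:ℕ) % D < D := Nat.mod_lt _ hD
    calc ‖p.eval (z i)‖ ^ ((j:ℕ) / D) * ‖z i‖ ^ ((j:ℕ) % D)
        ≤ (θ ^ D) ^ ((j:ℕ) / D) * R ^ D := by
          refine mul_le_mul (pow_le_pow_left₀ (norm_nonneg _) (hpz i) _) ?_ (by positivity) (by positivity)
          exact (pow_le_pow_left₀ (norm_nonneg _) (hz i) _).trans (pow_le_pow_right₀ hR hm.le)
      _ = (θ ^ (D * ((j:ℕ) / D) + D)) * (R / θ) ^ D := by
          rw [← pow_mul, pow_add, mul_assoc, ← mul_pow, mul_div_cancel₀ _ hθ0.ne']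
      _ ≤ θ ^ (j:ℕ) * (R / θ) ^ D := by
          refine mul_le_mul_of_nonneg_right ?_ (by positivity)
          refine pow_le_pow_of_le_one hθ0.le hθ1 ?_
          have := Nat.div_add_mod (j:ℕ) D
          omega
  · rw [Finset.prod_mul_distrib, Finset.prod_const, Finset.card_univ, Fintype.card_fin,
      Fin.prod_univ_eq_prod_range (fun i => θ ^ i), Finset.prod_pow_eq_pow_sum]
    change _ * (θ ^ tri (2 ^ J) * _) ≤ _
    rw [mul_left_comm]
    refine mul_le_mul_of_nonneg_left ?_ (by positivity)
    rw [mul_pow]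
    refine mul_le_mul ((fact_le_two_pow J).trans ?_) ?_ (by positivity) (by positivity)
    · exact pow_le_pow_right₀ (by norm_num) (Nat.mul_le_mul_right _ (by omega))
    · exact pow_le_pow_right₀ (one_le_pow₀ hRθ) (Nat.le_mul_of_pos_left _ (by omega))

theorem fekete_pts (K : Set ℂ) (hK : IsCompact K)
    (hmon : ∀ p : ℂ[X], p.Monic → 1 ≤ p.natDegree → ∃ z ∈ K, 1 ≤ ‖p.eval z‖) (n : ℕ) (hn : 1 ≤ n) :
    ∃ z : Fin (n + 1) → ℂ, (∀ i, z i ∈ K) ∧ Function.Injective z ∧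
      ∀ k, 1 ≤ ∏ j : Fin n, ‖z k - z (k.succAbove j)‖ := by
  have hinf : K.Infinite := by
    intro hfin
    obtain ⟨w, hw, -⟩ := hmon X monic_X (by simp)
    obtain ⟨z, hz, h1⟩ := hmon (∏ k ∈ hfin.toFinset, (X - C k)) (monic_prod_of_monic _ _ fun k _ => monic_X_sub_C k) (by
      rw [natDegree_prod_of_monic _ _ fun k _ => monic_X_sub_C k]
      simp only [natDegree_X_sub_C, Finset.sum_const, smul_eq_mul, mul_one]
      exact Finset.card_pos.2 ⟨w, by simpa using hw⟩)
    rw [eval_prod, Finset.prod_eq_zero (i := z) (by simpa using hz) (by simp)] at h1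
    simp at h1
    linarith
  set h : (Fin (n + 1) → ℂ) → Fin (n + 1) → Fin (n + 1) → ℝ := fun z i j => if i = j then 1 else ‖z i - z j‖ with hh
  set Φ : (Fin (n + 1) → ℂ) → ℝ := fun z => ∏ i, ∏ j, h z i j with hΦ
  have hcont : Continuous Φ := by
    refine continuous_finset_prod _ fun i _ => continuous_finset_prod _ fun j _ => ?_
    by_cases hij : i = j
    · simp [hh, hij, continuous_const]
    · simp only [hh, if_neg hij]; fun_prop
  have hcpt : IsCompact (Set.pi Set.univ fun _ : Fin (n + 1) => K) := isCompact_univ_pi fun _ => hK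
  have : Infinite K := hinf.to_subtype
  let emb : Fin (n + 1) ↪ K := (Fin.valEmbedding).trans (Infinite.natEmbedding K)
  obtain ⟨z, hz, hmax⟩ := hcpt.exists_isMaxOn (f := Φ) ⟨fun i => (emb i : ℂ), fun i _ => (emb i).2⟩ hcont.continuousOn
  have hpos : 0 < Φ z := by
    refine lt_of_lt_of_le ?_ (hmax (a := fun i => (emb i : ℂ)) fun i _ => (emb i).2)
    refine Finset.prod_pos fun i _ => Finset.prod_pos fun j _ => ?_
    simp only [hh]; split_ifs with hij
    · norm_num
    · rw [norm_pos_iff, sub_ne_zero]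
      intro h2; exact hij (emb.injective (Subtype.ext h2))
  have hinj : Function.Injective z := by
    intro i j hij
    by_contra hne
    refine hpos.ne' (Finset.prod_eq_zero (Finset.mem_univ i) (Finset.prod_eq_zero (Finset.mem_univ j) ?_))
    simp [hh, hne, hij]
  refine ⟨z, fun i => hz i trivial, hinj, fun k => ?_⟩
  set E : ℂ → ℝ := fun w => ∏ j : Fin n, ‖w - z (k.succAbove j)‖ with hE
  set Q : ℝ := ∏ i : Fin n, ∏ j : Fin n, h z (k.succAbove i) (k.succAbove j) with hQ
  have hupd : ∀ w, Φ (Function.update z k w) = E w ^ 2 * Q := by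
    intro w
    have h1 : ∀ i : Fin n, Function.update z k w (k.succAbove i) = z (k.succAbove i) := fun i =>
      Function.update_of_ne (Fin.succAbove_ne k i) _ _
    have h3 : ∀ i : Fin n, ¬ (k = k.succAbove i) := fun i => (Fin.succAbove_ne k i).symm
    simp only [hΦ, hh]
    rw [Fin.prod_univ_succAbove _ k, Fin.prod_univ_succAbove _ k]
    simp only [h1, if_true, Function.update_self, Fin.succAbove_ne, h3, if_false, one_mul]
    have h4 : ∀ i : Fin n, (∏ j : Fin (n + 1), if k.succAbove i = j then (1:ℝ) else ‖z (k.succAbove i) - Function.update z k w j‖)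
        = ‖w - z (k.succAbove i)‖ * ∏ j, h z (k.succAbove i) (k.succAbove j) := by
      intro i
      rw [Fin.prod_univ_succAbove _ k]
      simp only [Function.update_self, Fin.succAbove_ne, if_false, h1, hh]
      rw [norm_sub_rev]
    simp only [h4]
    rw [Finset.prod_mul_distrib, ← mul_assoc, sq]
  obtain ⟨w, hw, hw1⟩ := hmon (∏ j : Fin n, (X - C (z (k.succAbove j))))
    (monic_prod_of_monic _ _ fun j _ => monic_X_sub_C _) (by
      rw [natDegree_prod_of_monic _ _ fun k _ => monic_X_sub_C _]; simpa using hn)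
  have hw1' : 1 ≤ E w := by simpa [eval_prod, norm_prod, hE] using hw1
  have h5 := hmax (a := Function.update z k w) (by
    intro i _
    by_cases hik : i = k
    · subst hik; simpa using hw
    · rw [Function.update_of_ne hik]; exact hz i trivial)
  have h6 : Φ z = E (z k) ^ 2 * Q := by rw [← hupd, Function.update_eq_self]
  simp only [Set.mem_setOf_eq] at h5
  rw [hupd, h6] at h5
  have hQ0 : 0 < Q := by
    have hE0 : 0 ≤ E (z k) ^ 2 := sq_nonneg _
    rw [h6] at hpos
    exact pos_of_mul_pos_right hpos hE0
  have h7 := le_of_mul_le_mul_right h5 hQ0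
  have h8 := abs_le_of_sq_le_sq h7 (Finset.prod_nonneg fun j _ => norm_nonneg _)
  exact hw1'.trans ((le_abs_self _).trans h8)

theorem fekete_poly (K : Set ℂ) (hK : IsCompact K) (R : ℝ) (hKR : ∀ z ∈ K, ‖z‖ ≤ R)
    (hmon : ∀ p : ℂ[X], p.Monic → 1 ≤ p.natDegree → ∃ z ∈ K, 1 ≤ ‖p.eval z‖) (n : ℕ) (hn : 1 ≤ n) :
    ∃ P : ℂ[X], P.Monic ∧ P.natDegree = n + 1 ∧ (∀ y, R < ‖y‖ → P.eval y ≠ 0) ∧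
      ∀ (q : ℂ[X]) (M : ℝ), q.natDegree ≤ n → (∀ z ∈ K, ‖q.eval z‖ ≤ M) → ∀ y, R < ‖y‖ →
        ‖q.eval y‖ ≤ (n + 1) * M * ‖P.eval y‖ / (‖y‖ - R) := by
  obtain ⟨z, hzK, hinj, hz⟩ := fekete_pts K hK hmon n hn
  have hne : ∀ y, R < ‖y‖ → ∀ i ∈ Finset.univ, y ≠ z i := by
    rintro y hy i - rfl; exact absurd (hKR _ (hzK i)) (not_le.2 hy)
  refine ⟨Lagrange.nodal Finset.univ z, Lagrange.nodal_monic, by rw [Lagrange.natDegree_nodal]; simp,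
    fun y hy => Lagrange.eval_nodal_not_at_node (hne y hy), ?_⟩
  intro q M hq hM y hy
  have hyR : 0 < ‖y‖ - R := by linarith
  have hM0 : 0 ≤ M := (norm_nonneg _).trans (hM _ (hzK 0))
  have hdeg : q.degree < (Finset.univ : Finset (Fin (n + 1))).card := by
    rw [Finset.card_univ, Fintype.card_fin]
    exact degree_le_natDegree.trans_lt (by exact_mod_cast Nat.lt_succ_of_le hq)
  conv_lhs => rw [Lagrange.eq_interpolate (hinj.injOn) hdeg]
  rw [Lagrange.eval_interpolate_not_at_node _ (hne y hy), norm_mul]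
  have hsum : ‖∑ i : Fin (n + 1), Lagrange.nodalWeight Finset.univ z i * (y - z i)⁻¹ * q.eval (z i)‖ ≤
      (n + 1) * (M / (‖y‖ - R)) := by
    refine (norm_sum_le _ _).trans ((Finset.sum_le_card_nsmul _ _ (M / (‖y‖ - R)) fun i _ => ?_).trans (by simp))
    have hw : ‖Lagrange.nodalWeight Finset.univ z i‖ ≤ 1 := by
      have h1 : ‖Lagrange.nodalWeight Finset.univ z i‖ = (∏ j : Fin n, ‖z i - z (i.succAbove j)‖)⁻¹ := by
        rw [Lagrange.nodalWeight, norm_prod, ← Finset.prod_inv_distrib]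
        simp only [norm_inv]
        have : (Finset.univ.erase i) = (Finset.univ : Finset (Fin n)).map (Fin.succAboveEmb i) := by
          ext j
          simp only [Finset.mem_erase, Finset.mem_univ, and_true, Finset.mem_map, true_and]
          constructor
          · intro h; obtain ⟨k, hk⟩ := Fin.exists_succAbove_eq h; exact ⟨k, hk⟩
          · rintro ⟨k, rfl⟩; exact Fin.succAbove_ne i k
        rw [this, Finset.prod_map]
        rfl
      rw [h1]; exact inv_le_one_of_one_le₀ (hz i)
    have h2 : ‖y - z i‖⁻¹ ≤ (‖y‖ - R)⁻¹ := by
      refine inv_anti₀ hyR ?_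
      have := norm_sub_norm_le y (z i)
      have := hKR _ (hzK i)
      linarith
    rw [norm_mul, norm_mul, norm_inv, div_eq_mul_inv, mul_comm M]
    refine mul_le_mul ?_ (hM _ (hzK i)) (norm_nonneg _) (inv_nonneg.2 hyR.le)
    calc _ ≤ 1 * (‖y‖ - R)⁻¹ := mul_le_mul hw h2 (by positivity) zero_le_one
      _ = _ := one_mul _
  calc _ ≤ ‖(Lagrange.nodal Finset.univ z).eval y‖ * ((n + 1) * (M / (‖y‖ - R))) :=
        mul_le_mul_of_nonneg_left hsum (norm_nonneg _)
    _ = _ := by ring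

end Fekete


section GreenCmp

theorem logpoly (p : ℂ[X]) (hp : p ≠ 0) (R : ℝ) (hR : 0 < R) (hroot : ∀ y, R < ‖y‖ → p.eval y ≠ 0) :
    ∃ Λ : ℂ → ℂ, DifferentiableOn ℂ Λ (Metric.ball 0 R⁻¹) ∧ Λ 0 = 0 ∧ ∀ y, R < ‖y‖ →
      Real.log ‖p.eval y‖ = Real.log ‖p.leadingCoeff‖ + p.natDegree * Real.log ‖y‖ + (Λ y⁻¹).re := by
  have key : ∀ m : Multiset ℂ, (∀ a ∈ m, ‖a‖ ≤ R) → ∃ Λ : ℂ → ℂ, DifferentiableOn ℂ Λ (Metric.ball 0 R⁻¹) ∧ Λ 0 = 0 ∧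
      ∀ y, R < ‖y‖ → (m.map fun a => y - a).prod ≠ 0 ∧
        Real.log ‖(m.map fun a => y - a).prod‖ = m.card * Real.log ‖y‖ + (Λ y⁻¹).re := by
    intro m
    induction m using Multiset.induction_on with
    | empty => intro _; exact ⟨fun _ => 0, differentiableOn_const _, rfl, by simp⟩
    | cons a m ih =>
      intro hm
      obtain ⟨Λ, h1, h2, h3⟩ := ih fun b hb => hm b (Multiset.mem_cons_of_mem hb)
      have ha := hm a (Multiset.mem_cons_self a m)
      refine ⟨fun w => Complex.log (1 - a * w) + Λ w, ?_, by simp [h2], ?_⟩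
      · refine DifferentiableOn.add (DifferentiableOn.clog (by fun_prop) ?_) h1
        intro w hw
        rw [mem_ball_zero_iff] at hw
        refine Complex.mem_slitPlane_of_norm_lt_one (z := - (a * w)) ?_ |> fun h => by simpa [sub_eq_add_neg] using h
        rw [norm_neg, norm_mul]
        calc ‖a‖ * ‖w‖ ≤ R * ‖w‖ := mul_le_mul_of_nonneg_right ha (norm_nonneg _)
          _ < R * R⁻¹ := mul_lt_mul_of_pos_left hw hR
          _ = 1 := mul_inv_cancel₀ hR.ne'
      · intro y hy
        obtain ⟨h4, h5⟩ := h3 y hy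
        have hy0 : y ≠ 0 := by rintro rfl; simp at hy; linarith
        have hya : y - a ≠ 0 := by rw [sub_ne_zero]; rintro rfl; linarith
        have h6 : y - a = y * (1 - a * y⁻¹) := by field_simp
        have h7 : 1 - a * y⁻¹ ≠ 0 := by intro h; rw [h6, h, mul_zero] at hya; exact hya rfl
        rw [Multiset.map_cons, Multiset.prod_cons]
        refine ⟨mul_ne_zero hya h4, ?_⟩
        rw [norm_mul, Real.log_mul (norm_ne_zero_iff.2 hya) (norm_ne_zero_iff.2 h4), h5, h6, norm_mul,
          Real.log_mul (norm_ne_zero_iff.2 hy0) (norm_ne_zero_iff.2 h7), Complex.add_re, Complex.log_re, Multiset.card_cons]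
        push_cast; ring
  obtain ⟨Λ, h1, h2, h3⟩ := key p.roots fun a ha => by
    by_contra hc
    exact hroot a (not_le.1 hc) (isRoot_of_mem_roots ha)
  refine ⟨Λ, h1, h2, fun y hy => ?_⟩
  have hs := IsAlgClosed.splits p
  have he : p.eval y = p.leadingCoeff * (p.roots.map fun a => y - a).prod := hs.eval_eq_prod_roots y
  obtain ⟨h4, h5⟩ := h3 y hy
  rw [he, norm_mul, Real.log_mul (norm_ne_zero_iff.2 (leadingCoeff_ne_zero.2 hp)) (norm_ne_zero_iff.2 h4), h5,
    hs.natDegree_eq_card_roots]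
  ring

theorem bc_cmp (q P : ℂ[X]) (n : ℕ) (R L : ℝ) (hR : 0 < R) (hL : 1 ≤ L) (hq0 : q ≠ 0) (hq : q.natDegree = n)
    (hql : ‖q.leadingCoeff‖ = 1) (hP : P.Monic) (hPn : P.natDegree = n + 1) (hqr : ∀ y, R < ‖y‖ → q.eval y ≠ 0)
    (hPr : ∀ y, R < ‖y‖ → P.eval y ≠ 0) (hle : ∀ y, R < ‖y‖ → ‖q.eval y‖ ≤ L * ‖P.eval y‖ / (‖y‖ - R))
    (y : ℂ) (hy : 4 * R ≤ ‖y‖) :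
    |Real.log ‖q.eval y‖ - (Real.log ‖P.eval y‖ - Real.log ‖y‖)| ≤ 2 * Real.log (2 * L) := by
  obtain ⟨Λ, a1, a2, a3⟩ := logpoly q hq0 R hR hqr
  obtain ⟨Λ', b1, b2, b3⟩ := logpoly P hP.ne_zero R hR hPr
  have hM : 0 < Real.log (2 * L) := Real.log_pos (by linarith)
  have hsub : Metric.ball (0:ℂ) (2 * R)⁻¹ ⊆ Metric.ball 0 R⁻¹ :=
    Metric.ball_subset_ball (inv_anti₀ hR (by linarith))
  have hval : ∀ y, R < ‖y‖ → (Λ y⁻¹ - Λ' y⁻¹).re = Real.log ‖q.eval y‖ - (Real.log ‖P.eval y‖ - Real.log ‖y‖) := by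
    intro y hy
    rw [a3 y hy, b3 y hy, hq, hPn, hql, hP.leadingCoeff, Complex.sub_re]
    simp; ring
  have hw : y⁻¹ ∈ Metric.ball (0:ℂ) (2 * R)⁻¹ := by
    rw [mem_ball_zero_iff, norm_inv]
    exact inv_strictAnti₀ (by linarith) (by linarith)
  have hbc := Complex.borelCaratheodory_zero (f := fun w => Λ w - Λ' w) (M := Real.log (2 * L)) (R := (2 * R)⁻¹) (z := y⁻¹) hM
    ((a1.sub b1).mono hsub) ?_ (by positivity) hw (by simp [a2, b2])
  · rw [← hval y (by linarith)]
    refine (Complex.abs_re_le_norm _).trans (hbc.trans ?_)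
    have hy0 : 0 < ‖y‖ := by linarith
    have h1 : ‖y⁻¹‖ ≤ (4 * R)⁻¹ := by rw [norm_inv]; exact inv_anti₀ (by positivity) hy
    have h2 : (2 * R)⁻¹ = 2 * (4 * R)⁻¹ := by field_simp; norm_num
    have h3 : 0 < (4 * R)⁻¹ := by positivity
    rw [div_le_iff₀ (by linarith)]
    have : ‖y⁻¹‖ ≤ (2 * R)⁻¹ - ‖y⁻¹‖ := by linarith
    exact mul_le_mul_of_nonneg_left this (by linarith)
  · intro w hw
    by_cases hw0 : w = 0
    · subst hw0; simp only [Set.mem_setOf_eq, a2, b2]; simp [hM.le]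
    · have hwn : 0 < ‖w‖ := norm_pos_iff.2 hw0
      rw [mem_ball_zero_iff] at hw
      have h2R : 2 * R < ‖w⁻¹‖ := by
        rw [norm_inv]
        have := inv_strictAnti₀ hwn hw
        rwa [inv_inv] at this
      have h1 := hval w⁻¹ (by linarith)
      rw [inv_inv] at h1
      simp only [Set.mem_setOf_eq]
      rw [h1]
      have hqn : 0 < ‖q.eval w⁻¹‖ := norm_pos_iff.2 (hqr _ (by linarith))
      have hPn : 0 < ‖P.eval w⁻¹‖ := norm_pos_iff.2 (hPr _ (by linarith))
      have hyn : 0 < ‖w⁻¹‖ := by linarith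
      have h4 : ‖q.eval w⁻¹‖ ≤ 2 * L * ‖P.eval w⁻¹‖ / ‖w⁻¹‖ := by
        refine (hle w⁻¹ (by linarith)).trans ?_
        rw [div_le_div_iff₀ (by linarith) hyn]
        have : 0 ≤ L * ‖P.eval w⁻¹‖ := by positivity
        nlinarith
      have h5 := Real.log_le_log hqn h4
      rw [Real.log_div (by positivity) hyn.ne', Real.log_mul (by positivity) hPn.ne'] at h5
      linarith

theorem green_cmp (F G : ℂ[X]) (d e : ℕ) (hd : 1 ≤ d) (he : 1 ≤ e) (hFd : F.natDegree = d) (hGd : G.natDegree = e)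
    (hFl : ‖F.leadingCoeff‖ = 1) (hGl : ‖G.leadingCoeff‖ = 1) (K : Set ℂ) (hK : IsCompact K) (R : ℝ) (hR : 1 ≤ R)
    (hKR : ∀ z ∈ K, ∀ i, ‖(fun x => F.eval x)^[i] z‖ ≤ R ∧ ‖(fun x => G.eval x)^[i] z‖ ≤ R)
    (hF : ∀ y, R < ‖y‖ → ∀ i, (fun x => F.eval x)^[i] y ≠ 0) (hG : ∀ y, R < ‖y‖ → ∀ i, (fun x => G.eval x)^[i] y ≠ 0)
    (hmon : ∀ p : ℂ[X], p.Monic → 1 ≤ p.natDegree → ∃ z ∈ K, 1 ≤ ‖p.eval z‖)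
    (i j : ℕ) (y : ℂ) (hy : 4 * R ≤ ‖y‖) :
    |(e:ℝ) ^ j * Real.log ‖(fun x => F.eval x)^[i] y‖ - (d:ℝ) ^ i * Real.log ‖(fun x => G.eval x)^[j] y‖| ≤
      2 * ((e:ℝ) ^ j + (d:ℝ) ^ i) * Real.log R := by
  have hlead : ∀ (H : ℂ[X]) (i : ℕ), ‖H.leadingCoeff‖ = 1 → 1 ≤ H.natDegree → ‖(itp H i).leadingCoeff‖ = 1 := by
    intro H i h1 h2
    induction i with
    | zero => simp [itp]
    | succ i ih =>
      have : itp H (i + 1) = (itp H i).comp H := by rw [itp, Function.iterate_succ_apply']; rfl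
      rw [this, leadingCoeff_comp (by omega), norm_mul, norm_pow, ih, h1, one_pow, one_mul]
  have main : ∀ k : ℕ, 1 ≤ k → (k:ℝ) * |(e:ℝ) ^ j * Real.log ‖(fun x => F.eval x)^[i] y‖ -
      (d:ℝ) ^ i * Real.log ‖(fun x => G.eval x)^[j] y‖| ≤
      4 * Real.log (2 * (k * (d ^ i * e ^ j : ℕ) + 1)) + k * (2 * ((e:ℝ) ^ j + (d:ℝ) ^ i) * Real.log R) := by
    intro k hk
    set n := k * (d ^ i * e ^ j) with hn
    have hn1 : 1 ≤ n := Nat.one_le_iff_ne_zero.2 (by positivity)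
    obtain ⟨P, hP, hPn, hPr, hPq⟩ := fekete_poly K hK R (fun z hz => by simpa using (hKR z hz 0).1) hmon n hn1
    have sub : ∀ (H : ℂ[X]) (a t : ℕ), ‖H.leadingCoeff‖ = 1 → 1 ≤ H.natDegree → (∀ z ∈ K, ‖(fun x => H.eval x)^[a] z‖ ≤ R) →
        (∀ y, R < ‖y‖ → (fun x => H.eval x)^[a] y ≠ 0) → H.natDegree ^ a * t = n →
        |t * Real.log ‖(fun x => H.eval x)^[a] y‖ - (Real.log ‖P.eval y‖ - Real.log ‖y‖)| ≤
          2 * Real.log (2 * ((n + 1) * R ^ t)) := by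
      intro H a t h1 h2 h3 h4 h5
      have hl := hlead H a h1 h2
      have hq0 : itp H a ^ t ≠ 0 := by
        apply pow_ne_zero; intro h; rw [h] at hl; simp at hl
      have := bc_cmp (itp H a ^ t) P n R ((n + 1) * R ^ t) (by linarith) ?_ hq0 (by
        rw [natDegree_pow, itp_natDegree, mul_comm, h5]) (by rw [leadingCoeff_pow, norm_pow, hl, one_pow]) hP hPn
        (fun y hy => by rw [eval_pow, itp_eval]; exact pow_ne_zero _ (h4 y hy)) hPr ?_ y hy
      · rwa [eval_pow, itp_eval, norm_pow, Real.log_pow] at this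
      · have : 1 ≤ R ^ t := one_le_pow₀ hR
        have : (0:ℝ) ≤ n := Nat.cast_nonneg n
        nlinarith
      · intro y hy
        have := hPq (itp H a ^ t) (R ^ t) (by rw [natDegree_pow, itp_natDegree, mul_comm, h5]) (fun z hz => by
          rw [eval_pow, itp_eval, norm_pow]; exact pow_le_pow_left₀ (norm_nonneg _) (h3 z hz) t) y hy
        exact this
    have s1 := sub F i (k * e ^ j) hFl (by omega) (fun z hz => (hKR z hz i).1) (fun y hy => hF y hy i) (by
      rw [hFd, hn]; ring)
    have s2 := sub G j (k * d ^ i) hGl (by omega) (fun z hz => (hKR z hz j).2) (fun y hy => hG y hy j) (by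
      rw [hGd, hn]; ring)
    have hexp : ∀ t : ℕ, Real.log (2 * (((n:ℝ) + 1) * R ^ t)) = Real.log (2 * ((n:ℝ) + 1)) + t * Real.log R := by
      intro t
      rw [← mul_assoc, Real.log_mul (by positivity) (by positivity), Real.log_pow]
    rw [hexp] at s1 s2
    rw [← abs_of_nonneg (Nat.cast_nonneg k : (0:ℝ) ≤ k), ← abs_mul, abs_of_nonneg (Nat.cast_nonneg k : (0:ℝ) ≤ k)]
    have hnc : (n:ℝ) = k * (d ^ i * e ^ j : ℕ) := by rw [hn]; push_cast; ring
    rw [hnc] at s1 s2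
    push_cast at s1 s2 ⊢
    rw [abs_le] at s1 s2 ⊢
    constructor
    · linarith [s1.1, s2.2]
    · linarith [s1.2, s2.1]
  by_contra hcon
  push Not at hcon
  set a := |(e:ℝ) ^ j * Real.log ‖(fun x => F.eval x)^[i] y‖ - (d:ℝ) ^ i * Real.log ‖(fun x => G.eval x)^[j] y‖| with ha
  set b := 2 * ((e:ℝ) ^ j + (d:ℝ) ^ i) * Real.log R with hb
  set D : ℕ := d ^ i * e ^ j with hD
  have hD1 : 1 ≤ D := Nat.one_le_iff_ne_zero.2 (by positivity)
  have hlim : Filter.Tendsto (fun x : ℝ => Real.log x / x) Filter.atTop (nhds 0) := by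
    simpa using (Real.isLittleO_log_id_atTop).tendsto_div_nhds_zero
  have hseq : Filter.Tendsto (fun k : ℕ => 2 * ((k:ℝ) * D + 1)) Filter.atTop Filter.atTop := by
    refine Filter.Tendsto.const_mul_atTop (by norm_num) (Filter.tendsto_atTop_add_const_right _ _ ?_)
    exact Filter.Tendsto.atTop_mul_const (by exact_mod_cast hD1) tendsto_natCast_atTop_atTop
  have hev := (hlim.comp hseq).eventually (gt_mem_nhds (show (0:ℝ) < (a - b) / (16 * D) by
    have : (0:ℝ) < D := by exact_mod_cast hD1
    have : 0 < a - b := by linarith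
    positivity))
  obtain ⟨k, hk1, hk2⟩ := ((Filter.eventually_ge_atTop 1).and hev).exists
  have h1 := main k hk1
  simp only [Function.comp_apply] at hk2
  have hk1' : (1:ℝ) ≤ k := by exact_mod_cast hk1
  have hD1' : (1:ℝ) ≤ D := by exact_mod_cast hD1
  have hx : 0 < 2 * ((k:ℝ) * D + 1) := by positivity
  rw [div_lt_iff₀ hx] at hk2
  have h2 : (a - b) / (16 * D) * (2 * ((k:ℝ) * D + 1)) ≤ (a - b) / (16 * D) * (4 * (k * D)) := by
    refine mul_le_mul_of_nonneg_left ?_ (div_nonneg (by linarith) (by positivity))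
    nlinarith
  have h3 : (a - b) / (16 * D) * (4 * (k * D)) = (a - b) * k / 4 := by field_simp; norm_num
  nlinarith

end GreenCmp


section WordsProp

theorem eval_reverse_mul (P : ℂ[X]) (w : ℂ) (hw : w ≠ 0) :
    P.eval w⁻¹ * w ^ P.natDegree = P.reverse.eval w := by
  letI : Invertible w⁻¹ := invertibleOfNonzero (inv_ne_zero hw)
  have h := eval₂_reverse_mul_pow (RingHom.id ℂ) w⁻¹ P
  have h1 : ⅟ (w⁻¹) = w := by rw [invOf_eq_inv, inv_inv]
  rw [h1] at h
  rw [eval₂_id, eval₂_id] at h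
  rw [← h, mul_assoc, ← mul_pow, inv_mul_cancel₀ hw, one_pow, mul_one]

theorem poly_prop (P Q : ℂ[X]) (n : ℕ) (hn : 1 ≤ n) (hP : P.natDegree = n) (hQ : Q.natDegree = n)
    (hl : ‖P.leadingCoeff‖ = ‖Q.leadingCoeff‖) (C' S : ℝ)
    (h : ∀ y, S ≤ ‖y‖ → Real.log ‖P.eval y‖ - Real.log ‖Q.eval y‖ ≤ C' * ((‖P.eval y‖ ^ 2)⁻¹ + (‖Q.eval y‖ ^ 2)⁻¹)) :
    ∃ ζ : ℂ, P = C ζ * Q := by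
  have hP0 : P.leadingCoeff ≠ 0 := leadingCoeff_ne_zero.2 (by rintro rfl; simp at hP; omega)
  have hQ0 : Q.leadingCoeff ≠ 0 := leadingCoeff_ne_zero.2 (by rintro rfl; simp at hQ; omega)
  set ζ := P.leadingCoeff / Q.leadingCoeff with hζ
  have hζn : ‖ζ‖ = 1 := by rw [hζ, norm_div, hl, div_self (norm_ne_zero_iff.2 hQ0)]
  have hζ0 : ζ ≠ 0 := by intro h0; rw [h0] at hζn; simp at hζn
  refine ⟨ζ, ?_⟩
  by_contra hne
  set Q' := C ζ * Q with hQ'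
  set E := P - Q' with hE
  have hE0 : E ≠ 0 := sub_ne_zero.2 hne
  have hQ'd : Q'.natDegree = n := by rw [hQ', natDegree_C_mul hζ0, hQ]
  have hQ'l : Q'.leadingCoeff = P.leadingCoeff := by
    rw [hQ', leadingCoeff_mul, leadingCoeff_C, hζ, div_mul_cancel₀ _ hQ0]
  have hQ'e : ∀ y, ‖Q'.eval y‖ = ‖Q.eval y‖ := by intro y; rw [hQ']; simp [hζn]
  have hEd : E.natDegree < n := by
    have hPne : P ≠ 0 := leadingCoeff_ne_zero.1 hP0
    have hQ'ne : Q' ≠ 0 := leadingCoeff_ne_zero.1 (by rw [hQ'l]; exact hP0)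
    have := degree_sub_lt (p := P) (q := Q') (by rw [degree_eq_natDegree hPne, degree_eq_natDegree hQ'ne, hP, hQ'd])
      hPne hQ'l.symm
    have := natDegree_lt_natDegree hE0 this
    rwa [hP] at this
  set r := n - E.natDegree with hr
  have hr1 : 1 ≤ r := by omega
  have hrn : r ≤ n := Nat.sub_le _ _
  set a := E.leadingCoeff / P.leadingCoeff with ha
  have ha0 : a ≠ 0 := div_ne_zero (leadingCoeff_ne_zero.2 hE0) hP0
  obtain ⟨ω, hω⟩ := IsAlgClosed.exists_pow_nat_eq ((‖a‖ : ℂ) / a) (n := r) (by omega)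
  have han : 0 < ‖a‖ := norm_pos_iff.2 ha0
  have hωn : ‖ω‖ = 1 := by
    have h1 : ‖ω‖ ^ r = 1 := by
      rw [← norm_pow, hω, norm_div, Complex.norm_real, norm_norm, div_self han.ne']
    exact (pow_eq_one_iff_of_nonneg (norm_nonneg _) (by omega)).1 h1
  have hω0 : ω ≠ 0 := by intro h0; rw [h0] at hωn; simp at hωn
  have hcont : ∀ p : ℂ[X], Filter.Tendsto (fun u : ℝ => p.reverse.eval ((u:ℂ) * ω)) (nhdsWithin 0 (Set.Ioi 0))
      (nhds p.leadingCoeff) := by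
    intro p
    have h1 : Continuous (fun u : ℝ => p.reverse.eval ((u:ℂ) * ω)) := by fun_prop
    have h2 := (h1.tendsto 0).mono_left (nhdsWithin_le_nhds (s := Set.Ioi 0))
    simpa [← coeff_zero_eq_eval_zero, coeff_zero_reverse] using h2
  have t1 : Filter.Tendsto (fun u : ℝ => (ω ^ r * (E.reverse.eval ((u:ℂ) * ω) / Q'.reverse.eval ((u:ℂ) * ω))).re)
      (nhdsWithin 0 (Set.Ioi 0)) (nhds ‖a‖) := by
    have h1 := ((hcont E).div (hcont Q') (by rw [hQ'l]; exact hP0)).const_mul (ω ^ r)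
    have hlim : ω ^ r * (E.leadingCoeff / Q'.leadingCoeff) = ((‖a‖ : ℝ) : ℂ) := by
      rw [hω, hQ'l, ← ha, div_mul_cancel₀ _ ha0]
    rw [hlim] at h1
    have h2 := (Complex.continuous_re.tendsto _).comp h1
    rw [Complex.ofReal_re] at h2
    exact h2
  have t2 : Filter.Tendsto (fun u : ℝ => |C'| * ((‖P.reverse.eval ((u:ℂ) * ω)‖ ^ 2)⁻¹ + (‖Q'.reverse.eval ((u:ℂ) * ω)‖ ^ 2)⁻¹))
      (nhdsWithin 0 (Set.Ioi 0)) (nhds (|C'| * ((‖P.leadingCoeff‖ ^ 2)⁻¹ + (‖P.leadingCoeff‖ ^ 2)⁻¹))) := by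
    have hp : ‖P.leadingCoeff‖ ^ 2 ≠ 0 := pow_ne_zero _ (norm_ne_zero_iff.2 hP0)
    have h1 := ((((hcont P).norm.pow 2).inv₀ hp).add (((hcont Q').norm.pow 2).inv₀ (by rw [hQ'l]; exact hp))).const_mul |C'|
    rwa [hQ'l] at h1
  set A := |C'| * ((‖P.leadingCoeff‖ ^ 2)⁻¹ + (‖P.leadingCoeff‖ ^ 2)⁻¹) with hA
  have hA0 : 0 ≤ A := by positivity
  have ev1 := t1.eventually (lt_mem_nhds (show ‖a‖ / 2 < ‖a‖ by linarith))
  have ev2 := t2.eventually (gt_mem_nhds (show A < A + 1 by linarith))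
  have hsmall : ∀ δ : ℝ, 0 < δ → ∀ᶠ u : ℝ in nhdsWithin 0 (Set.Ioi 0), 0 < u ∧ u < δ := by
    intro δ hδ
    exact Ioo_mem_nhdsGT hδ
  set δ : ℝ := min (1 / (|S| + 1)) (min (1 / (A + 1)) (min 1 (‖a‖ / (8 * (A + 1))))) with hδ
  have hδ0 : 0 < δ := by positivity
  have ev3 := hsmall δ hδ0
  have nz : ∀ p : ℂ[X], p.leadingCoeff ≠ 0 → ∀ᶠ u : ℝ in nhdsWithin 0 (Set.Ioi 0), p.reverse.eval ((u:ℂ) * ω) ≠ 0 :=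
    fun p hp => (hcont p).eventually_ne hp
  obtain ⟨u, ⟨h1, h2, ⟨hu0, huδ⟩, h4⟩, h5⟩ := ((ev1.and (ev2.and (ev3.and (nz P hP0)))).and
    (nz Q' (by rw [hQ'l]; exact hP0))).exists
  have hu1 : u < 1 / (|S| + 1) := huδ.trans_le (min_le_left _ _)
  have hu2 : u < 1 / (A + 1) := huδ.trans_le ((min_le_right _ _).trans (min_le_left _ _))
  have hu3 : u < 1 := huδ.trans_le ((min_le_right _ _).trans ((min_le_right _ _).trans (min_le_left _ _)))
  have hu4 : u < ‖a‖ / (8 * (A + 1)) := huδ.trans_le ((min_le_right _ _).trans ((min_le_right _ _).trans (min_le_right _ _)))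
  set w : ℂ := (u:ℂ) * ω with hw
  have hwn : ‖w‖ = u := by rw [hw, norm_mul, hωn, mul_one, Complex.norm_real, Real.norm_of_nonneg hu0.le]
  have hw0 : w ≠ 0 := by rw [← norm_pos_iff, hwn]; exact hu0
  have hS : S ≤ ‖w⁻¹‖ := by
    rw [norm_inv, hwn]
    have : |S| + 1 ≤ u⁻¹ := by
      rw [le_inv_comm₀ (by positivity) hu0]; rw [one_div] at hu1; exact hu1.le
    linarith [le_abs_self S]
  have hPv : P.eval w⁻¹ * w ^ n = P.reverse.eval w := by rw [← hP]; exact eval_reverse_mul P w hw0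
  have hQv : Q'.eval w⁻¹ * w ^ n = Q'.reverse.eval w := by rw [← hQ'd]; exact eval_reverse_mul Q' w hw0
  have hEv : E.eval w⁻¹ * w ^ E.natDegree = E.reverse.eval w := eval_reverse_mul E w hw0
  have hPne : P.eval w⁻¹ ≠ 0 := fun h0 => h4 (by rw [← hPv, h0, zero_mul])
  have hQne : Q'.eval w⁻¹ ≠ 0 := fun h0 => h5 (by rw [← hQv, h0, zero_mul])
  have hmain := h w⁻¹ hS
  rw [← hQ'e, ← Real.log_div (norm_ne_zero_iff.2 hPne) (norm_ne_zero_iff.2 hQne), ← norm_div] at hmain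
  set x := E.eval w⁻¹ / Q'.eval w⁻¹ with hx
  have hPQ : P.eval w⁻¹ / Q'.eval w⁻¹ = 1 + x := by
    rw [hx, hE, eval_sub, sub_div, div_self hQne]; ring
  rw [hPQ] at hmain
  have hxv : x = (u:ℂ) ^ r * (ω ^ r * (E.reverse.eval w / Q'.reverse.eval w)) := by
    rw [← mul_assoc, ← mul_pow, ← hw, ← hEv, ← hQv, hx]
    have : w ^ n = w ^ r * w ^ E.natDegree := by rw [← pow_add]; congr 1; omega
    rw [this]; field_simp
  have hxre : x.re = u ^ r * (ω ^ r * (E.reverse.eval w / Q'.reverse.eval w)).re := by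
    rw [hxv, ← Complex.ofReal_pow, Complex.re_ofReal_mul]
  have hη : C' * ((‖P.eval w⁻¹‖ ^ 2)⁻¹ + (‖Q'.eval w⁻¹‖ ^ 2)⁻¹) ≤ u ^ (2 * n) * (A + 1) := by
    have e1 : (‖P.eval w⁻¹‖ ^ 2)⁻¹ = u ^ (2 * n) * (‖P.reverse.eval w‖ ^ 2)⁻¹ := by
      rw [← hPv, norm_mul, norm_pow, hwn, mul_pow, ← pow_mul, mul_comm n 2]
      field_simp
    have e2 : (‖Q'.eval w⁻¹‖ ^ 2)⁻¹ = u ^ (2 * n) * (‖Q'.reverse.eval w‖ ^ 2)⁻¹ := by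
      rw [← hQv, norm_mul, norm_pow, hwn, mul_pow, ← pow_mul, mul_comm n 2]
      field_simp
    rw [e1, e2, ← mul_add, mul_left_comm]
    refine mul_le_mul_of_nonneg_left ?_ (by positivity)
    refine le_trans (mul_le_mul_of_nonneg_right (le_abs_self C') (by positivity)) h2.le
  set η := u ^ (2 * n) * (A + 1) with hηd
  have hu2n : u ^ (2 * n) ≤ u ^ (r + 1) := pow_le_pow_of_le_one hu0.le hu3.le (by omega)
  have hη1 : η ≤ 1 := by
    have : u ^ (2 * n) ≤ u := by
      calc u ^ (2 * n) ≤ u ^ 1 := pow_le_pow_of_le_one hu0.le hu3.le (by omega)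
        _ = u := pow_one u
    rw [lt_div_iff₀ (by linarith)] at hu2
    nlinarith
  have hη0 : 0 ≤ η := by positivity
  have hxl : 1 + x.re ≤ Real.exp η := by
    have h6 : 1 + x.re ≤ ‖1 + x‖ := by
      have := Complex.re_le_norm (1 + x); simpa using this
    have h7 : 0 < ‖1 + x‖ := by rw [← hPQ]; exact norm_pos_iff.2 (div_ne_zero hPne hQne)
    refine h6.trans ?_
    rw [← Real.log_le_iff_le_exp h7]
    exact hmain.trans hη
  have hexp : Real.exp η ≤ 1 + 2 * η := by
    have := Real.abs_exp_sub_one_le (x := η) (by rwa [abs_of_nonneg hη0])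
    rw [abs_of_nonneg hη0] at this
    linarith [le_abs_self (Real.exp η - 1)]
  have hfin : u ^ r * (‖a‖ / 2) ≤ 2 * (u ^ (r + 1) * (A + 1)) := by
    have h8 : u ^ r * (‖a‖ / 2) ≤ x.re := by
      rw [hxre]; exact mul_le_mul_of_nonneg_left h1.le (by positivity)
    have h9 : η ≤ u ^ (r + 1) * (A + 1) := mul_le_mul_of_nonneg_right hu2n (by linarith)
    linarith
  rw [pow_succ] at hfin
  have hur : 0 < u ^ r := by positivity
  have h10 : ‖a‖ / 2 ≤ 2 * (u * (A + 1)) := by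
    refine le_of_mul_le_mul_left ?_ hur
    calc _ ≤ _ := hfin
      _ = _ := by ring
  rw [lt_div_iff₀ (by positivity)] at hu4
  nlinarith

end WordsProp


section LocalThm

theorem gam_ex (d e : ℕ) (hd : 2 ≤ d) (he : 2 ≤ e) (a b : ℕ → ℝ) (L : ℝ) (hL : 0 ≤ L)
    (h : ∀ i j, |(e:ℝ) ^ j * a i - (d:ℝ) ^ i * b j| ≤ 2 * ((e:ℝ) ^ j + (d:ℝ) ^ i) * L) :
    ∃ Γ : ℝ, (∀ i, |a i - (d:ℝ) ^ i * Γ| ≤ 2 * L) ∧ (∀ j, |b j - (e:ℝ) ^ j * Γ| ≤ 2 * L) := by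
  have hd0 : ∀ i, 0 < (d:ℝ) ^ i := fun i => pow_pos (by positivity) i
  have he0 : ∀ i, 0 < (e:ℝ) ^ i := fun i => pow_pos (by positivity) i
  have lim0 : ∀ (n : ℕ), 2 ≤ n → ∀ x y c : ℝ, (∀ j : ℕ, x ≤ y + c / (n:ℝ) ^ j) → x ≤ y := by
    intro n hn x y c hx
    have h1 : Filter.Tendsto (fun j : ℕ => y + c / (n:ℝ) ^ j) Filter.atTop (nhds (y + 0)) := by
      refine Filter.Tendsto.const_add _ ?_
      refine Filter.Tendsto.div_atTop tendsto_const_nhds ?_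
      exact tendsto_pow_atTop_atTop_of_one_lt (by exact_mod_cast (by omega : 1 < n))
    rw [add_zero] at h1
    exact ge_of_tendsto' h1 hx
  have hab : ∀ i j, a i / (d:ℝ) ^ i - 2 * L / (d:ℝ) ^ i ≤ b j / (e:ℝ) ^ j + 2 * L / (e:ℝ) ^ j := by
    intro i j
    have h1 := (abs_le.1 (h i j)).2
    rw [← sub_div, ← add_div, div_le_div_iff₀ (hd0 i) (he0 j)]
    nlinarith
  have hba : ∀ i j, b j / (e:ℝ) ^ j - 2 * L / (e:ℝ) ^ j ≤ a i / (d:ℝ) ^ i + 2 * L / (d:ℝ) ^ i := by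
    intro i j
    have h1 := (abs_le.1 (h i j)).1
    rw [← sub_div, ← add_div, div_le_div_iff₀ (he0 j) (hd0 i)]
    nlinarith
  have haa : ∀ i k, a i / (d:ℝ) ^ i - 2 * L / (d:ℝ) ^ i ≤ a k / (d:ℝ) ^ k + 2 * L / (d:ℝ) ^ k := by
    intro i k
    refine lim0 e he _ _ (4 * L) fun j => ?_
    have h1 := hab i j
    have h2 := hba k j
    have h3 : 4 * L / (e:ℝ) ^ j = 2 * L / (e:ℝ) ^ j + 2 * L / (e:ℝ) ^ j := by ring
    linarith
  set Γ := ⨆ i, (a i / (d:ℝ) ^ i - 2 * L / (d:ℝ) ^ i) with hΓ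
  have hbdd : BddAbove (Set.range fun i => (a i / (d:ℝ) ^ i - 2 * L / (d:ℝ) ^ i)) :=
    ⟨_, by rintro _ ⟨i, rfl⟩; exact haa i 0⟩
  have l1 : ∀ i, a i / (d:ℝ) ^ i - 2 * L / (d:ℝ) ^ i ≤ Γ := fun i => le_ciSup hbdd i
  have l2 : ∀ i, Γ ≤ a i / (d:ℝ) ^ i + 2 * L / (d:ℝ) ^ i := fun i => ciSup_le fun k => haa k i
  have l3 : ∀ j, Γ ≤ b j / (e:ℝ) ^ j + 2 * L / (e:ℝ) ^ j := fun j => ciSup_le fun k => hab k j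
  have l4 : ∀ j, b j / (e:ℝ) ^ j - 2 * L / (e:ℝ) ^ j ≤ Γ := by
    intro j
    refine lim0 d hd _ _ (4 * L) fun i => ?_
    have h1 := hba i j
    have h2 := l1 i
    have h3 : 4 * L / (d:ℝ) ^ i = 2 * L / (d:ℝ) ^ i + 2 * L / (d:ℝ) ^ i := by ring
    linarith
  refine ⟨Γ, fun i => ?_, fun j => ?_⟩
  · have h1 := l1 i
    have h2 := l2 i
    rw [← sub_div, div_le_iff₀ (hd0 i)] at h1
    rw [← add_div, le_div_iff₀ (hd0 i)] at h2
    rw [abs_le]; constructor <;> linarith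
  · have h1 := l4 j
    have h2 := l3 j
    rw [← sub_div, div_le_iff₀ (he0 j)] at h1
    rw [← add_div, le_div_iff₀ (he0 j)] at h2
    rw [abs_le]; constructor <;> linarith

theorem gam_mul (n : ℕ) (hn : 2 ≤ n) (a : ℕ → ℝ) (L x y : ℝ) (h1 : ∀ i, |a i - (n:ℝ) ^ i * x| ≤ L)
    (h2 : ∀ i, |a (i + 1) - (n:ℝ) ^ i * y| ≤ L) : y = n * x := by
  by_contra hne
  have hpos : 0 < |y - n * x| := abs_pos.2 (sub_ne_zero.2 hne)
  obtain ⟨i, hi⟩ := pow_unbounded_of_one_lt (2 * L / |y - n * x|) (show (1:ℝ) < n by exact_mod_cast (by omega : 1 < n))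
  rw [div_lt_iff₀ hpos] at hi
  have h3 : (n:ℝ) ^ i * |y - n * x| = |(a (i + 1) - (n:ℝ) ^ (i + 1) * x) - (a (i + 1) - (n:ℝ) ^ i * y)| := by
    rw [← abs_of_pos (show 0 < (n:ℝ) ^ i by positivity), ← abs_mul, abs_of_pos (show 0 < (n:ℝ) ^ i by positivity)]
    congr 1; ring
  have h4 := abs_sub (a (i + 1) - (n:ℝ) ^ (i + 1) * x) (a (i + 1) - (n:ℝ) ^ i * y)
  have := h1 (i + 1)
  have := h2 i
  linarith

theorem centered_log (F : ℂ[X]) (d : ℕ) (hd : 2 ≤ d) (hF : F.Monic) (hFd : F.natDegree = d) (hc : F.coeff (d - 1) = 0) :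
    ∃ C2 S : ℝ, 0 ≤ C2 ∧ 1 ≤ S ∧ ∀ y, S ≤ ‖y‖ → |Real.log ‖F.eval y‖ - d * Real.log ‖y‖| ≤ C2 / ‖y‖ ^ 2 := by
  obtain ⟨k, rfl⟩ : ∃ k, d = k + 2 := ⟨d - 2, by omega⟩
  set E := F - X ^ (k + 2) with hE
  have hEd : E.natDegree ≤ k := by
    rw [natDegree_le_iff_coeff_eq_zero]
    intro N hN
    rw [hE, coeff_sub, coeff_X_pow]
    rcases Nat.lt_trichotomy N (k + 2) with h | h | h
    · have : N = k + 1 := by omega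
      subst this
      simpa using hc
    · subst h
      have := hF.coeff_natDegree
      rw [hFd] at this
      simp [this]
    · rw [coeff_eq_zero_of_natDegree_lt (by omega), if_neg (by omega), sub_zero]
  obtain ⟨B, hB⟩ : ∃ B : ℝ, ∀ j, ‖E.coeff j‖ ≤ B := by
    refine ⟨∑ j ∈ Finset.range (k + 1), ‖E.coeff j‖, fun j => ?_⟩
    by_cases hj : j < k + 1
    · exact Finset.single_le_sum (f := fun j => ‖E.coeff j‖) (fun _ _ => norm_nonneg _) (Finset.mem_range.2 hj)
    · rw [coeff_eq_zero_of_natDegree_lt (by omega), norm_zero]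
      exact Finset.sum_nonneg fun _ _ => norm_nonneg _
  have hB0 : 0 ≤ B := (norm_nonneg _).trans (hB 0)
  set A : ℝ := (k + 1) * B with hA
  have hA0 : 0 ≤ A := by positivity
  refine ⟨3 / 2 * A, 1 + 2 * A, by positivity, by linarith, fun y hy => ?_⟩
  have hy1 : 1 ≤ ‖y‖ := by linarith
  have hyp : 0 < ‖y‖ := by linarith
  have hy0 : y ≠ 0 := norm_pos_iff.1 hyp
  have hEy := eval_norm_le E k hEd B hB y ‖y‖ hy1 le_rfl
  rw [← hA] at hEy
  set x := E.eval y / y ^ (k + 2) with hx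
  have hFy : F.eval y = y ^ (k + 2) * (1 + x) := by
    have : F.eval y = E.eval y + y ^ (k + 2) := by rw [hE]; simp
    rw [this, hx]; field_simp; ring
  have hxn : ‖x‖ ≤ A / ‖y‖ ^ 2 := by
    rw [hx, norm_div, norm_pow, div_le_div_iff₀ (by positivity) (by positivity)]
    calc ‖E.eval y‖ * ‖y‖ ^ 2 ≤ A * ‖y‖ ^ k * ‖y‖ ^ 2 := by gcongr
      _ = _ := by ring
  have hx2 : ‖x‖ ≤ 1 / 2 := by
    refine hxn.trans ?_
    rw [div_le_div_iff₀ (by positivity) (by norm_num)]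
    nlinarith
  have h1x : 1 + x ≠ 0 := by
    intro h0
    have : x = -1 := by linear_combination h0
    rw [this] at hx2; norm_num at hx2
  rw [hFy, norm_mul, norm_pow, Real.log_mul (by positivity) (norm_ne_zero_iff.2 h1x), Real.log_pow]
  rw [add_sub_cancel_left, ← Complex.log_re]
  refine (Complex.abs_re_le_norm _).trans ((Complex.norm_log_one_add_half_le_self hx2).trans ?_)
  calc 3 / 2 * ‖x‖ ≤ 3 / 2 * (A / ‖y‖ ^ 2) := by gcongr
    _ = _ := by ring

/-- the letter polynomial -/
def ltr (F G : ℂ[X]) (b : Bool) : ℂ[X] := if b then F else G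

/-- the pigeonhole words -/
def pw (b : Bool) (D k : ℕ) : List Bool := List.replicate k b ++ (!b) :: List.replicate (D - k) b

theorem wdp_cons (F G : ℂ[X]) (b : Bool) (w : List Bool) : wdp F G (b :: w) = (ltr F G b).comp (wdp F G w) := rfl

theorem wdp_append (F G : ℂ[X]) (w w' : List Bool) : wdp F G (w ++ w') = (wdp F G w).comp (wdp F G w') := by
  induction w with
  | nil => simp [wdp]
  | cons b w ih => rw [List.cons_append, wdp_cons, wdp_cons, ih, comp_assoc]

theorem wdp_natDegree (F G : ℂ[X]) (w : List Bool) :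
    (wdp F G w).natDegree = (w.map fun b => (ltr F G b).natDegree).prod := by
  induction w with
  | nil => simp [wdp]
  | cons b w ih => rw [wdp_cons, natDegree_comp, ih]; simp

theorem pw_natDegree (F G : ℂ[X]) (b : Bool) (D k : ℕ) (hk : k ≤ D) :
    (wdp F G (pw b D k)).natDegree = (ltr F G b).natDegree ^ D * (ltr F G (!b)).natDegree := by
  rw [wdp_natDegree, pw]
  simp only [List.map_append, List.map_cons, List.map_replicate, List.prod_append, List.prod_cons, List.prod_replicate]
  have : (ltr F G b).natDegree ^ D = (ltr F G b).natDegree ^ k * (ltr F G b).natDegree ^ (D - k) := by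
    rw [← pow_add]; congr 1; omega
  rw [this]; ring

theorem words_prop (F G : ℂ[X]) (d e : ℕ) (hd : 2 ≤ d) (he : 2 ≤ e) (hFd : F.natDegree = d) (hGd : G.natDegree = e)
    (hF : F.Monic) (hGl : ‖G.leadingCoeff‖ = 1) (hc : F.coeff (d - 1) = 0) (R : ℝ) (hR : 1 ≤ R)
    (hesc : ∀ y, R ≤ ‖y‖ → ‖y‖ ≤ ‖F.eval y‖ ∧ ‖y‖ ≤ ‖G.eval y‖)
    (K : Set ℂ) (hK : IsCompact K)
    (hKR : ∀ z ∈ K, ∀ i, ‖(fun x => F.eval x)^[i] z‖ ≤ R ∧ ‖(fun x => G.eval x)^[i] z‖ ≤ R)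
    (hmon : ∀ p : ℂ[X], p.Monic → 1 ≤ p.natDegree → ∃ z ∈ K, 1 ≤ ‖p.eval z‖)
    (w w' : List Bool) (hww : (wdp F G w).natDegree = (wdp F G w').natDegree) :
    ∃ ζ : ℂ, wdp F G w = C ζ * wdp F G w' := by
  have hFl : ‖F.leadingCoeff‖ = 1 := by rw [hF.leadingCoeff, norm_one]
  have escF : ∀ y, R ≤ ‖y‖ → ∀ i, ‖y‖ ≤ ‖(fun x => F.eval x)^[i] y‖ := by
    intro y hy i
    induction i with
    | zero => simp
    | succ i ih => rw [Function.iterate_succ_apply']; exact ih.trans (hesc _ (hy.trans ih)).1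
  have escG : ∀ y, R ≤ ‖y‖ → ∀ i, ‖y‖ ≤ ‖(fun x => G.eval x)^[i] y‖ := by
    intro y hy i
    induction i with
    | zero => simp
    | succ i ih => rw [Function.iterate_succ_apply']; exact ih.trans (hesc _ (hy.trans ih)).2
  have hL : 0 ≤ Real.log R := Real.log_nonneg hR
  have hgc := green_cmp F G d e (by omega) (by omega) hFd hGd hFl hGl K hK R hR hKR
    (fun y hy i => norm_pos_iff.1 (by linarith [escF y hy.le i])) (fun y hy i => norm_pos_iff.1 (by linarith [escG y hy.le i])) hmon
  have hG0 : ∀ y : ℂ, ∃ Γ : ℝ, 4 * R ≤ ‖y‖ → (∀ i, |Real.log ‖(fun x => F.eval x)^[i] y‖ - (d:ℝ) ^ i * Γ| ≤ 2 * Real.log R) ∧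
      (∀ i, |Real.log ‖(fun x => G.eval x)^[i] y‖ - (e:ℝ) ^ i * Γ| ≤ 2 * Real.log R) := by
    intro y
    by_cases hy : 4 * R ≤ ‖y‖
    · obtain ⟨Γ, h1⟩ := gam_ex d e hd he (fun i => Real.log ‖(fun x => F.eval x)^[i] y‖)
        (fun i => Real.log ‖(fun x => G.eval x)^[i] y‖) (Real.log R) hL (fun i j => hgc i j y hy)
      exact ⟨Γ, fun _ => h1⟩
    · exact ⟨0, fun h => absurd h hy⟩
  choose Γ hΓ using hG0
  have ΓF : ∀ y, 4 * R ≤ ‖y‖ → Γ (F.eval y) = d * Γ y := by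
    intro y hy
    have hy' : 4 * R ≤ ‖F.eval y‖ := hy.trans (hesc y (by linarith)).1
    refine gam_mul d hd (fun i => Real.log ‖(fun x => F.eval x)^[i] y‖) _ _ _ (hΓ y hy).1 fun i => ?_
    exact (hΓ _ hy').1 i
  have ΓG : ∀ y, 4 * R ≤ ‖y‖ → Γ (G.eval y) = e * Γ y := by
    intro y hy
    have hy' : 4 * R ≤ ‖G.eval y‖ := hy.trans (hesc y (by linarith)).2
    refine gam_mul e he (fun i => Real.log ‖(fun x => G.eval x)^[i] y‖) _ _ _ (hΓ y hy).2 fun i => ?_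
    exact (hΓ _ hy').2 i
  obtain ⟨C2, S, hC2, hS, hlog⟩ := centered_log F d hd hF hFd hc
  have hΓlog : ∀ y, max (4 * R) S ≤ ‖y‖ → |Γ y - Real.log ‖y‖| ≤ C2 / ‖y‖ ^ 2 := by
    have step : ∀ n : ℕ, ∀ y, max (4 * R) S ≤ ‖y‖ → |Γ y - Real.log ‖y‖| ≤ 2 * Real.log R / (d:ℝ) ^ n + C2 / ‖y‖ ^ 2 := by
      intro n
      have hd2 : (2:ℝ) ≤ d := by exact_mod_cast hd
      induction n with
      | zero =>
        intro y hy
        have h1 := (hΓ y (le_trans (le_max_left _ _) hy)).1 0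
        simp only [Function.iterate_zero, id_eq, pow_zero, one_mul] at h1
        rw [abs_sub_comm] at h1
        have : 0 ≤ C2 / ‖y‖ ^ 2 := by positivity
        simp only [pow_zero, div_one]
        linarith
      | succ n ih =>
        intro y hy
        have hyR : 4 * R ≤ ‖y‖ := le_trans (le_max_left _ _) hy
        have hesc1 := (hesc y (by linarith)).1
        have h1 := ih (F.eval y) (hy.trans hesc1)
        have h2 := hlog y (le_trans (le_max_right _ _) hy)
        rw [ΓF y hyR] at h1
        have hy0 : 0 < ‖y‖ := by linarith
        have h3 : C2 / ‖F.eval y‖ ^ 2 ≤ C2 / ‖y‖ ^ 2 := by gcongr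
        have h4 : (d:ℝ) * |Γ y - Real.log ‖y‖| ≤ 2 * Real.log R / (d:ℝ) ^ n + 2 * (C2 / ‖y‖ ^ 2) := by
          have : (d:ℝ) * |Γ y - Real.log ‖y‖| = |(d * Γ y - Real.log ‖F.eval y‖) + (Real.log ‖F.eval y‖ - d * Real.log ‖y‖)| := by
            rw [← abs_of_nonneg (show (0:ℝ) ≤ d by linarith), ← abs_mul, abs_of_nonneg (show (0:ℝ) ≤ d by linarith)]
            congr 1; ring
          rw [this]
          refine (abs_add_le _ _).trans ?_
          linarith
        have h5 : 2 * Real.log R / (d:ℝ) ^ (n + 1) = (2 * Real.log R / (d:ℝ) ^ n) / d := by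
          rw [pow_succ, div_div]
        rw [h5]
        have h6 : (2 * Real.log R / (d:ℝ) ^ n) = d * ((2 * Real.log R / (d:ℝ) ^ n) / d) := by
          field_simp
        have h7 : 0 ≤ C2 / ‖y‖ ^ 2 := by positivity
        rw [h6] at h4
        refine le_of_mul_le_mul_left ?_ (show (0:ℝ) < d by linarith)
        nlinarith
    intro y hy
    have h1 : Filter.Tendsto (fun n : ℕ => 2 * Real.log R / (d:ℝ) ^ n + C2 / ‖y‖ ^ 2) Filter.atTop (nhds (0 + C2 / ‖y‖ ^ 2)) := by
      refine Filter.Tendsto.add_const _ ?_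
      refine Filter.Tendsto.div_atTop tendsto_const_nhds ?_
      exact tendsto_pow_atTop_atTop_of_one_lt (by exact_mod_cast (by omega : 1 < d))
    rw [zero_add] at h1
    exact ge_of_tendsto' h1 fun n => step n y hy
  have wesc : ∀ w y, max (4 * R) S ≤ ‖y‖ → ‖y‖ ≤ ‖(wdp F G w).eval y‖ ∧ Γ ((wdp F G w).eval y) = (wdp F G w).natDegree * Γ y := by
    intro w y hy
    induction w with
    | nil => simp [wdp]
    | cons b w ih =>
      obtain ⟨h1, h2⟩ := ih
      have h3 : 4 * R ≤ ‖(wdp F G w).eval y‖ := le_trans (le_max_left _ _) (hy.trans h1)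
      have h4 := hesc _ (show R ≤ ‖(wdp F G w).eval y‖ by linarith)
      rw [wdp_cons, natDegree_comp, eval_comp]
      cases b
      · simp only [ltr, Bool.false_eq_true, if_false]
        refine ⟨h1.trans h4.2, ?_⟩
        rw [ΓG _ h3, h2, hGd]; push_cast; ring
      · simp only [ltr, if_true]
        refine ⟨h1.trans h4.1, ?_⟩
        rw [ΓF _ h3, h2, hFd]; push_cast; ring
  have wdeg : ∀ w, 1 ≤ (wdp F G w).natDegree ∧ ‖(wdp F G w).leadingCoeff‖ = 1 := by
    intro w
    induction w with
    | nil => simp [wdp]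
    | cons b w ih =>
      rw [wdp_cons, natDegree_comp, leadingCoeff_comp (by omega), norm_mul, norm_pow, ih.2, one_pow, mul_one]
      cases b
      · simp only [ltr, Bool.false_eq_true, if_false]
        exact ⟨Nat.mul_pos (by omega) ih.1, hGl⟩
      · simp only [ltr, if_true]
        exact ⟨Nat.mul_pos (by omega) ih.1, hFl⟩
  refine poly_prop _ _ (wdp F G w).natDegree (wdeg w).1 rfl hww.symm ((wdeg w).2.trans (wdeg w').2.symm) C2 (max (4 * R) S) ?_
  intro y hy
  obtain ⟨a1, a2⟩ := wesc w y hy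
  obtain ⟨b1, b2⟩ := wesc w' y hy
  have c1 := hΓlog _ (hy.trans a1)
  have c2 := hΓlog _ (hy.trans b1)
  rw [a2] at c1
  rw [b2, ← hww] at c2
  have := abs_le.1 c1
  have := abs_le.1 c2
  rw [mul_add, ← div_eq_mul_inv, ← div_eq_mul_inv]
  linarith

theorem local_p (F G : ℂ[X]) (d e : ℕ) (hd : 2 ≤ d) (he : 2 ≤ e) (hFd : F.natDegree = d) (hGd : G.natDegree = e)
    (hF : F.Monic) (hGl : ‖G.leadingCoeff‖ = 1) (hc : F.coeff (d - 1) = 0) (R : ℝ) (hR : 1 ≤ R)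
    (hesc : ∀ y, R ≤ ‖y‖ → ‖y‖ ≤ ‖F.eval y‖ ∧ ‖y‖ ≤ ‖G.eval y‖)
    (K : Set ℂ) (hK : IsCompact K)
    (hKR : ∀ z ∈ K, ∀ i, ‖(fun x => F.eval x)^[i] z‖ ≤ R ∧ ‖(fun x => G.eval x)^[i] z‖ ≤ R)
    (b : Bool) (i D : ℕ) (hD : D = (ltr F G b).natDegree) (hi : i < D) (hcoef : (ltr F G b).coeff i ≠ 0)
    (hdist : ∀ k l, k < l → l ≤ D → wdp F G (pw b D k) ≠ wdp F G (pw b D l)) :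
    ∃ p : ℂ[X], p.Monic ∧ 1 ≤ p.natDegree ∧ ∀ z ∈ K, ‖p.eval z‖ < 1 := by
  by_contra hcon
  have hmon : ∀ p : ℂ[X], p.Monic → 1 ≤ p.natDegree → ∃ z ∈ K, 1 ≤ ‖p.eval z‖ := by
    intro p h1 h2
    by_contra h3
    push Not at h3
    exact hcon ⟨p, h1, h2, h3⟩
  have wp := words_prop F G d e hd he hFd hGd hF hGl hc R hR hesc K hK hKR hmon
  have hdeg : ∀ k ≤ D, (wdp F G (pw b D k)).natDegree = (wdp F G (pw b D 0)).natDegree := by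
    intro k hk
    rw [pw_natDegree _ _ _ _ _ hk, pw_natDegree _ _ _ _ _ (Nat.zero_le _)]
  have hltr : ∀ b, 2 ≤ (ltr F G b).natDegree := by
    intro b; cases b
    · simp only [ltr, Bool.false_eq_true, if_false]; omega
    · simp only [ltr, if_true]; omega
  have hdeg0 : 0 < (wdp F G (pw b D 0)).natDegree := by
    rw [pw_natDegree _ _ _ _ _ (Nat.zero_le _)]
    have := hltr b
    have := hltr (!b)
    positivity
  have hz : ∀ k : Fin (D + 1), ∃ ζ : ℂ, wdp F G (pw b D k) = C ζ * wdp F G (pw b D 0) := fun k =>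
    wp _ _ (hdeg k (by omega))
  choose ζ hζ using hz
  have hroot : ∀ k, ζ k ∈ nthRootsFinset (D - i) (1:ℂ) := by
    intro k
    rw [mem_nthRootsFinset (by omega)]
    have hk0 : ζ k ≠ 0 := by
      intro h0
      have h1 := hζ k
      rw [h0, C_0, zero_mul] at h1
      have h2 := hdeg k (by omega)
      rw [h1] at h2
      simp at h2; omega
    obtain ⟨ξ, hξ⟩ := wp (b :: pw b D k) (b :: pw b D 0) (by
      rw [wdp_cons, wdp_cons, natDegree_comp, natDegree_comp, hdeg k (by omega)])
    rw [wdp_cons, wdp_cons, hζ k] at hξ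
    have hfun : (ltr F G b).comp (C (ζ k) * X) = C ξ * ltr F G b := by
      refine Polynomial.funext fun x => ?_
      obtain ⟨y, hy⟩ := IsAlgClosed.exists_root (wdp F G (pw b D 0) - C x) (by
        rw [degree_eq_natDegree (by
          intro h0
          have : (wdp F G (pw b D 0) - C x).natDegree = 0 := by rw [h0]; simp
          rw [natDegree_sub_C] at this; omega), natDegree_sub_C]
        exact_mod_cast hdeg0.ne')
      have hy' : (wdp F G (pw b D 0)).eval y = x := by
        have : (wdp F G (pw b D 0) - C x).eval y = 0 := hy
        rw [eval_sub, eval_C] at this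
        exact sub_eq_zero.1 this
      have h3 := congrArg (eval y) hξ
      simp only [eval_comp, eval_mul, eval_C, hy'] at h3
      simp only [eval_comp, eval_mul, eval_C, eval_X]
      exact h3
    have hco : ∀ j, (ltr F G b).coeff j * ζ k ^ j = ξ * (ltr F G b).coeff j := by
      intro j
      have := congrArg (fun q => coeff q j) hfun
      simpa [comp_C_mul_X_coeff] using this
    have hlead : (ltr F G b).coeff D ≠ 0 := by
      rw [hD]
      have : ltr F G b ≠ 0 := by
        intro h0
        have := hltr b
        rw [h0] at this; simp at this
      exact leadingCoeff_ne_zero.2 this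
    have e1 : ζ k ^ i = ξ := by
      have := hco i
      rw [mul_comm] at this
      exact mul_right_cancel₀ hcoef this
    have e2 : ζ k ^ D = ξ := by
      have := hco D
      rw [mul_comm] at this
      exact mul_right_cancel₀ hlead this
    have e3 : ζ k ^ D = ζ k ^ (D - i) * ζ k ^ i := by rw [← pow_add]; congr 1; omega
    rw [e2, e1] at e3
    have hξ0 : ξ ≠ 0 := by rw [← e1]; exact pow_ne_zero _ hk0
    have : 1 * ξ = ζ k ^ (D - i) * ξ := by rw [one_mul]; exact e3
    exact (mul_right_cancel₀ hξ0 this).symm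
  obtain ⟨k, -, l, -, hkl, heq⟩ := Finset.exists_ne_map_eq_of_card_lt_of_maps_to (s := (Finset.univ : Finset (Fin (D + 1))))
    (t := nthRootsFinset (D - i) (1:ℂ)) (f := ζ) (by
      have h1 : (nthRootsFinset (D - i) (1:ℂ)).card ≤ D - i := by
        classical
        rw [nthRootsFinset_def]
        exact (Multiset.toFinset_card_le _).trans (card_nthRoots _ _)
      rw [Finset.card_univ, Fintype.card_fin]; omega) (fun k _ => hroot k)
  have hPeq : wdp F G (pw b D k) = wdp F G (pw b D l) := by rw [hζ k, hζ l, heq]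
  rcases lt_or_gt_of_ne hkl with h | h
  · exact hdist k l h (by omega) hPeq
  · exact hdist l k h (by omega) hPeq.symm

end LocalThm


section Uniform

/-- parameter space of normalized pairs -/
abbrev UU (d e : ℕ) : Type := (Fin d → ℂ) × ℂ × (Fin e → ℂ)

noncomputable def uF {d e : ℕ} (u : UU d e) : ℂ[X] := X ^ d + ∑ i : Fin d, C (u.1 i) * X ^ (i : ℕ)
noncomputable def uG {d e : ℕ} (u : UU d e) : ℂ[X] := C (u.2.1 ^ (e - 1)) * X ^ e + ∑ i : Fin e, C (u.2.2 i) * X ^ (i : ℕ)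

variable {d e : ℕ}

theorem uF_monic (u : UU d e) : (uF u).Monic := monic_X_pow_add (degree_sum_fin_lt _)
theorem uF_natDegree (u : UU d e) : (uF u).natDegree = d := by
  rw [uF, natDegree_add_eq_left_of_degree_lt (by rw [degree_X_pow]; exact degree_sum_fin_lt _), natDegree_X_pow]

theorem uG_deg_aux (u : UU d e) (hβ : u.2.1 ≠ 0) :
    (∑ i : Fin e, C (u.2.2 i) * X ^ (i : ℕ)).degree < (C (u.2.1 ^ (e - 1)) * X ^ e : ℂ[X]).degree := by
  rw [degree_C_mul_X_pow _ (pow_ne_zero _ hβ)]; exact degree_sum_fin_lt _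

theorem uG_natDegree (u : UU d e) (hβ : u.2.1 ≠ 0) : (uG u).natDegree = e := by
  rw [uG, natDegree_add_eq_left_of_degree_lt (uG_deg_aux u hβ), natDegree_C_mul_X_pow _ _ (pow_ne_zero _ hβ)]

theorem uG_lead (u : UU d e) (hβ : u.2.1 ≠ 0) : (uG u).leadingCoeff = u.2.1 ^ (e - 1) := by
  rw [uG, leadingCoeff_add_of_degree_lt' (uG_deg_aux u hβ), leadingCoeff_mul, leadingCoeff_C, leadingCoeff_X_pow, mul_one]

theorem sum_fin_coeff {n : ℕ} (a : Fin n → ℂ) (j : ℕ) :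
    (∑ i : Fin n, C (a i) * X ^ (i : ℕ)).coeff j = if h : j < n then a ⟨j, h⟩ else 0 := by
  rw [finset_sum_coeff]
  simp only [coeff_C_mul, coeff_X_pow]
  split_ifs with h
  · rw [Finset.sum_eq_single (⟨j, h⟩ : Fin n)]
    · simp
    · intro b _ hb
      rw [if_neg, mul_zero]
      intro h1; exact hb (Fin.ext h1.symm)
    · simp
  · refine Finset.sum_eq_zero fun i _ => ?_
    rw [if_neg (by omega), mul_zero]

theorem uF_coeff (u : UU d e) (j : ℕ) (h : j < d) : (uF u).coeff j = u.1 ⟨j, h⟩ := by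
  rw [uF, coeff_add, sum_fin_coeff, dif_pos h, coeff_X_pow, if_neg (by omega), zero_add]

theorem uG_coeff (u : UU d e) (j : ℕ) (h : j < e) : (uG u).coeff j = u.2.2 ⟨j, h⟩ := by
  rw [uG, coeff_add, sum_fin_coeff, dif_pos h, coeff_C_mul, coeff_X_pow, if_neg (by omega), mul_zero, zero_add]

theorem uF_bd (u : UU d e) (B : ℝ) (hB : 1 ≤ B) (h : ∀ i, ‖u.1 i‖ ≤ B) (j : ℕ) : ‖(uF u).coeff j‖ ≤ B := by
  rcases lt_trichotomy j d with h1 | h1 | h1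
  · rw [uF_coeff u j h1]; exact h _
  · have := (uF_monic u).coeff_natDegree
    rw [uF_natDegree] at this
    rw [h1, this, norm_one]; exact hB
  · rw [coeff_eq_zero_of_natDegree_lt (by rwa [uF_natDegree]), norm_zero]; linarith

theorem uG_bd (u : UU d e) (hβ : u.2.1 ≠ 0) (B : ℝ) (hB : 1 ≤ B) (h : ∀ i, ‖u.2.2 i‖ ≤ B) (hl : ‖u.2.1 ^ (e - 1)‖ ≤ B) (j : ℕ) :
    ‖(uG u).coeff j‖ ≤ B := by
  rcases lt_trichotomy j e with h1 | h1 | h1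
  · rw [uG_coeff u j h1]; exact h _
  · have := uG_lead u hβ
    rw [leadingCoeff, uG_natDegree u hβ] at this
    rw [h1, this]; exact hl
  · rw [coeff_eq_zero_of_natDegree_lt (by rwa [uG_natDegree u hβ]), norm_zero]; linarith

theorem uF_cont : Continuous fun x : UU d e × ℂ => (uF x.1).eval x.2 := by
  simp only [uF, eval_add, eval_finset_sum, eval_mul, eval_C, eval_pow, eval_X]
  fun_prop

theorem uG_cont : Continuous fun x : UU d e × ℂ => (uG x.1).eval x.2 := by
  simp only [uG, eval_add, eval_finset_sum, eval_mul, eval_C, eval_pow, eval_X]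
  fun_prop

theorem uF_iter_cont (i : ℕ) : Continuous fun x : UU d e × ℂ => (fun z => (uF x.1).eval z)^[i] x.2 := by
  induction i with
  | zero => simpa using continuous_snd
  | succ i ih =>
    simp only [Function.iterate_succ_apply']
    exact uF_cont.comp (continuous_fst.prodMk ih)

theorem uG_iter_cont (i : ℕ) : Continuous fun x : UU d e × ℂ => (fun z => (uG x.1).eval z)^[i] x.2 := by
  induction i with
  | zero => simpa using continuous_snd
  | succ i ih =>
    simp only [Function.iterate_succ_apply']
    exact uG_cont.comp (continuous_fst.prodMk ih)

theorem uW_cont (w : List Bool) (x : ℂ) : Continuous fun u : UU d e => (wdp (uF u) (uG u) w).eval x := by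
  induction w with
  | nil => simpa [wdp] using continuous_const
  | cons b w ih =>
    simp only [wdp_cons, eval_comp]
    cases b
    · simp only [ltr, Bool.false_eq_true, if_false]
      exact uG_cont.comp (continuous_id.prodMk ih)
    · simp only [ltr, if_true]
      exact uF_cont.comp (continuous_id.prodMk ih)

theorem uL_coeff_cont (b : Bool) (i : ℕ) : Continuous fun u : UU d e => (ltr (uF u) (uG u) b).coeff i := by
  cases b
  · simp only [ltr, Bool.false_eq_true, if_false, uG, coeff_add, finset_sum_coeff, coeff_C_mul]
    fun_prop
  · simp only [ltr, if_true, uF, coeff_add, finset_sum_coeff, coeff_C_mul]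
    fun_prop

/-- the compact set of admissible parameters -/
structure Adm (B : ℝ) (b : Bool) (i D : ℕ) (x : ℕ → ℕ → ℂ) (u : UU d e) : Prop where
  hF : ∀ j, ‖u.1 j‖ ≤ B
  hβ : ‖u.2.1‖ ≤ B
  hβ' : 1 ≤ B * ‖u.2.1‖
  hG : ∀ j, ‖u.2.2 j‖ ≤ B
  hc : (uF u).coeff (d - 1) = 0
  hco : 1 ≤ B * ‖(ltr (uF u) (uG u) b).coeff i‖
  hw : ∀ k l, k < l → l ≤ D → 1 ≤ B * ‖(wdp (uF u) (uG u) (pw b D k)).eval (x k l) - (wdp (uF u) (uG u) (pw b D l)).eval (x k l)‖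

theorem Adm.compact (B : ℝ) (hB : 1 ≤ B) (b : Bool) (i D : ℕ) (x : ℕ → ℕ → ℂ) : IsCompact {u : UU d e | Adm B b i D x u} := by
  refine Metric.isCompact_of_isClosed_isBounded ?_ ?_
  · have : {u : UU d e | Adm B b i D x u} = {u | ∀ j, ‖u.1 j‖ ≤ B} ∩ {u | ‖u.2.1‖ ≤ B} ∩ {u | 1 ≤ B * ‖u.2.1‖} ∩ {u | ∀ j, ‖u.2.2 j‖ ≤ B} ∩
      {u | (uF u).coeff (d - 1) = 0} ∩ {u | 1 ≤ B * ‖(ltr (uF u) (uG u) b).coeff i‖} ∩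
      {u | ∀ k l, k < l → l ≤ D → 1 ≤ B * ‖(wdp (uF u) (uG u) (pw b D k)).eval (x k l) - (wdp (uF u) (uG u) (pw b D l)).eval (x k l)‖} := by
      ext u; constructor
      · rintro ⟨h1, h2, h3, h4, h5, h6, h7⟩; exact ⟨⟨⟨⟨⟨⟨h1, h2⟩, h3⟩, h4⟩, h5⟩, h6⟩, h7⟩
      · rintro ⟨⟨⟨⟨⟨⟨h1, h2⟩, h3⟩, h4⟩, h5⟩, h6⟩, h7⟩; exact ⟨h1, h2, h3, h4, h5, h6, h7⟩
    rw [this]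
    refine ((((((?_ : IsClosed _).inter ?_).inter ?_).inter ?_).inter ?_).inter ?_).inter ?_
    · simp only [Set.setOf_forall]
      exact isClosed_iInter fun j => isClosed_le (by fun_prop) continuous_const
    · exact isClosed_le (by fun_prop) continuous_const
    · exact isClosed_le continuous_const (by fun_prop)
    · simp only [Set.setOf_forall]
      exact isClosed_iInter fun j => isClosed_le (by fun_prop) continuous_const
    · exact isClosed_eq (uL_coeff_cont (d := d) (e := e) true (d - 1)) continuous_const
    · exact isClosed_le continuous_const (continuous_const.mul (uL_coeff_cont b i).norm)
    · simp only [Set.setOf_forall]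
      refine isClosed_iInter fun k => isClosed_iInter fun l => isClosed_iInter fun _ => isClosed_iInter fun _ => ?_
      exact isClosed_le continuous_const (continuous_const.mul ((uW_cont _ _).sub (uW_cont _ _)).norm)
  · refine (Metric.isBounded_iff_subset_closedBall 0).2 ⟨B, ?_⟩
    intro u hu
    rw [mem_closedBall_zero_iff]
    have hB0 : 0 ≤ B := by linarith
    rw [Prod.norm_def, Prod.norm_def]
    exact max_le ((pi_norm_le_iff_of_nonneg hB0).2 hu.hF) (max_le hu.hβ ((pi_norm_le_iff_of_nonneg hB0).2 hu.hG))

theorem Adm.bne {B : ℝ} {b : Bool} {i D : ℕ} {x : ℕ → ℕ → ℂ} {u : UU d e} (h : Adm B b i D x u) : u.2.1 ≠ 0 := by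
  intro h0
  have := h.hβ'
  rw [h0] at this; simp at this; linarith

theorem Adm.esc {B : ℝ} (hB : 1 ≤ B) (hd : 2 ≤ d) (he : 2 ≤ e) {b : Bool} {i D : ℕ} {x : ℕ → ℕ → ℂ} :
    ∃ R0 : ℝ, ∀ u : UU d e, Adm B b i D x u → ∀ y, R0 ≤ ‖y‖ → ‖y‖ ≤ ‖(uF u).eval y‖ ∧ ‖y‖ ≤ ‖(uG u).eval y‖ := by
  set B' := B ^ e with hB'
  have hB1 : 1 ≤ B' := one_le_pow₀ hB
  have hBB : B ≤ B' := le_self_pow₀ hB (by omega)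
  have hBB' : B ^ (e - 1) ≤ B' := pow_le_pow_right₀ hB (by omega)
  refine ⟨max (max (2 * d * B' ^ 2) (2 * e * B' ^ 2)) (2 * B'), fun u hu y hy => ?_⟩
  have cF : CBd (uF u) d B' := ⟨uF_natDegree u, uF_bd u B' hB1 fun i => (hu.hF i).trans hBB, by
    have := (uF_monic u).coeff_natDegree
    rw [uF_natDegree] at this
    rw [this, norm_one]; exact inv_le_one_of_one_le₀ hB1⟩
  have cG : CBd (uG u) e B' := ⟨uG_natDegree u hu.bne, uG_bd u hu.bne B' hB1 (fun i => (hu.hG i).trans hBB) (by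
      rw [norm_pow]; exact (pow_le_pow_left₀ (norm_nonneg _) hu.hβ _).trans hBB'), by
    have := uG_lead u hu.bne
    rw [leadingCoeff, uG_natDegree u hu.bne] at this
    rw [this, norm_pow]
    have h1 : B⁻¹ ≤ ‖u.2.1‖ := by
      rw [inv_le_iff_one_le_mul₀ (by linarith), mul_comm]; exact hu.hβ'
    calc B'⁻¹ ≤ (B ^ (e - 1))⁻¹ := inv_anti₀ (by positivity) hBB'
      _ = B⁻¹ ^ (e - 1) := (inv_pow _ _).symm
      _ ≤ _ := pow_le_pow_left₀ (by positivity) h1 _⟩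
  have hy1 : 2 * d * B' ^ 2 ≤ ‖y‖ := le_trans ((le_max_left _ _).trans (le_max_left _ _)) hy
  have hy2 : 2 * e * B' ^ 2 ≤ ‖y‖ := le_trans ((le_max_right _ _).trans (le_max_left _ _)) hy
  have hy3 : 2 * B' ≤ ‖y‖ := le_trans (le_max_right _ _) hy
  have h0 : ‖y‖ ≤ ‖y‖ ^ 2 / (2 * B') := by
    rw [le_div_iff₀ (by linarith)]; nlinarith
  exact ⟨h0.trans (arch_growth _ d B' hB1 hd cF y hy1), h0.trans (arch_growth _ e B' hB1 he cG y hy2)⟩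

/-- orbits bounded up to time m -/
def BdUp (u : UU d e) (R : ℝ) (m : ℕ) (z : ℂ) : Prop :=
  ∀ i ≤ m, ‖(fun x => (uF u).eval x)^[i] z‖ ≤ R ∧ ‖(fun x => (uG u).eval x)^[i] z‖ ≤ R

theorem BdUp.mono {u : UU d e} {R : ℝ} {m m' : ℕ} {z : ℂ} (h : BdUp u R m z) (hm : m' ≤ m) : BdUp u R m' z :=
  fun i hi => h i (hi.trans hm)

theorem near_bd (u : UU d e) (R : ℝ) (p : ℂ[X]) (τ : ℝ)
    (hp : ∀ z, (∀ m, BdUp u R m z) → ‖p.eval z‖ < τ) :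
    ∃ m : ℕ, ∀ᶠ u' in nhds u, ∀ z, BdUp u' R m z → ‖p.eval z‖ ≤ τ := by
  have hc : IsCompact (Metric.closedBall (0:ℂ) R) := isCompact_closedBall _ _
  have key : ∃ m : ℕ, ∀ᶠ u' in nhds u, ∀ z ∈ Metric.closedBall (0:ℂ) R, BdUp u' R m z → ‖p.eval z‖ ≤ τ := by
    refine hc.induction_on (p := fun s => ∃ m : ℕ, ∀ᶠ u' in nhds u, ∀ z ∈ s, BdUp u' R m z → ‖p.eval z‖ ≤ τ) ?_ ?_ ?_ ?_
    · exact ⟨0, by simp⟩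
    · rintro s t hst ⟨m, hm⟩
      exact ⟨m, hm.mono fun u' h z hz => h z (hst hz)⟩
    · rintro s t ⟨m, hm⟩ ⟨m', hm'⟩
      refine ⟨max m m', (hm.and hm').mono ?_⟩
      rintro u' ⟨h1, h2⟩ z (hz | hz) hb
      · exact h1 z hz (hb.mono (le_max_left _ _))
      · exact h2 z hz (hb.mono (le_max_right _ _))
    · intro z hz
      suffices h : ∃ m, ∀ᶠ x : UU d e × ℂ in nhds (u, z), BdUp x.1 R m x.2 → ‖p.eval x.2‖ ≤ τ by
        obtain ⟨m, hm⟩ := h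
        rw [nhds_prod_eq, Filter.eventually_prod_iff] at hm
        obtain ⟨pa, ha, pb, hb, hab⟩ := hm
        refine ⟨{z | pb z}, mem_nhdsWithin_of_mem_nhds hb, m, ha.mono fun u' hu' z' hz' => hab hu' hz'⟩
      by_cases hK : ∀ m, BdUp u R m z
      · refine ⟨0, ?_⟩
        have h1 : Continuous fun x : UU d e × ℂ => ‖p.eval x.2‖ := by fun_prop
        exact ((h1.tendsto (u, z)).eventually (gt_mem_nhds (hp z hK))).mono fun x hx _ => hx.le
      · push Not at hK
        obtain ⟨m, hm⟩ := hK
        simp only [BdUp, not_forall] at hm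
        obtain ⟨i, hi, hn⟩ := hm
        rw [not_and_or, not_le, not_le] at hn
        refine ⟨m, ?_⟩
        rcases hn with hn | hn
        · refine (((uF_iter_cont i).norm.tendsto (u, z)).eventually (lt_mem_nhds hn)).mono fun x hx hb => ?_
          exact absurd (hb i hi).1 (not_le.2 hx)
        · refine (((uG_iter_cont i).norm.tendsto (u, z)).eventually (lt_mem_nhds hn)).mono fun x hx hb => ?_
          exact absurd (hb i hi).2 (not_le.2 hx)
  obtain ⟨m, hm⟩ := key
  refine ⟨m, hm.mono fun u' h z hz => h z ?_ hz⟩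
  rw [mem_closedBall_zero_iff]
  exact (hz 0 (Nat.zero_le _)).1

/-- the uniform estimate on a set of parameters -/
def UEst (R : ℝ) (s : Set (UU d e)) : Prop :=
  ∃ (κ C : ℝ) (m : ℕ), 0 < κ ∧ κ < 1 ∧ 1 ≤ C ∧ ∀ u ∈ s, ∀ (J : ℕ) (z : Fin (2 ^ J) → ℂ),
    (∀ l, BdUp u R (max J m) (z l)) →
    ‖u.2.1 ^ tri (2 ^ J) * (Matrix.vandermonde z).det ^ 2‖ ≤ κ ^ tri (2 ^ J) * C ^ ((J + 1) * 2 ^ J)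

theorem UEst_union {R : ℝ} {s t : Set (UU d e)} (hs : UEst R s) (ht : UEst R t) : UEst R (s ∪ t) := by
  obtain ⟨κ, C, m, h1, h2, h3, h4⟩ := hs
  obtain ⟨κ', C', m', h1', h2', h3', h4'⟩ := ht
  refine ⟨max κ κ', max C C', max m m', lt_max_of_lt_left h1, max_lt h2 h2', le_max_of_le_left h3, ?_⟩
  rintro u (hu | hu) J z hz
  · refine (h4 u hu J z fun l => (hz l).mono (max_le_max le_rfl (le_max_left _ _))).trans ?_
    gcongr
    · exact le_max_left _ _
    · exact le_max_left _ _
  · refine (h4' u hu J z fun l => (hz l).mono (max_le_max le_rfl (le_max_right _ _))).trans ?_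
    gcongr
    · exact le_max_right _ _
    · exact le_max_right _ _

theorem unif (hd : 2 ≤ d) (he : 2 ≤ e) (B : ℝ) (hB : 1 ≤ B) (b : Bool) (i D : ℕ) (x : ℕ → ℕ → ℂ)
    (hD : D = if b then d else e) (hi : i < D) :
    ∃ R0 : ℝ, ∀ R, R0 ≤ R → 1 ≤ R → UEst R {u : UU d e | Adm B b i D x u} := by
  obtain ⟨R0, hR0⟩ := Adm.esc (d := d) (e := e) hB hd he (b := b) (i := i) (D := D) (x := x)
  refine ⟨R0, fun R hRR hR => ?_⟩
  refine (Adm.compact B hB b i D x).induction_on ?_ ?_ ?_ ?_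
  · exact ⟨1/2, 1, 0, by norm_num, by norm_num, le_rfl, by simp⟩
  · rintro s t hst ⟨κ, C, m, h1, h2, h3, h4⟩
    exact ⟨κ, C, m, h1, h2, h3, fun u hu => h4 u (hst hu)⟩
  · intro s t; exact UEst_union
  intro u hu
  have hbc : Continuous fun v : UU d e => ‖v.2.1‖ := by fun_prop
  have hmem : ∀ᶠ v in nhdsWithin u {u : UU d e | Adm B b i D x u}, Adm B b i D x v := self_mem_nhdsWithin
  rcases lt_trichotomy ‖u.2.1‖ 1 with hlt | heq | hgt
  · set κ := (1 + ‖u.2.1‖) / 2 with hκ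
    have hκ0 : 0 < κ := by positivity
    have hκ1 : κ < 1 := by rw [hκ]; linarith
    have hev := ((hbc.tendsto u).eventually (gt_mem_nhds (show ‖u.2.1‖ < κ by rw [hκ]; linarith))).filter_mono
      (nhdsWithin_le_nhds (s := {u : UU d e | Adm B b i D x u}))
    refine ⟨_, hev, κ, (2 * R ^ d) ^ 2, 0, hκ0, hκ1, ?_, ?_⟩
    · exact one_le_pow₀ (by linarith [one_le_pow₀ hR (n := d)])
    · intro v hv J z hz
      have h1 := bas_det_norm (uF v) 1 d hd one_ne_zero (uF_natDegree v) (by rw [(uF_monic v).leadingCoeff, one_pow]) J z R hR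
        (fun l i hi => by rw [one_mul]; exact (hz l i (hi.le.trans (le_max_left _ _))).1)
      rw [one_pow, one_mul] at h1
      rw [norm_mul, norm_pow, norm_pow]
      have hone : 1 ≤ 2 * R ^ d := by linarith [one_le_pow₀ hR (n := d)]
      calc ‖v.2.1‖ ^ tri (2 ^ J) * ‖(Matrix.vandermonde z).det‖ ^ 2 ≤ κ ^ tri (2 ^ J) * ((2 * R ^ d) ^ (J * 2 ^ J)) ^ 2 := by
            have : ‖v.2.1‖ ≤ κ := le_of_lt hv
            gcongr
        _ = κ ^ tri (2 ^ J) * ((2 * R ^ d) ^ 2) ^ (J * 2 ^ J) := by rw [pow_right_comm]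
        _ ≤ _ := by
            refine mul_le_mul_of_nonneg_left (pow_le_pow_right₀ (one_le_pow₀ hone) ?_) (by positivity)
            exact Nat.mul_le_mul_right _ (by omega)
  · -- the critical case
    have hmem' := hu
    have hne := hu.bne
    set K : Set ℂ := {z | ∀ m, BdUp u R m z} with hKdef
    have hKcl : IsClosed K := by
      have : K = ⋂ i : ℕ, ({z | ‖(fun x => (uF u).eval x)^[i] z‖ ≤ R} ∩ {z | ‖(fun x => (uG u).eval x)^[i] z‖ ≤ R}) := by
        ext z
        simp only [Set.mem_iInter]
        constructor
        · intro h i; exact h i i le_rfl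
        · intro h m i _; exact h i
      rw [this]
      refine isClosed_iInter fun i => (isClosed_le ?_ continuous_const).inter (isClosed_le ?_ continuous_const)
      · exact ((uF_iter_cont i).comp (continuous_const.prodMk continuous_id)).norm
      · exact ((uG_iter_cont i).comp (continuous_const.prodMk continuous_id)).norm
    have hKc : IsCompact K := by
      refine (isCompact_closedBall (0:ℂ) R).of_isClosed_subset hKcl fun z hz => ?_
      rw [mem_closedBall_zero_iff]; exact (hz 0 0 le_rfl).1
    have hGl : ‖(uG u).leadingCoeff‖ = 1 := by rw [uG_lead u hne, norm_pow, heq, one_pow]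
    obtain ⟨p, hpm, hpd, hpK⟩ := local_p (uF u) (uG u) d e hd he (uF_natDegree u) (uG_natDegree u hne) (uF_monic u) hGl hu.hc R hR
      (fun y hy => hR0 u hu y (hRR.trans hy)) K hKc (fun z hz i => hz i i le_rfl) b i D (by
        rw [hD]; cases b
        · simp only [ltr, Bool.false_eq_true, if_false]; exact (uG_natDegree u hne).symm
        · simp only [ltr, if_true]; exact (uF_natDegree u).symm) hi (by
        intro h0
        have := hu.hco
        rw [h0] at this; simp at this; linarith) (by
        intro k l hkl hl h0
        have := hu.hw k l hkl hl
        rw [h0] at this; simp at this; linarith)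
    set D' := p.natDegree with hD'
    obtain ⟨τ, hτ1, hτ⟩ : ∃ τ : ℝ, τ < 1 ∧ ∀ z ∈ K, ‖p.eval z‖ ≤ τ := by
      rcases K.eq_empty_or_nonempty with h0 | h0
      · exact ⟨0, by norm_num, by rw [h0]; simp⟩
      · obtain ⟨z0, hz0, hmax⟩ := hKc.exists_isMaxOn h0 (f := fun z => ‖p.eval z‖) (by fun_prop)
        exact ⟨‖p.eval z0‖, hpK z0 hz0, fun z hz => hmax hz⟩
    obtain ⟨θ, hθτ, hθ0, hθ1⟩ : ∃ θ : ℝ, τ < θ ^ D' ∧ 0 < θ ∧ θ < 1 := by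
      have h1 : Continuous fun t : ℝ => t ^ D' := by fun_prop
      have h2 := (h1.tendsto 1).mono_left (nhdsWithin_le_nhds (s := Set.Iio 1))
      rw [one_pow] at h2
      have h3 := h2.eventually (lt_mem_nhds hτ1)
      have h4 : ∀ᶠ t : ℝ in nhdsWithin 1 (Set.Iio 1), 0 < t ∧ t < 1 := Ioo_mem_nhdsLT (by norm_num)
      obtain ⟨t, h5, h6⟩ := (h3.and h4).exists
      exact ⟨t, h5, h6.1, h6.2⟩
    obtain ⟨m, hm⟩ := near_bd u R p (θ ^ D') (fun z hz => (hτ z hz).trans_lt hθτ)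
    have hev := (((hbc.tendsto u).eventually (gt_mem_nhds (show ‖u.2.1‖ < θ⁻¹ by rw [heq]; exact (one_lt_inv₀ hθ0).2 hθ1)))
      ).and hm |>.filter_mono (nhdsWithin_le_nhds (s := {u : UU d e | Adm B b i D x u}))
    have hC1 : 1 ≤ 2 * (R / θ) ^ D' := by
      have : 1 ≤ R / θ := by rw [le_div_iff₀ hθ0]; linarith
      linarith [one_le_pow₀ this (n := D')]
    refine ⟨_, hev, θ, (2 * (R / θ) ^ D') ^ 2, m, hθ0, hθ1, one_le_pow₀ hC1, ?_⟩
    rintro v ⟨hv1, hv2⟩ J z hz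
    have h1 := pbas_det_norm p hpm hpd θ R hθ0 hθ1.le hR J z (fun l => (hz l 0 (Nat.zero_le _)).1)
      (fun l => hv2 (z l) ((hz l).mono (le_max_right _ _)))
    rw [norm_mul, norm_pow, norm_pow]
    calc ‖v.2.1‖ ^ tri (2 ^ J) * ‖(Matrix.vandermonde z).det‖ ^ 2
        ≤ θ⁻¹ ^ tri (2 ^ J) * (θ ^ tri (2 ^ J) * (2 * (R / θ) ^ D') ^ ((J + 1) * 2 ^ J)) ^ 2 := by
          have : ‖v.2.1‖ ≤ θ⁻¹ := hv1.le
          gcongr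
      _ = (θ⁻¹ * θ) ^ tri (2 ^ J) * (θ ^ tri (2 ^ J) * ((2 * (R / θ) ^ D') ^ 2) ^ ((J + 1) * 2 ^ J)) := by
          rw [pow_right_comm (2 * (R / θ) ^ D') 2, mul_pow θ⁻¹]; ring
      _ = _ := by rw [inv_mul_cancel₀ hθ0.ne', one_pow, one_mul]
  · set ρ := (1 + ‖u.2.1‖) / 2 with hρ
    have hρ1 : 1 < ρ := by rw [hρ]; linarith
    have hev := (((hbc.tendsto u).eventually (lt_mem_nhds (show ρ < ‖u.2.1‖ by rw [hρ]; linarith))).filter_mono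
      (nhdsWithin_le_nhds (s := {u : UU d e | Adm B b i D x u}))).and hmem
    have hA1 : 1 ≤ B * R := by nlinarith
    have hC1 : 1 ≤ 2 * (B * R) ^ e := by linarith [one_le_pow₀ hA1 (n := e)]
    refine ⟨_, hev, ρ⁻¹, (2 * (B * R) ^ e) ^ 2, 0, by positivity, inv_lt_one_of_one_lt₀ hρ1, one_le_pow₀ hC1, ?_⟩
    rintro v ⟨hv, hva⟩ J z hz
    have hvne := hva.bne
    have h1 := bas_det_norm (uG v) v.2.1 e he hvne (uG_natDegree v hvne) (uG_lead v hvne) J z (B * R) hA1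
      (fun l i hi => by
        rw [norm_mul]
        exact mul_le_mul hva.hβ (hz l i (hi.le.trans (le_max_left _ _))).2 (norm_nonneg _) (by linarith))
    have h2 : v.2.1 ^ tri (2 ^ J) * (Matrix.vandermonde z).det ^ 2 =
        v.2.1⁻¹ ^ tri (2 ^ J) * (v.2.1 ^ tri (2 ^ J) * (Matrix.vandermonde z).det) ^ 2 := by
      rw [inv_pow]; field_simp
    rw [h2, norm_mul, norm_pow, norm_pow, norm_inv]
    calc ‖v.2.1‖⁻¹ ^ tri (2 ^ J) * ‖v.2.1 ^ tri (2 ^ J) * (Matrix.vandermonde z).det‖ ^ 2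
        ≤ ρ⁻¹ ^ tri (2 ^ J) * ((2 * (B * R) ^ e) ^ (J * 2 ^ J)) ^ 2 := by
          have : ‖v.2.1‖⁻¹ ≤ ρ⁻¹ := inv_anti₀ (by linarith) (le_of_lt hv)
          gcongr
      _ = ρ⁻¹ ^ tri (2 ^ J) * ((2 * (B * R) ^ e) ^ 2) ^ (J * 2 ^ J) := by rw [pow_right_comm]
      _ ≤ _ := by
          refine mul_le_mul_of_nonneg_left (pow_le_pow_right₀ (one_le_pow₀ hC1) ?_) (by positivity)
          exact Nat.mul_le_mul_right _ (by omega)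

end Uniform


section CaseA

theorem pw_inj_aux (b : Bool) (i j : ℕ) (L L' : List Bool)
    (h : List.replicate i b ++ (!b) :: L = List.replicate j b ++ (!b) :: L') : i = j := by
  induction i generalizing j with
  | zero =>
    cases j with
    | zero => rfl
    | succ j => simp [List.replicate_succ] at h
  | succ i ih =>
    cases j with
    | zero => simp [List.replicate_succ] at h
    | succ j =>
      simp only [List.replicate_succ, List.cons_append, List.cons.injEq, true_and] at h
      rw [ih j h]

theorem wdp_map (φ : ℂ →+* ℂ) (F G : ℂ[X]) (w : List Bool) : (wdp F G w).map φ = wdp (F.map φ) (G.map φ) w := by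
  induction w with
  | nil => simp [wdp]
  | cons b w ih =>
    rw [wdp_cons, wdp_cons, Polynomial.map_comp, ih]
    cases b <;> rfl

theorem wit_ex (P Q : ℂ[X]) (h : P ≠ Q) : ∃ x : ℕ, P.eval (x:ℂ) ≠ Q.eval (x:ℂ) := by
  by_contra hcon
  push Not at hcon
  refine h (Polynomial.eq_of_infinite_eval_eq P Q ?_)
  refine (Set.infinite_range_of_injective (Nat.cast_injective (R := ℂ))).mono ?_
  rintro _ ⟨x, rfl⟩
  exact hcon x

theorem uF_of {d e : ℕ} (F : ℂ[X]) (hF : F.Monic) (hd : F.natDegree = d) (u : UU d e) (hu : ∀ j, u.1 j = F.coeff j) : uF u = F := by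
  ext j
  rcases lt_trichotomy j d with h1 | h1 | h1
  · rw [uF_coeff u j h1, hu]
  · have h2 := (uF_monic u).coeff_natDegree
    have h3 := hF.coeff_natDegree
    rw [uF_natDegree] at h2
    rw [hd] at h3
    rw [h1, h2, h3]
  · rw [coeff_eq_zero_of_natDegree_lt (by rwa [uF_natDegree]), coeff_eq_zero_of_natDegree_lt (by rwa [hd])]

theorem uG_of {d e : ℕ} (G : ℂ[X]) (hd : G.natDegree = e) (u : UU d e) (hβ : u.2.1 ≠ 0) (hl : G.leadingCoeff = u.2.1 ^ (e - 1))
    (hu : ∀ j, u.2.2 j = G.coeff j) : uG u = G := by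
  ext j
  rcases lt_trichotomy j e with h1 | h1 | h1
  · rw [uG_coeff u j h1, hu]
  · have h2 := uG_lead u hβ
    rw [leadingCoeff, uG_natDegree u hβ] at h2
    rw [leadingCoeff, hd] at hl
    rw [h1, h2, hl]
  · rw [coeff_eq_zero_of_natDegree_lt (by rwa [uG_natDegree u hβ]), coeff_eq_zero_of_natDegree_lt (by rwa [hd])]

theorem tri_two (N : ℕ) : tri N * 2 = N * (N - 1) := Finset.sum_range_id_mul_two N

theorem choose_J (κ C : ℝ) (h0 : 0 < κ) (h1 : κ < 1) (hC : 1 ≤ C) :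
    ∃ J : ℕ, κ ^ tri (2 ^ J) * C ^ ((J + 1) * 2 ^ J) ≤ 1 / 2 := by
  obtain ⟨q, hq⟩ := exists_pow_lt_of_lt_one (show 0 < (1/2) / C by positivity) h1
  rw [lt_div_iff₀ (by linarith)] at hq
  obtain ⟨J, hJ⟩ : ∃ J : ℕ, 2 * q * (J + 1) + 1 ≤ 2 ^ J := by
    have h2 : Filter.Tendsto (fun n : ℕ => ((n:ℝ) ^ 1) / (2:ℝ) ^ n) Filter.atTop (nhds 0) :=
      tendsto_pow_const_div_const_pow_of_one_lt 1 (by norm_num)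
    have h3 := (h2.eventually (gt_mem_nhds (show (0:ℝ) < 1 / (4 * q + 1) by positivity))).and (Filter.eventually_ge_atTop 1)
    obtain ⟨J, hJ, hJ1⟩ := h3.exists
    refine ⟨J, ?_⟩
    rw [pow_one, div_lt_div_iff₀ (by positivity) (by positivity)] at hJ
    have : J * (4 * q + 1) < 1 * 2 ^ J := by exact_mod_cast hJ
    nlinarith
  refine ⟨J, ?_⟩
  set E := (J + 1) * 2 ^ J with hE
  have hE1 : 1 ≤ E := Nat.mul_pos (by omega) (by positivity)
  have htri : q * E ≤ tri (2 ^ J) := by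
    have h2 := tri_two (2 ^ J)
    have h3 : 2 * q * (J + 1) ≤ 2 ^ J - 1 := by omega
    have h4 : 2 ^ J * (2 * q * (J + 1)) ≤ 2 ^ J * (2 ^ J - 1) := Nat.mul_le_mul_left _ h3
    rw [← h2] at h4
    rw [hE]; nlinarith
  calc κ ^ tri (2 ^ J) * C ^ E ≤ κ ^ (q * E) * C ^ E := by
        gcongr ?_ * _
        exact pow_le_pow_of_le_one h0.le h1.le htri
    _ = (κ ^ q * C) ^ E := by rw [mul_pow, pow_mul]
    _ ≤ (1/2) ^ E := by gcongr
    _ ≤ (1/2) ^ 1 := pow_le_pow_of_le_one (by norm_num) (by norm_num) hE1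
    _ = 1 / 2 := pow_one _

theorem caseA_norm {F G c : ℂ[X]} (h : Hyp F G c) (d e : ℕ) (hd : 2 ≤ d) (he : 2 ≤ e) (hFd : F.natDegree = d) (hGd : G.natDegree = e)
    (hF : F.Monic) (hc : F.coeff (d - 1) = 0) (β : ℂ) (hβ : β ≠ 0) (hGl : G.leadingCoeff = β ^ (e - 1))
    (b : Bool) (i D : ℕ) (hD : D = if b then d else e) (hi : i < D) (hco : (ltr F G b).coeff i ≠ 0) :
    (SolM 1 F G c).Finite := by
  have hdist : ∀ k l, ∃ x : ℕ, k < l → l ≤ D →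
      (wdp F G (pw b D k)).eval (x:ℂ) - (wdp F G (pw b D l)).eval (x:ℂ) ≠ 0 := by
    intro k l
    by_cases hkl : k < l
    · have hne : wdp F G (pw b D k) ≠ wdp F G (pw b D l) := by
        intro h0
        refine h.free (pw b D k) (pw b D l) (by simp [pw]) (by simp [pw]) (fun h1 => ?_) ?_
        · have := pw_inj_aux b k l _ _ h1
          omega
        · funext z
          rw [← wdp_eval, ← wdp_eval, h0]
      obtain ⟨x, hx⟩ := wit_ex _ _ hne
      exact ⟨x, fun _ _ => sub_ne_zero.2 hx⟩
    · exact ⟨0, fun h1 => absurd h1 hkl⟩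
  choose x hx using hdist
  set Y : Set ℂ := ((Set.range F.coeff ∪ Set.range G.coeff) ∪ (Set.range c.coeff ∪ {G.leadingCoeff⁻¹, F.leadingCoeff⁻¹})) ∪
    ({β, β⁻¹, ((ltr F G b).coeff i)⁻¹} ∪
      (Set.image2 (fun k l => ((wdp F G (pw b D k)).eval (x k l:ℂ) - (wdp F G (pw b D l)).eval (x k l:ℂ))⁻¹) (Set.Iic D) (Set.Iic D))) with hY
  have hYf : Y.Finite := (((range_coeff_finite F).union (range_coeff_finite G)).union
    ((range_coeff_finite c).union (Set.toFinite _))).union ((Set.toFinite _).union ((Set.finite_Iic D).image2 _ (Set.finite_Iic D)))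
  have yF : ∀ j, F.coeff j ∈ Y := fun j => Or.inl (Or.inl (Or.inl ⟨j, rfl⟩))
  have yG : ∀ j, G.coeff j ∈ Y := fun j => Or.inl (Or.inl (Or.inr ⟨j, rfl⟩))
  have yc : ∀ j, c.coeff j ∈ Y := fun j => Or.inl (Or.inr (Or.inl ⟨j, rfl⟩))
  have ylG : G.leadingCoeff⁻¹ ∈ Y := Or.inl (Or.inr (Or.inr (Or.inl rfl)))
  have ylF : F.leadingCoeff⁻¹ ∈ Y := Or.inl (Or.inr (Or.inr (Or.inr rfl)))
  have yβ : β ∈ Y := Or.inr (Or.inl (by simp))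
  have yβ' : β⁻¹ ∈ Y := Or.inr (Or.inl (by simp))
  have yco : ((ltr F G b).coeff i)⁻¹ ∈ Y := Or.inr (Or.inl (by simp))
  have yw : ∀ k l, k < l → l ≤ D → ((wdp F G (pw b D k)).eval (x k l:ℂ) - (wdp F G (pw b D l)).eval (x k l:ℂ))⁻¹ ∈ Y :=
    fun k l hkl hl => Or.inr (Or.inr ⟨k, by simp; omega, l, hl, rfl⟩)
  clear_value Y
  obtain ⟨O, s, T, B, kl⟩ := exists_KL Y hYf
  have hB := kl.one_le
  obtain ⟨R1, hR1, A1⟩ := kl.esc_arch F c yF ylF (by omega) yc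
  obtain ⟨R2, hR2, A2⟩ := kl.esc_arch G c yG ylG (by omega) yc
  obtain ⟨κ1, V1⟩ := kl.esc_val F c yF ylF (by omega) yc
  obtain ⟨κ2, V2⟩ := kl.esc_val G c yG ylG (by omega) yc
  obtain ⟨R0, hR0⟩ := unif (d := d) (e := e) hd he B hB b i D (fun k l => (x k l : ℂ)) hD hi
  set R := max R0 (max R1 R2) with hR
  have hRR1 : R1 ≤ R := (le_max_left _ _).trans (le_max_right _ _)
  have hRR2 : R2 ≤ R := (le_max_right _ _).trans (le_max_right _ _)
  obtain ⟨κ, C', m0, hκ0, hκ1, hC1, hU⟩ := hR0 R (le_max_left _ _) (hR1.trans hRR1)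
  -- parameter of φ
  have one_le_of : ∀ φ ∈ T, ∀ y : ℂ, y ≠ 0 → y⁻¹ ∈ Y → 1 ≤ B * ‖φ y‖ := by
    intro φ hφ y hy hyY
    have h1 := kl.y_le φ hφ _ hyY
    have h2 : ‖φ y⁻¹‖ * ‖φ y‖ = 1 := by rw [← norm_mul, ← map_mul, inv_mul_cancel₀ hy, map_one, norm_one]
    rw [← h2]
    exact mul_le_mul_of_nonneg_right h1 (norm_nonneg _)
  set uu : (ℂ →+* ℂ) → UU d e := fun φ => (fun j => φ (F.coeff j), φ β, fun j => φ (G.coeff j)) with huu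
  have uuF : ∀ φ, uF (uu φ) = F.map φ := fun φ => uF_of _ (hF.map φ) (by rw [natDegree_map, hFd]) _ (fun j => by simp [huu])
  have uuG : ∀ φ, uG (uu φ) = G.map φ := fun φ => uG_of _ (by rw [natDegree_map, hGd]) _ ((map_ne_zero φ).2 hβ)
    (by rw [leadingCoeff_map, hGl, map_pow]) (fun j => by simp [huu])
  have hltr : ∀ φ : ℂ →+* ℂ, ltr (F.map φ) (G.map φ) b = (ltr F G b).map φ := by intro φ; cases b <;> rfl
  have hAdm : ∀ φ ∈ T, Adm B b i D (fun k l => (x k l : ℂ)) (uu φ) := by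
    intro φ hφ
    refine ⟨fun j => kl.y_le φ hφ _ (yF j), kl.y_le φ hφ _ yβ, one_le_of φ hφ _ hβ yβ', fun j => kl.y_le φ hφ _ (yG j), ?_, ?_, ?_⟩
    · rw [uuF, coeff_map, hc, map_zero]
    · rw [uuF, uuG, hltr, coeff_map]; exact one_le_of φ hφ _ hco yco
    · intro k l hkl hl
      rw [uuF, uuG, ← wdp_map, ← wdp_map]
      have h1 := one_le_of φ hφ _ (hx k l hkl hl) (yw k l hkl hl)
      rwa [map_sub, map_eval_apply, map_eval_apply, map_natCast] at h1
  set a2 := κ2 + 1 with ha2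
  set q := κ1 * d + a2 * e with hq
  obtain ⟨J, hJ⟩ := choose_J κ (B ^ q * C') hκ0 hκ1 (one_le_mul_of_one_le_of_one_le (one_le_pow₀ hB) hC1)
  obtain ⟨M0, hM01, hM0⟩ := exists_pow_two_le c.natDegree
  set M := max M0 (max J m0) with hM
  refine h.reduce M ?_
  by_contra hinf
  have hinf : (SolM M F G c).Infinite := hinf
  obtain ⟨t, ht, htc⟩ := hinf.exists_subset_card_eq (2 ^ J)
  set z : Fin (2 ^ J) → ℂ := fun l => (t.equivFinOfCardEq htc).symm l with hz
  have hzinj : Function.Injective z := Subtype.val_injective.comp (t.equivFinOfCardEq htc).symm.injective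
  have hzS : ∀ l, z l ∈ SolM M F G c := fun l => ht ((t.equivFinOfCardEq htc).symm l).2
  have hzb : ∀ φ ∈ T, ∀ l, BdUp (uu φ) R (max J m0) (φ (z l)) := by
    intro φ hφ l i hi
    obtain ⟨m, n, hm, hn, e1, e2⟩ := hzS l
    have hM0M : M0 ≤ M := le_max_left _ _
    have hJM : max J m0 ≤ M := le_max_right _ _
    rw [uuF, uuG, ← map_iter, ← map_iter]
    exact ⟨(A1 φ hφ m (z l) (hM0 m (hM0M.trans hm)) e1 i (by omega)).trans hRR1,
      (A2 φ hφ n (z l) (hM0 n (hM0M.trans hn)) e2 i (by omega)).trans hRR2⟩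
  have hV0 : (Matrix.vandermonde z).det ≠ 0 := Matrix.det_vandermonde_ne_zero_iff.2 hzinj
  set V := (Matrix.vandermonde z).det with hV
  have m1 : s ^ (κ1 * d * (J * 2 ^ J)) * ((1:ℂ) ^ tri (2 ^ J) * V) ∈ O := by
    refine bas_det_mem O s kl.s_mem F 1 d hd one_ne_zero hFd (by rw [hF.leadingCoeff, one_pow]) κ1 J z fun l i hi => ?_
    obtain ⟨m, n, hm, hn, e1, e2⟩ := hzS l
    have hM0M : M0 ≤ M := le_max_left _ _
    have hJM : J ≤ M := (le_max_left _ _).trans (le_max_right _ _)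
    rw [one_mul]
    exact V1 m (z l) (hM0 m (hM0M.trans hm)) e1 i (by omega)
  have m2 : s ^ (a2 * e * (J * 2 ^ J)) * (β ^ tri (2 ^ J) * V) ∈ O := by
    refine bas_det_mem O s kl.s_mem G β e he hβ hGd hGl a2 J z fun l i hi => ?_
    obtain ⟨m, n, hm, hn, e1, e2⟩ := hzS l
    have hM0M : M0 ≤ M := le_max_left _ _
    have hJM : J ≤ M := (le_max_left _ _).trans (le_max_right _ _)
    have h1 := V2 n (z l) (hM0 n (hM0M.trans hn)) e2 i (by omega)
    have h2 := O.mul_mem h1 (kl.y_mem β yβ)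
    convert h2 using 1
    rw [ha2]; ring
  have hZ := O.mul_mem m1 m2
  set Z := s ^ (κ1 * d * (J * 2 ^ J)) * ((1:ℂ) ^ tri (2 ^ J) * V) * (s ^ (a2 * e * (J * 2 ^ J)) * (β ^ tri (2 ^ J) * V)) with hZd
  have hZeq : Z = s ^ (q * (J * 2 ^ J)) * (β ^ tri (2 ^ J) * V ^ 2) := by
    have hqe : q * (J * 2 ^ J) = κ1 * d * (J * 2 ^ J) + a2 * e * (J * 2 ^ J) := by
      rw [hq]; exact add_mul _ _ _
    rw [hZd, hqe, pow_add, one_pow]; ring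
  have hZ0 : Z ≠ 0 := by
    rw [hZeq]
    exact mul_ne_zero (pow_ne_zero _ kl.s_ne) (mul_ne_zero (pow_ne_zero _ hβ) (pow_ne_zero _ hV0))
  refine hZ0 (kl.small (Set.range z) (Set.finite_range z) ?_ Z ?_ hZ ?_)
  · rintro _ ⟨l, rfl⟩
    obtain ⟨m, n, hm, hn, e1, e2⟩ := hzS l
    have hM0M : M0 ≤ M := le_max_left _ _
    refine ⟨c - itp F m, itp_sub_ne F c m (h.fin_f m (by omega)), fun n => ?_, ?_⟩
    · rw [coeff_sub]
      exact Subfield.sub_mem _ (Subfield.subset_closure (yc n)) (itp_coeff_mem _ F (fun j => Subfield.subset_closure (yF j)) m n)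
    · rw [eval_sub, itp_eval, e1, sub_self]
  · rw [hZeq]
    have hle : Subfield.closure Y ≤ Subfield.closure (Y ∪ Set.range z) := Subfield.closure_mono Set.subset_union_left
    refine mul_mem (pow_mem (hle kl.s_cl) _) (mul_mem (pow_mem (hle (Subfield.subset_closure yβ)) _) (pow_mem ?_ _))
    rw [hV, Matrix.det_vandermonde]
    refine prod_mem fun i _ => prod_mem fun j _ => ?_
    exact sub_mem (Subfield.subset_closure (Or.inr ⟨j, rfl⟩)) (Subfield.subset_closure (Or.inr ⟨i, rfl⟩))
  · intro φ hφ
    have hVφ : φ V = (Matrix.vandermonde fun l => φ (z l)).det := by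
      rw [hV, Matrix.det_vandermonde, Matrix.det_vandermonde]
      simp [map_prod]
    have h1 := hU (uu φ) (hAdm φ hφ) J (fun l => φ (z l)) (hzb φ hφ)
    rw [← hVφ] at h1
    have h2 : φ Z = φ s ^ (q * (J * 2 ^ J)) * ((uu φ).2.1 ^ tri (2 ^ J) * φ V ^ 2) := by
      rw [hZeq]; simp [huu]
    rw [h2, norm_mul, norm_pow]
    calc ‖φ s‖ ^ (q * (J * 2 ^ J)) * ‖(uu φ).2.1 ^ tri (2 ^ J) * φ V ^ 2‖
        ≤ B ^ (q * (J * 2 ^ J)) * (κ ^ tri (2 ^ J) * C' ^ ((J + 1) * 2 ^ J)) := by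
          have := kl.s_le φ hφ
          gcongr
      _ ≤ B ^ (q * ((J + 1) * 2 ^ J)) * (κ ^ tri (2 ^ J) * C' ^ ((J + 1) * 2 ^ J)) := by
          refine mul_le_mul_of_nonneg_right (pow_le_pow_right₀ hB ?_) (by positivity)
          exact Nat.mul_le_mul_left _ (Nat.mul_le_mul_right _ (by omega))
      _ = κ ^ tri (2 ^ J) * (B ^ q * C') ^ ((J + 1) * 2 ^ J) := by rw [mul_pow, pow_mul]; ring
      _ ≤ 1 / 2 := hJ

theorem caseA_monic {F G c : ℂ[X]} (h : Hyp F G c) (hd : 2 ≤ F.natDegree) (he : 2 ≤ G.natDegree)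
    (hF : F.Monic) (hc : F.coeff (F.natDegree - 1) = 0) : (SolM 1 F G c).Finite := by
  have hG0 : G.leadingCoeff ≠ 0 := leadingCoeff_ne_zero.2 (by rintro rfl; simp at he)
  obtain ⟨β, hβ⟩ := IsAlgClosed.exists_pow_nat_eq G.leadingCoeff (n := G.natDegree - 1) (by omega)
  have hβ0 : β ≠ 0 := by rintro rfl; apply hG0; rw [← hβ, zero_pow (by omega)]
  by_cases h1 : ∃ i < F.natDegree, F.coeff i ≠ 0
  · obtain ⟨i, hi, hi0⟩ := h1
    exact caseA_norm h _ _ hd he rfl rfl hF hc β hβ0 hβ.symm true i F.natDegree rfl hi hi0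
  by_cases h2 : ∃ i < G.natDegree, G.coeff i ≠ 0
  · obtain ⟨i, hi, hi0⟩ := h2
    exact caseA_norm h _ _ hd he rfl rfl hF hc β hβ0 hβ.symm false i G.natDegree rfl hi hi0
  push Not at h1 h2
  have e1 : F = X ^ F.natDegree := by
    conv_lhs => rw [hF.as_sum]
    rw [Finset.sum_eq_zero, add_zero]
    intro i hi
    rw [h1 i (Finset.mem_range.1 hi), C_0, zero_mul]
  have e2 : G = C G.leadingCoeff * X ^ G.natDegree := by
    conv_lhs => rw [G.as_sum_range_C_mul_X_pow, Finset.sum_range_succ]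
    rw [Finset.sum_eq_zero, zero_add]; · rfl
    intro i hi
    rw [h2 i (Finset.mem_range.1 hi), C_0, zero_mul]
  have := caseMono F.natDegree G.natDegree G.leadingCoeff hd he hG0 (c := c)
  rw [← e1, ← e2] at this
  exact this h

theorem caseA {f g c : ℂ[X]} (h : Hyp f g c) (hf : 2 ≤ f.natDegree) (hg : 2 ≤ g.natDegree) : (SolM 1 f g c).Finite := by
  have hf0 : f.leadingCoeff ≠ 0 := leadingCoeff_ne_zero.2 (by rintro rfl; simp at hf)
  obtain ⟨α, hα⟩ := IsAlgClosed.exists_pow_nat_eq f.leadingCoeff⁻¹ (n := f.natDegree - 1) (by omega)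
  have hα0 : α ≠ 0 := by rintro rfl; apply inv_ne_zero hf0; rw [← hα, zero_pow (by omega)]
  refine SolM_cj α 0 hα0 1 ?_
  have h' := h.cj α 0 hα0
  have hd1 := natDegree_cjp α 0 hα0 f (by omega)
  have hd2 := natDegree_cjp α 0 hα0 g (by omega)
  have hlin : (C α * X + C 0 : ℂ[X]).natDegree = 1 := natDegree_linear hα0
  have hm : (cjp α 0 f).Monic := by
    rw [Monic, cjp, C_0, sub_zero, leadingCoeff_mul, leadingCoeff_C, ← C_0, leadingCoeff_comp (by rw [hlin]; omega), C_0, add_zero,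
      leadingCoeff_mul, leadingCoeff_C, leadingCoeff_X, mul_one]
    have : α ^ f.natDegree = α ^ (f.natDegree - 1) * α := by rw [← pow_succ]; congr 1; omega
    rw [this, hα]
    field_simp
  generalize hf1 : cjp α 0 f = f1 at *
  generalize hg1 : cjp α 0 g = g1 at *
  generalize cjp α 0 c = c1 at *
  set n := f1.natDegree with hn
  set γ : ℂ := -f1.coeff (n - 1) / n with hγ
  refine SolM_cj 1 γ one_ne_zero 1 ?_
  have hd1' := natDegree_cjp 1 γ one_ne_zero f1 (by omega)
  have hd2' := natDegree_cjp 1 γ one_ne_zero g1 (by omega)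
  have hcj : cjp 1 γ f1 = taylor γ f1 - C γ := by
    rw [cjp, inv_one, C_1, one_mul, one_mul, taylor_apply]
  have hn0 : (n:ℂ) ≠ 0 := by exact_mod_cast (by omega : n ≠ 0)
  have htop : (cjp 1 γ f1).coeff n = 1 := by
    rw [hcj, coeff_sub, coeff_C, if_neg (by omega), sub_zero, taylor_coeff]
    have : (hasseDeriv n f1) = C 1 := by
      have h3 : (hasseDeriv n f1).natDegree = 0 := by
        have := natDegree_hasseDeriv_le f1 n
        omega
      rw [eq_C_of_natDegree_eq_zero h3, hasseDeriv_coeff, zero_add, Nat.choose_self, Nat.cast_one, one_mul, hm.coeff_natDegree]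
    rw [this, eval_C]
  refine caseA_monic (h'.cj 1 γ one_ne_zero) (by omega) (by omega) ?_ ?_
  · rw [Monic, leadingCoeff, hd1', ← hn, htop]
  · rw [hd1', ← hn, hcj, coeff_sub, coeff_C, if_neg (by omega), sub_zero, taylor_coeff]
    have h3 : (hasseDeriv (n - 1) f1).natDegree ≤ 1 := by
      have := natDegree_hasseDeriv_le f1 (n - 1)
      omega
    rw [eq_X_add_C_of_natDegree_le_one h3, hasseDeriv_coeff, hasseDeriv_coeff]
    have h4 : 1 + (n - 1) = n := by omega
    rw [h4, zero_add, Nat.choose_self, hm.coeff_natDegree]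
    have h5 : n.choose (n - 1) = n := by
      rw [Nat.choose_symm (by omega), Nat.choose_one_right]
    rw [h5, hγ]
    simp
    field_simp
    ring

end CaseA


section SpecSection

theorem totient_dvd (n h : ℕ) (hn : 1 ≤ n) (hh : n.totient ≤ h) : n ∣ (2 * h).factorial := by
  rw [Nat.dvd_iff_prime_pow_dvd_dvd]
  intro p k hp hk
  rcases Nat.eq_zero_or_pos k with rfl | hk0
  · simp
  have h1 : (p ^ k).totient ≤ n.totient :=
    Nat.le_of_dvd (Nat.totient_pos.2 hn) (Nat.totient_dvd_of_dvd hk)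
  rw [Nat.totient_prime_pow hp hk0] at h1
  have h2 : p ≤ 2 * (p - 1) := by have := hp.two_le; omega
  have h3 : p ^ k ≤ 2 * h := by
    calc p ^ k = p ^ (k - 1) * p := by rw [← pow_succ, Nat.sub_add_cancel hk0]
      _ ≤ p ^ (k - 1) * (2 * (p - 1)) := Nat.mul_le_mul_left _ h2
      _ = 2 * (p ^ (k - 1) * (p - 1)) := by ring
      _ ≤ 2 * h := by omega
  exact Nat.dvd_factorial (pow_pos hp.pos _) h3

theorem root_order {L : Type*} [Field L] [CharZero L] (p : ℤ[X]) (hp : p ≠ 0) (z : L)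
    (hz : aeval z p = 0) (k : ℕ) (hk : 1 ≤ k) (hzk : z ^ k = 1) :
    z ^ (2 * p.natDegree).factorial = 1 := by
  have hfin : IsOfFinOrder z := isOfFinOrder_iff_pow_eq_one.2 ⟨k, hk, hzk⟩
  have ho : 0 < orderOf z := hfin.orderOf_pos
  have hprim : IsPrimitiveRoot z (orderOf z) := IsPrimitiveRoot.orderOf z
  have h1 := cyclotomic_eq_minpoly hprim ho
  have hintg : IsIntegral ℤ z := hprim.isIntegral ho
  have h2 : minpoly ℤ z ∣ p := minpoly.isIntegrallyClosed_dvd hintg hz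
  have h3 := natDegree_le_of_dvd h2 hp
  rw [← h1, natDegree_cyclotomic] at h3
  exact orderOf_dvd_iff_pow_eq_one.1 (totient_dvd _ _ ho h3)

theorem ext_hom_aux {A B L : Type} [CommRing A] [CommRing B] [Field L] [IsAlgClosed L] [IsDomain A] [IsDomain B]
    (i : A →+* B) (hi : Function.Injective i) (j : A →+* L) (hj : Function.Injective j)
    (hintg : i.IsIntegral) : ∃ l : B →+* L, l.comp i = j := by
  letI : Algebra A L := j.toAlgebra
  letI : Algebra A B := i.toAlgebra
  haveI : FaithfulSMul A L := (faithfulSMul_iff_algebraMap_injective _ _).2 hj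
  haveI : FaithfulSMul A B := (faithfulSMul_iff_algebraMap_injective _ _).2 hi
  haveI : Algebra.IsIntegral A B := ⟨hintg⟩
  haveI : Algebra.IsAlgebraic A B := inferInstance
  let ℓ : B →ₐ[A] L := IsAlgClosed.lift
  exact ⟨ℓ.toRingHom, RingHom.ext fun a => ℓ.commutes a⟩

theorem ext_hom {R S L : Type} [CommRing R] [CommRing S] [Field L] [IsAlgClosed L] [Algebra R S]
    [Algebra.IsIntegral R S] (hinj : Function.Injective (algebraMap R S)) (χ : R →+* L) :
    ∃ ψ : S →+* L, ψ.comp (algebraMap R S) = χ := by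
  have hP : (RingHom.ker χ).IsPrime := RingHom.ker_isPrime χ
  obtain ⟨Q, -, hQ, hQP⟩ := Ideal.exists_ideal_over_prime_of_isIntegral (RingHom.ker χ) (⊥ : Ideal S)
    (by
      intro x hx
      have : algebraMap R S x = 0 := by simpa using hx
      have : x = 0 := hinj (by rw [this, map_zero])
      rw [this]; exact zero_mem _)
  let χ' : (R ⧸ RingHom.ker χ) →+* L := RingHom.kerLift χ
  let ι : (R ⧸ RingHom.ker χ) →+* (S ⧸ Q) := Ideal.quotientMap Q (algebraMap R S) (by rw [← hQP])
  have hι : Function.Injective ι := Ideal.quotientMap_injective' (by rw [← hQP])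
  have hχ' : Function.Injective χ' := RingHom.kerLift_injective χ
  have hintg : ι.IsIntegral := by
    intro x
    obtain ⟨y, rfl⟩ := Ideal.Quotient.mk_surjective x
    obtain ⟨p, hp, hpy⟩ := Algebra.IsIntegral.isIntegral (R := R) y
    refine ⟨p.map (Ideal.Quotient.mk _), hp.map _, ?_⟩
    rw [eval₂_map]
    have : ι.comp (Ideal.Quotient.mk (RingHom.ker χ)) =
        (Ideal.Quotient.mk Q).comp (algebraMap R S) := by
      ext r; rfl
    rw [this, ← hom_eval₂, hpy, map_zero]
  haveI : IsDomain (R ⧸ RingHom.ker χ) := Ideal.Quotient.isDomain _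
  haveI : IsDomain (S ⧸ Q) := Ideal.Quotient.isDomain _
  obtain ⟨l, hl⟩ := ext_hom_aux ι hι χ' hχ' hintg
  refine ⟨l.comp (Ideal.Quotient.mk Q), ?_⟩
  ext r
  have := congrArg (fun q => q (Ideal.Quotient.mk _ r)) hl
  exact this

end SpecSection


section SpecSection2

theorem spec_ring {r : ℕ} (t : Fin r → ℂ) (ht : klGen t) (S : MvPolynomial (Fin r) ℤ)
    (P : Fin r → ℤ) (hSP : MvPolynomial.eval P S ≠ 0) :
    ∃ (R : Subring ℂ) (ψ : R →+* AlgebraicClosure ℚ),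
      (∀ (p : ℂ[X]) (z : ℂ), p.Monic → (∀ i, p.coeff i ∈ R) → p.eval z = 0 → z ∈ R) ∧
      (∀ (S' : MvPolynomial (Fin r) ℤ) (y : ℂ), S' ∣ S →
        (MvPolynomial.aeval t : MvPolynomial (Fin r) ℤ →ₐ[ℤ] ℂ).toRingHom.IsIntegralElem
        (MvPolynomial.aeval t S' * y) → y ∈ R) ∧
      (∀ D : MvPolynomial (Fin r) ℤ, ∃ x : R, x.1 = MvPolynomial.aeval t D ∧
        ψ x = ((MvPolynomial.eval P D : ℤ) : AlgebraicClosure ℚ)) ∧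
      (∀ u : R, ∃ p : (AlgebraicClosure ℚ)[X], p.Monic ∧ (∀ i, ∃ (n : ℤ) (k : ℕ),
        p.coeff i * ((MvPolynomial.eval P S : ℤ) : AlgebraicClosure ℚ) ^ k = n) ∧ p.eval (ψ u) = 0) := by
  classical
  let R0 := MvPolynomial (Fin r) ℤ
  let R1 := Localization.Away S
  let i : R0 →+* ℂ := (MvPolynomial.aeval t : MvPolynomial (Fin r) ℤ →ₐ[ℤ] ℂ).toRingHom
  have hi : Function.Injective i := ht
  have hS0 : S ≠ 0 := by rintro rfl; simp at hSP
  have hiS : IsUnit (i S) := by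
    rw [isUnit_iff_ne_zero]; intro h; exact hS0 (hi (by rw [h, map_zero]))
  let L := AlgebraicClosure ℚ
  let e : R0 →+* L := (Int.castRingHom L).comp (MvPolynomial.eval P)
  have heS : IsUnit (e S) := by
    rw [isUnit_iff_ne_zero]
    exact Int.cast_ne_zero.2 hSP
  let j : R1 →+* ℂ := IsLocalization.Away.lift S hiS
  let χ : R1 →+* L := IsLocalization.Away.lift S heS
  have hj : ∀ x : R0, j (algebraMap R0 R1 x) = i x := fun x => IsLocalization.Away.lift_eq S hiS x
  have hχ : ∀ x : R0, χ (algebraMap R0 R1 x) = e x := fun x => IsLocalization.Away.lift_eq S heS x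
  have hsurj : ∀ z : R1, ∃ (x : R0) (k : ℕ), z * algebraMap R0 R1 S ^ k = algebraMap R0 R1 x := by
    intro z
    obtain ⟨k, x, h⟩ := IsLocalization.Away.surj S z
    exact ⟨x, k, by simpa using h⟩
  have hSu : IsUnit (algebraMap R0 R1 S) := IsLocalization.Away.algebraMap_isUnit S
  have hjinj : Function.Injective j := by
    rw [injective_iff_map_eq_zero]
    intro z hz
    obtain ⟨x, k, h⟩ := hsurj z
    have h1 := congrArg j h
    rw [map_mul, hz, zero_mul, hj] at h1
    have : x = 0 := hi (by rw [← h1, map_zero])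
    rw [this, map_zero] at h
    exact (hSu.pow k).mul_left_eq_zero.1 h
  letI : Algebra R1 ℂ := j.toAlgebra
  let R := (integralClosure R1 ℂ).toSubring
  have hmem : ∀ z : ℂ, z ∈ R ↔ IsIntegral R1 z := fun z => Iff.rfl
  obtain ⟨ψ, hψ⟩ := ext_hom (R := R1) (S := integralClosure R1 ℂ) (L := L)
    (by
      intro x y hxy
      apply hjinj
      exact congrArg Subtype.val hxy) χ
  refine ⟨R, ψ, ?_, ?_, ?_, ?_⟩
  · intro p z hp hc hz
    rw [hmem]
    have hl : p ∈ lifts (algebraMap (integralClosure R1 ℂ) ℂ) := by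
      rw [lifts_iff_coeff_lifts]
      intro n
      exact ⟨⟨p.coeff n, hc n⟩, rfl⟩
    obtain ⟨q, hq, -, hqm⟩ := lifts_and_degree_eq_and_monic hl hp
    have h1 : IsIntegral (integralClosure R1 ℂ) z := ⟨q, hqm, by rw [← eval_map, hq, hz]⟩
    exact isIntegral_trans z h1
  · rintro S' y ⟨S'', hS'⟩ hy
    rw [hmem]
    have h1 : IsIntegral R1 (i S' * y) := by
      obtain ⟨p, hp, hp0⟩ := hy
      refine ⟨p.map (algebraMap R0 R1), hp.map _, ?_⟩
      rw [eval₂_map]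
      have : (algebraMap R1 ℂ).comp (algebraMap R0 R1) = i := RingHom.ext hj
      rw [this]; exact hp0
    have hu : IsUnit (algebraMap R0 R1 S') := by
      have h5 : algebraMap R0 R1 S = algebraMap R0 R1 S' * algebraMap R0 R1 S'' := by
        rw [← map_mul]; exact congrArg _ hS'
      rw [h5] at hSu
      exact isUnit_of_mul_isUnit_left hSu
    obtain ⟨v, hv⟩ := hu.exists_left_inv
    have h2 : IsIntegral R1 (algebraMap R1 ℂ v) := isIntegral_algebraMap
    have h3 := h2.mul h1
    have h4 : algebraMap R1 ℂ v * i S' = 1 := by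
      have := congrArg j hv
      rw [map_mul, map_one, hj] at this
      exact this
    rwa [← mul_assoc, h4, one_mul] at h3
  · intro D
    refine ⟨algebraMap R1 (integralClosure R1 ℂ) (algebraMap R0 R1 D), ?_, ?_⟩
    · exact hj D
    · have := congrArg (fun q => q (algebraMap R0 R1 D)) hψ
      have h2 : ψ (algebraMap R1 (integralClosure R1 ℂ) (algebraMap R0 R1 D)) = χ (algebraMap R0 R1 D) := this
      exact h2.trans (hχ D)
  · intro u
    obtain ⟨p, hp, hp0⟩ : IsIntegral R1 u.1 := u.2
    refine ⟨p.map χ, hp.map _, ?_, ?_⟩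
    · intro n
      obtain ⟨x, k, h⟩ := hsurj (p.coeff n)
      refine ⟨MvPolynomial.eval P x, k, ?_⟩
      have := congrArg χ h
      rw [map_mul, map_pow, hχ, hχ] at this
      rw [coeff_map]
      exact this
    · have h1 : eval₂ (algebraMap R1 (integralClosure R1 ℂ)) (u : integralClosure R1 ℂ) p = 0 := by
        apply Subtype.ext
        have := hom_eval₂ p (algebraMap R1 (integralClosure R1 ℂ)) (algebraMap (integralClosure R1 ℂ) ℂ) u
        exact this.trans hp0
      have h2 := congrArg ψ h1
      rw [hom_eval₂, hψ, map_zero] at h2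
      rw [eval_map]
      exact h2

theorem spec (Y : Set ℂ) (hY : Y.Finite) (a b : ℂ) (ha : a ∈ Y) (hb : b ∈ Y)
    (ha1 : ∀ k, 1 ≤ k → a ^ k ≠ 1) (hb1 : ∀ k, 1 ≤ k → b ^ k ≠ 1) :
    ∃ (R : Subring ℂ) (ψ : R →+* AlgebraicClosure ℚ),
      (∀ y ∈ Y, y ∈ R) ∧
      (∀ (p : ℂ[X]) (z : ℂ), p.Monic → (∀ i, p.coeff i ∈ R) → p.eval z = 0 → z ∈ R) ∧
      (∀ x : R, x.1 = a → ∀ k, 1 ≤ k → ψ x ^ k ≠ 1) ∧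
      (∀ x : R, x.1 = b → ∀ k, 1 ≤ k → ψ x ^ k ≠ 1) ∧
      ∀ δ : R, δ ≠ 0 → δ.1 ∈ Y → δ.1⁻¹ ∈ Y →
        {x | x ∈ IntermediateField.adjoin ℚ {z | ∃ y : R, y.1 ∈ Y ∧ ψ y = z} ∧
          ∃ u : R, IsUnit u ∧ IsUnit (u - δ) ∧ ψ u = x}.Finite := by
  classical
  obtain ⟨r, t, ht, htY, halg, s, hs, hsY⟩ := kl_basis Y hY
  let i : MvPolynomial (Fin r) ℤ →+* ℂ := (MvPolynomial.aeval t : MvPolynomial (Fin r) ℤ →ₐ[ℤ] ℂ).toRingHom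
  have hi : Function.Injective i := ht
  have key : ∀ a ∈ Y, (∀ k, 1 ≤ k → a ^ k ≠ 1) → ∃ S : MvPolynomial (Fin r) ℤ, S ≠ 0 ∧
      ∀ (P : Fin r → ℤ) (R : Subring ℂ) (ψ : R →+* AlgebraicClosure ℚ),
      MvPolynomial.eval P S ≠ 0 → 
      (∀ (S' : MvPolynomial (Fin r) ℤ) (y : ℂ), S' ∣ S →
        (MvPolynomial.aeval t : MvPolynomial (Fin r) ℤ →ₐ[ℤ] ℂ).toRingHom.IsIntegralElem
        (MvPolynomial.aeval t S' * y) → y ∈ R) →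
      (∀ D : MvPolynomial (Fin r) ℤ, ∃ x : R, x.1 = MvPolynomial.aeval t D ∧
        ψ x = ((MvPolynomial.eval P D : ℤ) : AlgebraicClosure ℚ)) →
      (∀ x : R, x.1 = a → ∀ k, 1 ≤ k → ψ x ^ k ≠ 1) := by
    intro a ha ha1
    obtain ⟨p, hp, hp0⟩ := halg a ha
    set M := (2 * p.natDegree).factorial with hM
    have hM1 : 1 ≤ M := Nat.factorial_pos _
    letI : Algebra (MvPolynomial (Fin r) ℤ) ℂ := i.toAlgebra
    have haa : IsAlgebraic (MvPolynomial (Fin r) ℤ) a := ⟨p, hp, hp0⟩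
    have h1 : IsAlgebraic (MvPolynomial (Fin r) ℤ) (a ^ M - 1) := (haa.pow M).sub isAlgebraic_one
    have h2 : IsAlgebraic (MvPolynomial (Fin r) ℤ) (a ^ M - 1)⁻¹ := h1.inv
    obtain ⟨σ, hσ, h3⟩ := h2.exists_integral_multiple
    rw [Algebra.smul_def] at h3
    refine ⟨σ * p.leadingCoeff, mul_ne_zero hσ (leadingCoeff_ne_zero.2 hp), ?_⟩
    intro P R ψ hP hR hψ x hx k hk hxk
    have h4 : (a ^ M - 1)⁻¹ ∈ R := hR σ _ (dvd_mul_right _ _) h3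
    have hne : a ^ M - 1 ≠ 0 := sub_ne_zero.2 (ha1 M hM1)
    have h5 : ψ (x ^ M - 1) * ψ ⟨_, h4⟩ = 1 := by
      rw [← map_mul, ← map_one ψ]
      congr 1
      apply Subtype.ext
      change (x.1 ^ M - 1) * _ = (1:ℂ)
      rw [hx, mul_inv_cancel₀ hne]
    set q : ℤ[X] := p.map (MvPolynomial.eval P) with hq
    rw [map_mul] at hP
    have hlc : MvPolynomial.eval P p.leadingCoeff ≠ 0 := right_ne_zero_of_mul hP
    have hqd : q.natDegree = p.natDegree := natDegree_map_of_leadingCoeff_ne_zero _ hlc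
    have hq0 : q ≠ 0 := by
      intro h0
      apply hlc
      have := congrArg (fun w => w.coeff p.natDegree) h0
      simpa [hq] using this
    choose D hD1 hD2 using hψ
    have h6 : aeval (ψ x) q = 0 := by
      rw [hq, aeval_def, eval₂_map, eval₂_eq_sum_range]
      have e1 : ∀ n, ((algebraMap ℤ (AlgebraicClosure ℚ)).comp (MvPolynomial.eval P)) (p.coeff n) * ψ x ^ n
          = ψ (D (p.coeff n) * x ^ n) := by
        intro n
        rw [map_mul, hD2, map_pow]; rfl
      rw [Finset.sum_congr rfl fun n _ => e1 n, ← map_sum]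
      have e2 : ∑ n ∈ Finset.range (p.natDegree + 1), D (p.coeff n) * x ^ n = 0 := by
        apply Subtype.ext
        rw [eval₂_eq_sum_range] at hp0
        rw [← Subring.subtype_apply, map_sum, ← Subring.subtype_apply, map_zero, ← hp0]
        refine Finset.sum_congr rfl fun n _ => ?_
        rw [map_mul, map_pow, Subring.subtype_apply, Subring.subtype_apply, hD1, hx]; rfl
      rw [e2, map_zero]
    have h7 := root_order q hq0 (ψ x) h6 k hk hxk
    rw [hqd, ← hM] at h7
    rw [map_sub, map_pow, h7, map_one, sub_self, zero_mul] at h5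
    exact zero_ne_one h5
  obtain ⟨Sa, hSa, hSa'⟩ := key a ha ha1
  obtain ⟨Sb, hSb, hSb'⟩ := key b hb hb1
  set S := s * Sa * Sb with hS
  have hS0 : S ≠ 0 := mul_ne_zero (mul_ne_zero hs hSa) hSb
  obtain ⟨P, hP⟩ : ∃ P : Fin r → ℤ, MvPolynomial.eval P S ≠ 0 := by
    by_contra hcon
    push Not at hcon
    exact hS0 (MvPolynomial.funext fun P => by rw [hcon P, map_zero])
  have hP' := hP
  rw [hS, map_mul, map_mul] at hP'
  obtain ⟨R, ψ, hR1, hR2, hR3, hR4⟩ := spec_ring t ht S P hP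
  have hSaS : Sa ∣ S := ⟨s * Sb, by rw [hS]; ring⟩
  have hSbS : Sb ∣ S := ⟨s * Sa, by rw [hS]; ring⟩
  have hsS : s ∣ S := ⟨Sa * Sb, by rw [hS]; ring⟩
  refine ⟨R, ψ, fun y hy => hR2 s y hsS (hsY y hy), hR1,
    hSa' P R ψ (right_ne_zero_of_mul (left_ne_zero_of_mul hP')) (fun S' y h => hR2 S' y (h.trans hSaS)) hR3,
    hSb' P R ψ (right_ne_zero_of_mul hP') (fun S' y h => hR2 S' y (h.trans hSbS)) hR3, ?_⟩
  intro δ hδ0 hδY hδY'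
  set W : Set (AlgebraicClosure ℚ) := {z | ∃ y : R, y.1 ∈ Y ∧ ψ y = z} with hW
  have hWf : W.Finite := by
    have h1 : {y : R | y.1 ∈ Y}.Finite := hY.preimage Subtype.val_injective.injOn
    exact h1.image ψ
  haveI : Finite W := hWf.to_subtype
  set K := IntermediateField.adjoin ℚ W with hK
  haveI : FiniteDimensional ℚ K := by
    apply IntermediateField.finiteDimensional_adjoin
    intro x _
    have h9 := (AlgebraicClosure.isAlgebraic ℚ).isAlgebraic x
    obtain ⟨p, hp, hp0⟩ := h9.isIntegral
    refine ⟨p, hp, ?_⟩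
    rw [← hp0]
    congr 1
  haveI : NumberField K := ⟨⟩
  have hδK : ψ δ ∈ K := IntermediateField.subset_adjoin _ _ ⟨δ, hδY, rfl⟩
  have hδ1 : δ.1 ≠ 0 := fun h => hδ0 (Subtype.ext h)
  have hδu : ψ δ ≠ 0 := by
    intro h0
    have h4 : δ.1⁻¹ ∈ R := hR2 s _ hsS (hsY _ hδY')
    have : ψ δ * ψ ⟨_, h4⟩ = 1 := by
      rw [← map_mul, ← map_one ψ]; congr 1; exact Subtype.ext (mul_inv_cancel₀ hδ1)
    rw [h0, zero_mul] at this
    exact zero_ne_one this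
  set N : ℤ := MvPolynomial.eval P S with hN
  obtain ⟨O, hO1, hO2, hO3⟩ := sunit_nf (K := K) {⟨ψ δ, hδK⟩, (N : K)} (by simp)
  have hOδ := hO1 ⟨ψ δ, hδK⟩ (by simp)
  have hON := hO1 (N : K) (by simp)
  -- elements of `R` whose image is in `K` map to `O`
  have hRO : ∀ (u : R) (hu : ψ u ∈ K), (⟨ψ u, hu⟩ : K) ∈ O := by
    intro u hu
    obtain ⟨p, hp, hpc, hp0⟩ := hR4 u
    have hc : ∀ n, ∃ k ∈ O, (k : AlgebraicClosure ℚ) = p.coeff n := by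
      intro n
      obtain ⟨w, k, hwk⟩ := hpc n
      refine ⟨(w : K) * ((N : K)⁻¹) ^ k, O.mul_mem (intCast_mem O w) (O.pow_mem hON.2 k), ?_⟩
      have hNL : ((N : ℤ) : AlgebraicClosure ℚ) ≠ 0 := Int.cast_ne_zero.2 hP
      push_cast
      rw [← hwk, mul_assoc, ← mul_pow, mul_inv_cancel₀ hNL, one_pow, mul_one]
    have hl : p ∈ lifts (algebraMap K (AlgebraicClosure ℚ)) := by
      rw [lifts_iff_coeff_lifts]
      intro n
      obtain ⟨k, -, hk⟩ := hc n
      exact ⟨k, hk⟩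
    obtain ⟨q, hq, -, hqm⟩ := lifts_and_degree_eq_and_monic hl hp
    refine hO2 q _ hqm ?_ ?_
    · intro n
      obtain ⟨k, hk, hk2⟩ := hc n
      have : q.coeff n = k := by
        apply Subtype.ext
        rw [hk2, ← hq, coeff_map]; rfl
      rw [this]; exact hk
    · apply Subtype.ext
      have h1 := hp0
      rw [← hq, eval_map] at h1
      have h2 := hom_eval₂ q (RingHom.id K) (algebraMap K (AlgebraicClosure ℚ)) (⟨ψ u, hu⟩ : K)
      rw [RingHom.comp_id, eval₂_id] at h2
      exact h2.trans h1
  refine (hO3.image fun k : K => (k : AlgebraicClosure ℚ) * ψ δ).subset ?_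
  rintro x ⟨hxK, u, hu, hud, rfl⟩
  have inv : ∀ u : R, IsUnit u → ∀ hx : ψ u ∈ K, (⟨ψ u, hx⟩ : K) ≠ 0 ∧ (⟨ψ u, hx⟩ : K) ∈ O ∧ (⟨ψ u, hx⟩ : K)⁻¹ ∈ O := by
    intro u hu hx
    obtain ⟨v, hv⟩ := hu.exists_right_inv
    have h1 : ψ u * ψ v = 1 := by rw [← map_mul, hv, map_one]
    have h0 : ψ u ≠ 0 := left_ne_zero_of_mul (by rw [h1]; exact one_ne_zero)
    have h2 : ψ v = (ψ u)⁻¹ := eq_inv_of_mul_eq_one_right h1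
    have hvK : ψ v ∈ K := by rw [h2]; exact inv_mem hx
    refine ⟨fun h => h0 (congrArg Subtype.val h), hRO u hx, ?_⟩
    have := hRO v hvK
    convert this using 1
    exact Subtype.ext h2.symm
  have hd0 : (⟨ψ δ, hδK⟩ : K) ≠ 0 := fun h => hδu (congrArg Subtype.val h)
  have hudK : ψ (u - δ) ∈ K := by rw [map_sub]; exact sub_mem hxK hδK
  obtain ⟨i0, i1, i2⟩ := inv u hu hxK
  obtain ⟨j0, j1, j2⟩ := inv _ hud hudK
  set d : K := ⟨ψ δ, hδK⟩ with hd
  set X' : K := ⟨ψ u, hxK⟩ with hX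
  have hsub : (⟨ψ (u - δ), hudK⟩ : K) = X' - d := Subtype.ext (map_sub ψ u δ)
  rw [hsub] at j0 j1 j2
  have hone : 1 - X' * d⁻¹ = -((X' - d) * d⁻¹) := by
    rw [sub_mul, mul_inv_cancel₀ hd0]; ring
  refine ⟨X' * d⁻¹, ⟨mul_ne_zero i0 (inv_ne_zero hd0), ?_, O.mul_mem i1 hOδ.2, ?_, ?_, ?_⟩, ?_⟩
  · rw [hone]; exact neg_ne_zero.2 (mul_ne_zero j0 (inv_ne_zero hd0))
  · rw [mul_inv, inv_inv]; exact O.mul_mem i2 hOδ.1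
  · rw [hone]; exact O.neg_mem (O.mul_mem j1 hOδ.2)
  · rw [hone, inv_neg, mul_inv, inv_inv]; exact O.neg_mem (O.mul_mem j2 hOδ.1)
  · change ψ u * (ψ δ)⁻¹ * ψ δ = ψ u
    rw [mul_assoc, inv_mul_cancel₀ hδu, mul_one]

end SpecSection2


section LinSection

/-- solutions in the doubly linear normal form -/
def LS (a b : ℂ) (c : ℂ[X]) (m n : ℕ) (l : ℂ) : Prop :=
  1 ≤ m ∧ 1 ≤ n ∧ a ^ m * l = c.eval l ∧ b ^ n * (l - 1) + 1 = c.eval l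

theorem LS_swap {a b : ℂ} {c : ℂ[X]} {m n : ℕ} {l : ℂ} (h : LS a b c m n l) :
    LS b a (1 - c.comp (1 - X)) n m (1 - l) := by
  obtain ⟨h1, h2, h3, h4⟩ := h
  refine ⟨h2, h1, ?_, ?_⟩
  · simp; linear_combination -h4
  · simp; linear_combination -h3

theorem pow_inj_of {L : Type*} [Field L] (x : L) (hx0 : x ≠ 0) (hx : ∀ k, 1 ≤ k → x ^ k ≠ 1) :
    Function.Injective fun k : ℕ => x ^ k := by
  have key : ∀ m n : ℕ, m < n → x ^ m ≠ x ^ n := by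
    intro m n hmn h
    apply hx (n - m) (by omega)
    have : x ^ n = x ^ m * x ^ (n - m) := by rw [← pow_add]; congr 1; omega
    rw [this] at h
    exact (mul_left_cancel₀ (pow_ne_zero m hx0) (by rw [mul_one]; exact h)).symm
  intro m n h
  rcases lt_trichotomy m n with h1 | h1 | h1
  · exact absurd h (key m n h1)
  · exact h1
  · exact absurd h.symm (key n m h1)

theorem eval_mem_ring (R : Subring ℂ) (q : ℂ[X]) (hq : ∀ i, q.coeff i ∈ R) (l : ℂ) (hl : l ∈ R) :
    q.eval l ∈ R := by
  rw [eval_eq_sum_range]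
  exact R.sum_mem fun i _ => R.mul_mem (hq i) (R.pow_mem hl i)

theorem isUnit_ring (R : Subring ℂ) (x : R) (h0 : x.1 ≠ 0) (h : x.1⁻¹ ∈ R) : IsUnit x := by
  refine IsUnit.of_mul_eq_one ⟨_, h⟩ ?_
  exact Subtype.ext (mul_inv_cancel₀ h0)

theorem two_units (a b : ℂ) (c : ℂ[X]) (ha0 : a ≠ 0)
    (ha1 : ∀ k, 1 ≤ k → a ^ k ≠ 1) (hb1 : ∀ k, 1 ≤ k → b ^ k ≠ 1) (r r' : ℂ) (hr : r ≠ r')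
    (Y : Set ℂ) (hY : Y.Finite) :
    ∃ R : Subring ℂ, (∀ y ∈ Y, y ∈ R ∧ y⁻¹ ∈ R) ∧ (a ∈ R ∧ a⁻¹ ∈ R) ∧ (b ∈ R ∧ b⁻¹ ∈ R) ∧
      (∀ i, c.coeff i ∈ R) ∧ (c.leadingCoeff⁻¹ ∈ R) ∧
      (∀ (p : ℂ[X]) (z : ℂ), p.Monic → (∀ i, p.coeff i ∈ R) → p.eval z = 0 → z ∈ R) ∧
      {m | ∃ n l, LS a b c m n l ∧ l ∈ R ∧ (l - r ≠ 0 ∧ (l - r)⁻¹ ∈ R) ∧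
        (l - r' ≠ 0 ∧ (l - r')⁻¹ ∈ R)}.Finite := by
  set Y0 : Set ℂ := Y ∪ {a, b, r, r' - r} ∪ Set.range c.coeff with hY0
  have hY0f : Y0.Finite := (hY.union (by simp)).union (range_coeff_finite c)
  set Z : Set ℂ := Y0 ∪ Inv.inv '' Y0 with hZ
  have hZf : Z.Finite := hY0f.union (hY0f.image _)
  have hYZ : ∀ y ∈ Y0, y ∈ Z := fun y hy => Or.inl hy
  have hYZ' : ∀ y ∈ Y0, y⁻¹ ∈ Z := fun y hy => Or.inr ⟨y, hy, rfl⟩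
  have ya : a ∈ Y0 := Or.inl (Or.inr (by simp))
  have yb : b ∈ Y0 := Or.inl (Or.inr (by simp))
  have yr : r ∈ Y0 := Or.inl (Or.inr (by simp))
  have yd : r' - r ∈ Y0 := Or.inl (Or.inr (by simp))
  have yc : ∀ i, c.coeff i ∈ Y0 := fun i => Or.inr ⟨i, rfl⟩
  obtain ⟨R, ψ, hR1, hR2, hR3, hR4, hR5⟩ := spec Z hZf a b (hYZ a ya) (hYZ b yb) ha1 hb1
  have hm : ∀ y ∈ Y0, y ∈ R ∧ y⁻¹ ∈ R := fun y hy => ⟨hR1 _ (hYZ y hy), hR1 _ (hYZ' y hy)⟩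
  refine ⟨R, fun y hy => hm y (Or.inl (Or.inl hy)), hm a ya, hm b yb, fun i => (hm _ (yc i)).1,
    (hm _ (yc _)).2, hR2, ?_⟩
  have hd0 : r' - r ≠ 0 := sub_ne_zero.2 hr.symm
  have hfin := hR5 ⟨r' - r, (hm _ yd).1⟩ (fun h => hd0 (congrArg Subtype.val h)) (hYZ _ yd) (hYZ' _ yd)
  set K := IntermediateField.adjoin ℚ {z | ∃ y : R, y.1 ∈ Z ∧ ψ y = z} with hK
  set A : R := ⟨a, (hm a ya).1⟩ with hA
  set B : R := ⟨b, (hm b yb).1⟩ with hB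
  set r0 : R := ⟨r, (hm r yr).1⟩ with hr0
  have hAK : ψ A ∈ K := IntermediateField.subset_adjoin _ _ ⟨A, hYZ a ya, rfl⟩
  have hBK : ψ B ∈ K := IntermediateField.subset_adjoin _ _ ⟨B, hYZ b yb, rfl⟩
  have hrK : ψ r0 ∈ K := IntermediateField.subset_adjoin _ _ ⟨r0, hYZ r yr, rfl⟩
  have hA0 : ψ A ≠ 0 := by
    have := (isUnit_ring R A ha0 (hm a ya).2).map ψ
    exact this.ne_zero
  have hAinj := pow_inj_of (ψ A) hA0 (hR3 A rfl)
  obtain ⟨cR, hcR⟩ : ∃ cR : R[X], cR.map R.subtype = c := by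
    have : c ∈ lifts R.subtype := by
      rw [lifts_iff_coeff_lifts]
      intro n
      exact ⟨⟨c.coeff n, (hm _ (yc n)).1⟩, rfl⟩
    exact this
  have hcev : ∀ x : R, c.eval x.1 = (cR.eval x : R) := by
    intro x
    rw [← hcR, eval_map]
    exact eval₂_at_apply R.subtype x
  have hcψ : ∀ x : R, ψ (cR.eval x) = (cR.map ψ).eval (ψ x) := by
    intro x
    rw [eval_map, eval₂_at_apply]
  refine Set.Finite.of_finite_image (f := fun k : ℕ => ψ A ^ k) ?_ hAinj.injOn
  refine (hfin.image fun x => (cR.map ψ).eval (x + ψ r0) / (x + ψ r0)).subset ?_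
  rintro _ ⟨m, ⟨n, l, ⟨hm1, hn1, e1, e2⟩, hl, ⟨u1, u2⟩, ⟨v1, v2⟩⟩, rfl⟩
  set lR : R := ⟨l, hl⟩ with hlR
  have E1 : A ^ m * lR = cR.eval lR := Subtype.ext (by rw [← hcev]; exact e1)
  have E2 : B ^ n * (lR - 1) + 1 = cR.eval lR := Subtype.ext (by rw [← hcev]; exact e2)
  have F1 : ψ A ^ m * ψ lR = (cR.map ψ).eval (ψ lR) := by
    rw [← hcψ, ← E1]; simp
  have F2 : ψ B ^ n * (ψ lR - 1) + 1 = (cR.map ψ).eval (ψ lR) := by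
    rw [← hcψ, ← E2]; simp
  have hBn := hR4 B rfl n hn1
  have hl0 : ψ lR ≠ 0 := by
    intro h0
    rw [h0] at F1 F2
    apply hBn
    linear_combination F1 - F2
  have hAB : ψ A ^ m - ψ B ^ n ≠ 0 := by
    intro h0
    apply hBn
    linear_combination F1 - F2 - h0 * ψ lR
  have hlK : ψ lR ∈ K := by
    have : ψ lR = (1 - ψ B ^ n) / (ψ A ^ m - ψ B ^ n) := by
      rw [eq_div_iff hAB]
      linear_combination F1 - F2
    rw [this]
    exact div_mem (sub_mem (one_mem _) (pow_mem hBK n)) (sub_mem (pow_mem hAK m) (pow_mem hBK n))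
  refine ⟨ψ (lR - r0), ⟨by rw [map_sub]; exact sub_mem hlK hrK, lR - r0, isUnit_ring R _ u1 u2, ?_, rfl⟩, ?_⟩
  · have : lR - r0 - ⟨r' - r, (hm _ yd).1⟩ = ⟨l - r', R.sub_mem hl (by
        have := R.add_mem (hm _ yd).1 (hm _ yr).1
        rwa [sub_add_cancel] at this)⟩ := by
      apply Subtype.ext
      change l - r - (r' - r) = l - r'
      ring
    rw [this]
    exact isUnit_ring R _ v1 v2
  · simp only []
    rw [map_sub, sub_add_cancel, ← F1, mul_div_assoc, div_self hl0, mul_one]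

theorem pow_unit (a b : ℂ) (ha0 : a ≠ 0) 
    (ha1 : ∀ k, 1 ≤ k → a ^ k ≠ 1) (hb1 : ∀ k, 1 ≤ k → b ^ k ≠ 1) (d : ℂ) (hd : d ≠ 0)
    (Y : Set ℂ) (hY : Y.Finite) :
    ∃ R : Subring ℂ, (∀ y ∈ Y, y ∈ R ∧ y⁻¹ ∈ R) ∧ (a ∈ R ∧ a⁻¹ ∈ R) ∧ (b ∈ R ∧ b⁻¹ ∈ R) ∧
      {m | a ^ m - d ≠ 0 ∧ (a ^ m - d)⁻¹ ∈ R}.Finite := by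
  set Y0 : Set ℂ := Y ∪ {a, b, d} with hY0
  have hY0f : Y0.Finite := (hY.union (by simp))
  set Z : Set ℂ := Y0 ∪ Inv.inv '' Y0 with hZ
  have hZf : Z.Finite := hY0f.union (hY0f.image _)
  have hYZ : ∀ y ∈ Y0, y ∈ Z := fun y hy => Or.inl hy
  have hYZ' : ∀ y ∈ Y0, y⁻¹ ∈ Z := fun y hy => Or.inr ⟨y, hy, rfl⟩
  have ya : a ∈ Y0 := (Or.inr (by simp))
  have yb : b ∈ Y0 := (Or.inr (by simp))
  have yd : d ∈ Y0 := (Or.inr (by simp))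
  obtain ⟨R, ψ, hR1, hR2, hR3, hR4, hR5⟩ := spec Z hZf a b (hYZ a ya) (hYZ b yb) ha1 hb1
  have hm : ∀ y ∈ Y0, y ∈ R ∧ y⁻¹ ∈ R := fun y hy => ⟨hR1 _ (hYZ y hy), hR1 _ (hYZ' y hy)⟩
  refine ⟨R, fun y hy => hm y (Or.inl hy), hm a ya, hm b yb, ?_⟩
  have hfin := hR5 ⟨d, (hm _ yd).1⟩ (fun h => hd (congrArg Subtype.val h)) (hYZ _ yd) (hYZ' _ yd)
  set A : R := ⟨a, (hm a ya).1⟩ with hA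
  have hA0 : ψ A ≠ 0 := by
    have := (isUnit_ring R A ha0 (hm a ya).2).map ψ
    exact this.ne_zero
  have hAinj := pow_inj_of (ψ A) hA0 (hR3 A rfl)
  refine Set.Finite.of_finite_image (f := fun k : ℕ => ψ A ^ k) ?_ hAinj.injOn
  refine hfin.subset ?_
  rintro _ ⟨m, ⟨h1, h2⟩, rfl⟩
  have hAK : ψ A ∈ IntermediateField.adjoin ℚ {z | ∃ y : R, y.1 ∈ Z ∧ ψ y = z} :=
    IntermediateField.subset_adjoin _ _ ⟨A, hYZ a ya, rfl⟩
  refine ⟨pow_mem hAK m, A ^ m,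
    (isUnit_ring R A ha0 (hm a ya).2).pow m, isUnit_ring R _ h1 h2, map_pow _ _ _⟩

theorem l_mem (R : Subring ℂ) (a : ℂ) (ha : a ∈ R) (c : ℂ[X]) (hc : 2 ≤ c.natDegree) (hcR : ∀ i, c.coeff i ∈ R)
    (hlc : c.leadingCoeff⁻¹ ∈ R)
    (hR : ∀ (p : ℂ[X]) (z : ℂ), p.Monic → (∀ i, p.coeff i ∈ R) → p.eval z = 0 → z ∈ R)
    (m : ℕ) (l : ℂ) (h : a ^ m * l = c.eval l) : l ∈ R := by
  have hc0 : c.leadingCoeff ≠ 0 := by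
    rw [Ne, leadingCoeff_eq_zero]; rintro rfl; simp at hc
  refine hR (C c.leadingCoeff⁻¹ * (c - C (a ^ m) * X)) l ?_ ?_ ?_
  · have h1 : (C (a ^ m) * X : ℂ[X]).degree < c.degree := by
      refine (degree_C_mul_X_le _).trans_lt ?_
      rw [degree_eq_natDegree (fun h => by rw [h] at hc; simp at hc)]
      exact_mod_cast hc
    rw [Monic, leadingCoeff_mul, leadingCoeff_C, leadingCoeff_sub_of_degree_lt h1, inv_mul_cancel₀ hc0]
  · intro i
    rw [coeff_C_mul, coeff_sub, coeff_C_mul, coeff_X]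
    refine R.mul_mem hlc (R.sub_mem (hcR i) (R.mul_mem (R.pow_mem ha m) ?_))
    split_ifs
    · exact R.one_mem
    · exact R.zero_mem
  · simp [h]

end LinSection


section LinSection2

variable {a b : ℂ} {c : ℂ[X]}

theorem lin_A (ha0 : a ≠ 0) (ha1 : ∀ k, 1 ≤ k → a ^ k ≠ 1) (hb1 : ∀ k, 1 ≤ k → b ^ k ≠ 1)
    (hc : 2 ≤ c.natDegree) (hc0 : c.eval 0 ≠ 0) : {m | ∃ n l, LS a b c m n l}.Finite := by
  obtain ⟨ρ, hρ⟩ := IsAlgClosed.exists_root c (by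
    intro h; rw [degree_eq_natDegree (by rintro rfl; simp at hc0)] at h
    have : c.natDegree = 0 := by exact_mod_cast h
    omega)
  have hρ0 : ρ ≠ 0 := by rintro rfl; exact hc0 hρ
  obtain ⟨q, hq⟩ := dvd_iff_isRoot.2 hρ
  obtain ⟨R, hRY, hRa, hRb, hRc, hRl, hRi, hfin⟩ := two_units a b c ha0 ha1 hb1 0 ρ hρ0.symm
    (Set.range q.coeff ∪ Set.range c.divX.coeff ∪ {c.coeff 0, ρ})
    (((range_coeff_finite q).union (range_coeff_finite _)).union (by simp))
  refine hfin.subset ?_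
  rintro m ⟨n, l, h⟩
  obtain ⟨h1, h2, h3, h4⟩ := h
  have hl : l ∈ R := l_mem R a hRa.1 c hc hRc hRl hRi m l h3
  have hqR : q.eval l ∈ R := eval_mem_ring R q (fun i => (hRY _ (Or.inl (Or.inl ⟨i, rfl⟩))).1) l hl
  have hdR : c.divX.eval l ∈ R := eval_mem_ring R _ (fun i => (hRY _ (Or.inl (Or.inr ⟨i, rfl⟩))).1) l hl
  have hl0 : l ≠ 0 := by rintro rfl; exact hc0 (by rw [← h3, mul_zero])
  have hc0' : c.coeff 0 ≠ 0 := by rwa [coeff_zero_eq_eval_zero]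
  have e1 : c.eval l = c.divX.eval l * l + c.coeff 0 := by
    conv_lhs => rw [← divX_mul_X_add c]
    simp
  have e2 : c.eval l = (l - ρ) * q.eval l := by
    conv_lhs => rw [hq]
    simp
  have ham : a ^ m ≠ 0 := pow_ne_zero m ha0
  have hmR : (a ^ m)⁻¹ ∈ R := by rw [← inv_pow]; exact R.pow_mem hRa.2 m
  have hlR : l⁻¹ ∈ R := by
    have : l⁻¹ = (a ^ m - c.divX.eval l) * (c.coeff 0)⁻¹ := by
      apply inv_eq_of_mul_eq_one_right
      rw [← mul_assoc, show l * (a ^ m - c.divX.eval l) = c.coeff 0 by linear_combination e1 + h3]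
      exact mul_inv_cancel₀ hc0'
    rw [this]
    exact R.mul_mem (R.sub_mem (R.pow_mem hRa.1 m) hdR) (hRY _ (Or.inr (by simp))).2
  have e3 : (l - ρ) * (q.eval l * ((a ^ m)⁻¹ * l⁻¹)) = 1 := by
    rw [← mul_assoc, ← e2, ← h3, ← mul_inv]
    exact mul_inv_cancel₀ (mul_ne_zero ham hl0)
  refine ⟨n, l, ⟨h1, h2, h3, h4⟩, hl, ⟨by simpa using hl0, by simpa using hlR⟩, ?_, ?_⟩
  · exact left_ne_zero_of_mul (by rw [e3]; exact one_ne_zero)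
  · rw [← eq_inv_of_mul_eq_one_right e3]
    exact R.mul_mem hqR (R.mul_mem hmR hlR)

theorem lin_C (ha0 : a ≠ 0) (hb0 : b ≠ 0) (ha1 : ∀ k, 1 ≤ k → a ^ k ≠ 1) (hb1 : ∀ k, 1 ≤ k → b ^ k ≠ 1)
    (hc : 2 ≤ c.natDegree) (hc0 : c.eval 0 = 0) (hc1 : c.eval 1 = 1) :
    {m | ∃ n l, LS a b c m n l}.Finite := by
  have hroot : ∀ k : ℂ[X], 1 ≤ k.natDegree → ∃ r, k.eval r = 0 := by
    intro k hk
    exact IsAlgClosed.exists_root k (by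
      intro h; rw [degree_eq_natDegree (by rintro rfl; simp at hk)] at h
      have : k.natDegree = 0 := by exact_mod_cast h
      omega)
  obtain ⟨k, hk⟩ := dvd_iff_isRoot.2 (show IsRoot c 0 from hc0)
  rw [C_0, sub_zero] at hk
  have hkd : 1 ≤ k.natDegree := by
    have := congrArg natDegree hk
    have h2 := natDegree_mul_le (p := (X : ℂ[X])) (q := k)
    rw [natDegree_X] at h2
    omega
  obtain ⟨j, hj⟩ := dvd_iff_isRoot.2 (show IsRoot (c - 1) 1 by simp [hc1])
  have hjd : 1 ≤ j.natDegree := by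
    have := congrArg natDegree hj
    have h2 := natDegree_mul_le (p := (X - C 1 : ℂ[X])) (q := j)
    rw [natDegree_X_sub_C] at h2
    have h3 : (c - 1).natDegree = c.natDegree := natDegree_sub_C (a := 1)
    omega
  obtain ⟨r, hr⟩ := hroot k hkd
  obtain ⟨ρ, hρ⟩ := hroot j hjd
  obtain ⟨k2, hk2⟩ := dvd_iff_isRoot.2 (show IsRoot k r from hr)
  obtain ⟨j2, hj2⟩ := dvd_iff_isRoot.2 (show IsRoot j ρ from hρ)
  have ck : ∀ x, c.eval x = x * k.eval x := fun x => by conv_lhs => rw [hk]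
                                                        simp
  have cj : ∀ x, c.eval x - 1 = (x - 1) * j.eval x := fun x => by
    have := congrArg (eval x) hj
    simpa using this
  have kk : ∀ x, k.eval x = (x - r) * k2.eval x := fun x => by conv_lhs => rw [hk2]
                                                               simp
  have jj : ∀ x, j.eval x = (x - ρ) * j2.eval x := fun x => by conv_lhs => rw [hj2]
                                                               simp
  have hne : r ≠ ρ := by
    rintro rfl
    have h1 := ck r
    have h2 := cj r
    rw [hr, mul_zero] at h1
    rw [hρ, h1] at h2
    norm_num at h2
  obtain ⟨R, hRY, hRa, hRb, hRc, hRl, hRi, hfin⟩ := two_units a b c ha0 ha1 hb1 r ρ hne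
    (Set.range k2.coeff ∪ Set.range j2.coeff)
    ((range_coeff_finite _).union (range_coeff_finite _))
  refine hfin.subset ?_
  rintro m ⟨n, l, h⟩
  obtain ⟨h1, h2, h3, h4⟩ := h
  have hl : l ∈ R := l_mem R a hRa.1 c hc hRc hRl hRi m l h3
  have hkR : k2.eval l ∈ R := eval_mem_ring R _ (fun i => (hRY _ (Or.inl ⟨i, rfl⟩)).1) l hl
  have hjR : j2.eval l ∈ R := eval_mem_ring R _ (fun i => (hRY _ (Or.inr ⟨i, rfl⟩)).1) l hl
  have hl0 : l ≠ 0 := by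
    rintro rfl
    apply hb1 n h2
    rw [hc0] at h4
    linear_combination -h4
  have hl1 : l - 1 ≠ 0 := by
    intro h0
    have : l = 1 := by linear_combination h0
    rw [this, hc1, mul_one] at h3
    exact ha1 m h1 h3
  have ham : a ^ m ≠ 0 := pow_ne_zero m ha0
  have hbn : b ^ n ≠ 0 := pow_ne_zero n hb0
  have hmR : (a ^ m)⁻¹ ∈ R := by rw [← inv_pow]; exact R.pow_mem hRa.2 m
  have hnR : (b ^ n)⁻¹ ∈ R := by rw [← inv_pow]; exact R.pow_mem hRb.2 n
  have e1 : a ^ m = (l - r) * k2.eval l := by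
    apply mul_right_cancel₀ hl0
    rw [h3, ck, kk]; ring
  have e2 : b ^ n = (l - ρ) * j2.eval l := by
    apply mul_right_cancel₀ hl1
    have := cj l
    rw [jj] at this
    linear_combination h4 + this
  have e3 : (l - r) * (k2.eval l * (a ^ m)⁻¹) = 1 := by
    rw [← mul_assoc, ← e1]; exact mul_inv_cancel₀ ham
  have e4 : (l - ρ) * (j2.eval l * (b ^ n)⁻¹) = 1 := by
    rw [← mul_assoc, ← e2]; exact mul_inv_cancel₀ hbn
  refine ⟨n, l, ⟨h1, h2, h3, h4⟩, hl, ⟨?_, ?_⟩, ?_, ?_⟩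
  · exact left_ne_zero_of_mul (by rw [e3]; exact one_ne_zero)
  · rw [← eq_inv_of_mul_eq_one_right e3]
    exact R.mul_mem hkR hmR
  · exact left_ne_zero_of_mul (by rw [e4]; exact one_ne_zero)
  · rw [← eq_inv_of_mul_eq_one_right e4]
    exact R.mul_mem hjR hnR

theorem lin_0 (ha0 : a ≠ 0) (hb0 : b ≠ 0) (ha1 : ∀ k, 1 ≤ k → a ^ k ≠ 1) (hb1 : ∀ k, 1 ≤ k → b ^ k ≠ 1)
    (κ : ℂ) (hκ0 : κ ≠ 0) (hκ1 : κ ≠ 1) :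
    {m | ∃ n l, LS a b (C κ) m n l}.Finite := by
  obtain ⟨R, hRY, hRa, hRb, hRc, hRl, hRi, hfin⟩ := two_units a b (C κ) ha0 ha1 hb1 0 1 zero_ne_one
    {κ, κ - 1} (by simp)
  refine hfin.subset ?_
  rintro m ⟨n, l, h⟩
  obtain ⟨h1, h2, h3, h4⟩ := h
  rw [eval_C] at h3 h4
  have ham : a ^ m ≠ 0 := pow_ne_zero m ha0
  have hbn : b ^ n ≠ 0 := pow_ne_zero n hb0
  have hκ2 : κ - 1 ≠ 0 := sub_ne_zero.2 hκ1
  have hmR : (a ^ m)⁻¹ ∈ R := by rw [← inv_pow]; exact R.pow_mem hRa.2 m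
  have e1 : l * (a ^ m * κ⁻¹) = 1 := by
    rw [← mul_assoc, mul_comm l, h3, mul_inv_cancel₀ hκ0]
  have e2 : (l - 1) * (b ^ n * (κ - 1)⁻¹) = 1 := by
    rw [← mul_assoc, mul_comm (l - 1), show b ^ n * (l - 1) = κ - 1 by linear_combination h4, mul_inv_cancel₀ hκ2]
  have hl : l ∈ R := by
    have : l = κ * (a ^ m)⁻¹ := by rw [← div_eq_mul_inv, eq_div_iff ham, ← h3]; ring
    rw [this]
    exact R.mul_mem (hRY _ (by simp)).1 hmR
  refine ⟨n, l, ⟨h1, h2, by rw [eval_C]; exact h3, by rw [eval_C]; exact h4⟩, hl, ⟨?_, ?_⟩, ?_, ?_⟩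
  · rw [sub_zero]; exact left_ne_zero_of_mul (by rw [e1]; exact one_ne_zero)
  · rw [sub_zero, ← eq_inv_of_mul_eq_one_right e1]
    exact R.mul_mem (R.pow_mem hRa.1 m) (hRY _ (by simp)).2
  · exact left_ne_zero_of_mul (by rw [e2]; exact one_ne_zero)
  · rw [← eq_inv_of_mul_eq_one_right e2]
    exact R.mul_mem (R.pow_mem hRb.1 n) (hRY _ (by simp)).2

theorem lin_1 (ha0 : a ≠ 0) (ha1 : ∀ k, 1 ≤ k → a ^ k ≠ 1) (hb1 : ∀ k, 1 ≤ k → b ^ k ≠ 1)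
    (α γ : ℂ) (hγ : γ ≠ 0) (hγ' : 1 - α - γ ≠ 0) (hαγ : α + γ ≠ 0) :
    {m | ∃ n l, LS a b (C α * X + C γ) m n l}.Finite := by
  obtain ⟨R, hRY, hRa, hRb, hfin⟩ := pow_unit a b ha0 ha1 hb1 (α + γ) hαγ
    {γ, 1 - α - γ, -1} (by simp)
  refine hfin.subset ?_
  rintro m ⟨n, l, h⟩
  obtain ⟨h1, h2, h3, h4⟩ := h
  simp only [eval_add, eval_mul, eval_C, eval_X] at h3 h4
  have key : (a ^ m - (α + γ)) * (1 - γ - b ^ n) = - (γ * (1 - α - γ)) := by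
    have i1 : (a ^ m - α) * l = γ := by linear_combination h3
    have i2 : (b ^ n - α) * (l - 1) = α + γ - 1 := by linear_combination h4
    linear_combination (-(b ^ n - α)) * i1 + (a ^ m - α) * i2
  have e : (a ^ m - (α + γ)) * ((1 - γ - b ^ n) * (-1 * γ⁻¹ * (1 - α - γ)⁻¹)) = 1 := by
    rw [← mul_assoc, key]
    field_simp
  refine ⟨left_ne_zero_of_mul (by rw [e]; exact one_ne_zero), ?_⟩
  rw [← eq_inv_of_mul_eq_one_right e]
  have m1 := (hRY γ (by simp))
  have m2 := (hRY (1 - α - γ) (by simp))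
  exact R.mul_mem (R.sub_mem (R.sub_mem R.one_mem m1.1) (R.pow_mem hRb.1 n))
    (R.mul_mem (R.mul_mem (R.neg_mem R.one_mem) m1.2) m2.2)

theorem lin_fin (ha0 : a ≠ 0) (hb0 : b ≠ 0) (ha1 : ∀ k, 1 ≤ k → a ^ k ≠ 1) (hb1 : ∀ k, 1 ≤ k → b ^ k ≠ 1)
    (hf : ∀ m, 1 ≤ m → {l | a ^ m * l = c.eval l}.Finite)
    (hg : ∀ n, 1 ≤ n → {l | b ^ n * (l - 1) + 1 = c.eval l}.Finite)
    (hab : ∀ m n, 1 ≤ m → 1 ≤ n → a ^ m * b ^ n ≠ 1) :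
    {l | ∃ m n, LS a b c m n l}.Finite := by
  have hM : {m | ∃ n l, LS a b c m n l}.Finite → {l | ∃ m n, LS a b c m n l}.Finite := by
    intro h
    refine (h.biUnion (t := fun m => {l | 1 ≤ m ∧ a ^ m * l = c.eval l}) fun m hm => ?_).subset ?_
    · obtain ⟨n, l, h1, -⟩ := hm
      exact (hf m h1).subset fun l hl => hl.2
    · rintro l ⟨m, n, h⟩
      exact Set.mem_biUnion (x := m) ⟨n, l, h⟩ ⟨h.1, h.2.2.1⟩
  have hN : {m | ∃ n l, LS b a (1 - c.comp (1 - X)) m n l}.Finite → {l | ∃ m n, LS a b c m n l}.Finite := by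
    intro h
    refine (h.biUnion (t := fun n => {l | 1 ≤ n ∧ b ^ n * (l - 1) + 1 = c.eval l}) fun n hn => ?_).subset ?_
    · obtain ⟨n, l, h1, -⟩ := hn
      exact (hg _ h1).subset fun l hl => hl.2
    · rintro l ⟨m, n, h⟩
      exact Set.mem_biUnion (x := n) ⟨m, 1 - l, LS_swap h⟩ ⟨h.2.1, h.2.2.2⟩
  rcases Nat.lt_or_ge c.natDegree 2 with hd | hd
  · obtain ⟨α, γ, rfl⟩ : ∃ α γ, c = C α * X + C γ := exists_eq_X_add_C_of_natDegree_le_one (by omega)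
    by_cases hα : α = 0
    · subst hα
      have hcc : (C (0:ℂ) * X + C γ : ℂ[X]) = C γ := by simp
      rw [hcc] at hM ⊢
      by_cases h0 : γ = 0
      · refine (Set.finite_singleton (0:ℂ)).subset ?_
        rintro l ⟨m, n, h⟩
        have := h.2.2.1
        rw [eval_C, h0] at this
        exact (mul_eq_zero.1 this).resolve_left (pow_ne_zero m ha0)
      by_cases h1 : γ = 1
      · refine (Set.finite_singleton (1:ℂ)).subset ?_
        rintro l ⟨m, n, h⟩
        have := h.2.2.2
        rw [eval_C, h1] at this
        have h2 : b ^ n * (l - 1) = 0 := by linear_combination this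
        exact sub_eq_zero.1 ((mul_eq_zero.1 h2).resolve_left (pow_ne_zero n hb0))
      exact hM (lin_0 ha0 hb0 ha1 hb1 γ h0 h1)
    · have empty : (∀ m n l, ¬ LS a b (C α * X + C γ) m n l) → {l | ∃ m n, LS a b (C α * X + C γ) m n l}.Finite := by
        intro h
        convert Set.finite_empty
        ext l
        simp only [Set.mem_setOf_eq, Set.mem_empty_iff_false, iff_false]
        rintro ⟨m, n, h'⟩
        exact h m n l h'
      by_cases hγ : γ = 0
      · apply empty
        rintro m n l ⟨h1, h2, h3, h4⟩
        have hl0 : l ≠ 0 := by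
          rintro rfl
          apply hb1 n h2
          simp [hγ] at h4
          linear_combination -h4
        have : a ^ m = α := by
          apply mul_right_cancel₀ hl0
          rw [h3, hγ]; simp
        refine Set.infinite_univ (α := ℂ) ((hf m h1).subset fun l _ => ?_)
        simp [this, hγ]
      by_cases hγ' : 1 - α - γ = 0
      · apply empty
        rintro m n l ⟨h1, h2, h3, h4⟩
        simp only [eval_add, eval_mul, eval_C, eval_X] at h3 h4
        have hl0 : l - 1 ≠ 0 := by
          intro h0
          apply ha1 m h1
          have : l = 1 := by linear_combination h0
          rw [this] at h3
          linear_combination h3 - hγ'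
        have : b ^ n = α := by
          apply mul_right_cancel₀ hl0
          linear_combination h4 - hγ'
        refine Set.infinite_univ (α := ℂ) ((hg n h2).subset fun l _ => ?_)
        simp [this]
        linear_combination hγ'
      by_cases hαγ : α + γ = 0
      · by_cases h1 : 1 - γ = 0
        · apply empty
          rintro m n l ⟨h1', h2, h3, h4⟩
          have e1 : γ = 1 := by linear_combination -h1
          have e2 : α = -1 := by linear_combination hαγ - e1
          simp only [eval_add, eval_mul, eval_C, eval_X, e1, e2] at h3 h4
          apply hab m n h1' h2
          have i1 : (a ^ m + 1) * l = 1 := by linear_combination h3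
          have i2 : (b ^ n + 1) * (l - 1) = -1 := by linear_combination h4
          linear_combination (b ^ n + 1) * i1 - (a ^ m + 1) * i2
        · apply hN
          have : (1 - (C α * X + C γ : ℂ[X]).comp (1 - X)) = C α * X + C (1 - α - γ) := by
            simp; ring
          rw [this]
          exact lin_1 hb0 hb1 ha1 α _ hγ' (by intro h; apply hγ; linear_combination h) (by intro h; apply h1; linear_combination h)
      · exact hM (lin_1 ha0 ha1 hb1 α γ hγ hγ' hαγ)
  · by_cases h0 : c.eval 0 = 0
    · by_cases h1 : c.eval 1 = 1
      · exact hM (lin_C ha0 hb0 ha1 hb1 hd h0 h1)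
      · apply hN
        have hx : (1 - X : ℂ[X]).natDegree = 1 := by
          rw [← neg_sub, natDegree_neg]; exact natDegree_X_sub_C 1
        refine lin_A hb0 hb1 ha1 ?_ ?_
        · rw [← neg_sub, natDegree_neg, ← C_1, natDegree_sub_C, C_1, natDegree_comp, hx, mul_one]
          exact hd
        · simp
          intro h
          apply h1
          linear_combination -h
    · exact hM (lin_A ha0 ha1 hb1 hd h0)

end LinSection2


section TransSection

/-- words realizing nonnegative integer polynomials -/
def Wp (p : ℕ → ℕ) : ℕ → List Bool
  | 0 => []
  | n + 1 => Wp p n ++ (List.replicate (p n) true ++ [false])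

theorem wd_Wp (b : ℂ) (p : ℕ → ℕ) (n : ℕ) (x : ℂ) :
    wd (X + 1) (C b * X) (Wp p n) x = b ^ n * x + ∑ j ∈ Finset.range n, (p j : ℂ) * b ^ j := by
  have it : ∀ (k : ℕ) (y : ℂ), (fun x => (X + 1 : ℂ[X]).eval x)^[k] y = y + k := by
    intro k
    induction k with
    | zero => intro y; simp
    | succ k ih => intro y; rw [Function.iterate_succ_apply', ih]; simp; ring
  induction n generalizing x with
  | zero => simp [Wp, wd_nil]
  | succ n ih =>
    rw [Wp, wd_append, Function.comp_apply, ih, wd_append, Function.comp_apply, wd_rep_true, it,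
      Finset.sum_range_succ]
    simp [wd_false, wd_nil]
    ring

theorem trans_alg (b : ℂ) (c : ℂ[X]) (h : Hyp (X + 1) (C b * X) c) : Transcendental ℤ b := by
  rintro ⟨P, hP, hP0⟩
  set n := P.natDegree + 1 with hn
  set p : ℕ → ℕ := fun j => (P.coeff j).toNat with hp
  set q : ℕ → ℕ := fun j => (-P.coeff j).toNat with hq
  have hne : ∀ r : ℕ → ℕ, Wp r n ≠ [] := by
    intro r
    rw [hn, Wp]; simp
  have hsum : ∀ y : ℂ, ∑ j ∈ Finset.range n, (p j : ℂ) * y ^ j - ∑ j ∈ Finset.range n, (q j : ℂ) * y ^ j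
      = aeval y P := by
    intro y
    rw [aeval_eq_sum_range, ← Finset.sum_sub_distrib]
    refine Finset.sum_congr rfl fun j _ => ?_
    rw [← sub_mul, zsmul_eq_mul]
    congr 1
    have : ((p j : ℤ) - (q j : ℤ)) = P.coeff j := by
      simp only [hp, hq]; omega
    rw [← this]; push_cast; rfl
  refine h.free (Wp p n) (Wp q n) (hne p) (hne q) ?_ ?_
  · intro heq
    have hz : (P.map (algebraMap ℤ ℂ)) = 0 := by
      apply Polynomial.funext
      intro y
      have h1 := wd_Wp y p n 0
      rw [heq, wd_Wp y q n 0] at h1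
      have h2 := hsum y
      rw [eval_map_algebraMap, ← h2, eval_zero]
      linear_combination -h1
    exact hP ((Polynomial.map_eq_zero_iff (algebraMap ℤ ℂ).injective_int).1 hz)
  · funext x
    rw [wd_Wp, wd_Wp]
    have h2 := hsum b
    rw [hP0] at h2
    linear_combination h2

theorem hom_to (b b' : ℂ) (hb : Transcendental ℤ b) (hb' : Transcendental ℤ b') :
    ∃ φ : ℂ →+* ℂ, φ b = b' := by
  have i1 : Function.Injective (aeval b : ℤ[X] →ₐ[ℤ] ℂ).toRingHom := transcendental_iff_injective.1 hb
  have i2 : Function.Injective (aeval b' : ℤ[X] →ₐ[ℤ] ℂ).toRingHom := transcendental_iff_injective.1 hb'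
  haveI : Countable ℤ[X] := by
    apply Cardinal.mk_le_aleph0_iff.1
    exact Polynomial.cardinalMk_le_max.trans (by simp)
  haveI : Countable (FractionRing ℤ[X]) := by
    apply Cardinal.mk_le_aleph0_iff.1
    rw [Cardinal.mk_fractionRing]
    exact Cardinal.mk_le_aleph0_iff.2 inferInstance
  obtain ⟨φ, hφ⟩ := kl_exists_hom (E := FractionRing ℤ[X]) (IsFractionRing.lift i1) (IsFractionRing.lift i2)
  refine ⟨φ, ?_⟩
  have := congrArg (fun r => r (algebraMap ℤ[X] (FractionRing ℤ[X]) X)) hφ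
  simpa using this

theorem trans_big (b : ℂ) (c : ℂ[X]) (h : Hyp (X + 1) (C b * X) c)
    (hinf : ¬ (SolM 1 (X + 1) (C b * X) c).Finite) (φ : ℂ →+* ℂ) (R : ℝ) (N : ℕ) :
    ∃ (l : ℂ) (n : ℕ), R < ‖l‖ ∧ N < n ∧ φ b ^ n * l = (c.map φ).eval l := by
  by_contra hcon
  push Not at hcon
  apply hinf
  have it : ∀ (k : ℕ) (y : ℂ), (fun x => (X + 1 : ℂ[X]).eval x)^[k] y = y + k := by
    intro k
    induction k with
    | zero => intro y; simp
    | succ k ih => intro y; rw [Function.iterate_succ_apply', ih]; simp; ring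
  have it2 : ∀ (k : ℕ) (y : ℂ), (fun x => (C b * X : ℂ[X]).eval x)^[k] y = b ^ k * y := by
    intro k
    induction k with
    | zero => intro y; simp
    | succ k ih => intro y; rw [Function.iterate_succ_apply', ih]; simp; ring
  have ev : ∀ x, φ (c.eval x) = (c.map φ).eval (φ x) := fun x => by rw [eval_map, eval₂_at_apply]
  obtain ⟨B, hB⟩ := (isCompact_closedBall (0:ℂ) R).exists_bound_of_continuousOn
    (f := fun x => (c.map φ).eval x - x) (by fun_prop)
  obtain ⟨M, hM⟩ := exists_nat_gt B
  have h1 : (⋃ m ∈ Set.Icc 1 M, {l : ℂ | (fun x => (X + 1 : ℂ[X]).eval x)^[m] l = c.eval l}).Finite :=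
    (Set.finite_Icc 1 M).biUnion fun m hm => h.fin_f m hm.1
  have h2 : (⋃ m ∈ Set.Icc 1 N, {l : ℂ | (fun x => (C b * X : ℂ[X]).eval x)^[m] l = c.eval l}).Finite :=
    (Set.finite_Icc 1 N).biUnion fun m hm => h.fin_g m hm.1
  refine (h1.union h2).subset ?_
  rintro l ⟨m, n, hm, hn, h3, h4⟩
  by_cases hnN : n ≤ N
  · exact Or.inr (Set.mem_biUnion (x := n) ⟨hn, hnN⟩ h4)
  by_cases hl : ‖φ l‖ ≤ R
  · refine Or.inl (Set.mem_biUnion (x := m) ⟨hm, ?_⟩ h3)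
    rw [it] at h3
    have := hB (φ l) (by simpa using hl)
    rw [← ev, ← h3] at this
    simp at this
    have : (m:ℝ) < M := this.trans_lt hM
    exact_mod_cast this.le
  · exfalso
    refine hcon (φ l) n (not_le.1 hl) (not_le.1 hnN) ?_
    rw [it2] at h4
    rw [← ev, ← h4]; simp

theorem caseTrans (b : ℂ) (c : ℂ[X]) (h : Hyp (X + 1) (C b * X) c) :
    (SolM 1 (X + 1) (C b * X) c).Finite := by
  by_contra hinf
  have hb := trans_alg b c h
  have hb0 : b ≠ 0 := by rintro rfl; exact hb isAlgebraic_zero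
  obtain ⟨k, hk⟩ := exists_nat_gt (max ‖b‖ ‖b‖⁻¹)
  have hbp : 0 < ‖b‖ := norm_pos_iff.2 hb0
  have hk1 := (le_max_left _ _).trans_lt hk
  have hk2 := (le_max_right _ _).trans_lt hk
  have hk0 : (0:ℝ) < k := hbp.trans hk1
  have hkne : (k : ℂ) ≠ 0 := by exact_mod_cast hk0.ne'
  have t1 : Transcendental ℤ ((k:ℂ) * b) := by
    intro ht
    apply hb
    have h1 : IsAlgebraic ℤ ((k:ℂ)⁻¹ * (k * b)) := ((isAlgebraic_natCast k).inv).mul ht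
    rwa [← mul_assoc, inv_mul_cancel₀ hkne, one_mul] at h1
  have t2 : Transcendental ℤ ((k:ℂ)⁻¹ * b) := by
    intro ht
    apply hb
    have h1 : IsAlgebraic ℤ ((k:ℂ) * ((k:ℂ)⁻¹ * b)) := (isAlgebraic_natCast k).mul ht
    rwa [← mul_assoc, mul_inv_cancel₀ hkne, one_mul] at h1
  have hd : 2 ≤ c.natDegree := by
    by_contra hd
    obtain ⟨φ, hφ⟩ := hom_to b _ hb t1
    have hn : 1 < ‖φ b‖ := by
      rw [hφ, norm_mul, Complex.norm_natCast]
      rwa [inv_lt_iff_one_lt_mul₀ hbp] at hk2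
    have hdc : (c.map φ).natDegree ≤ 1 := by rw [natDegree_map]; omega
    obtain ⟨α, γ, hc⟩ := exists_eq_X_add_C_of_natDegree_le_one hdc
    obtain ⟨N, hN⟩ := pow_unbounded_of_one_lt (‖α‖ + ‖γ‖) hn
    obtain ⟨l, n, h1, h2, h3⟩ := trans_big b c h hinf φ 1 N
    rw [hc] at h3
    simp only [eval_add, eval_mul, eval_C, eval_X] at h3
    have h4 : ‖φ b‖ ^ n * ‖l‖ ≤ (‖α‖ + ‖γ‖) * ‖l‖ := by
      rw [← norm_pow, ← norm_mul, h3]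
      refine (norm_add_le _ _).trans ?_
      rw [norm_mul, add_mul]
      gcongr
      exact le_mul_of_one_le_right (norm_nonneg _) h1.le
    have h5 := le_of_mul_le_mul_right h4 (by linarith)
    have h6 : ‖φ b‖ ^ N ≤ ‖φ b‖ ^ n := pow_le_pow_right₀ hn.le h2.le
    linarith
  obtain ⟨φ, hφ⟩ := hom_to b _ hb t2
  have hn : ‖φ b‖ < 1 := by
    rw [hφ, norm_mul, norm_inv, Complex.norm_natCast, inv_mul_lt_iff₀ hk0, mul_one]
    exact hk1
  set c' := c.map φ with hc'
  have hd' : 0 < c'.divX.degree := by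
    rw [← natDegree_pos_iff_degree_pos, natDegree_divX_eq_natDegree_tsub_one, hc', natDegree_map]; omega
  have ht := c'.divX.tendsto_norm_atTop hd' (l := Bornology.cobounded ℂ) (z := id) tendsto_norm_cobounded_atTop
  have he := ht.eventually_ge_atTop (‖c'.coeff 0‖ + 1)
  rw [← comap_norm_atTop, Filter.eventually_comap] at he
  obtain ⟨R, hR⟩ := Filter.eventually_atTop.1 he
  obtain ⟨l, n, h1, h2, h3⟩ := trans_big b c h hinf φ (max R 1) 0
  have h4 := hR ‖l‖ ((le_max_left _ _).trans h1.le) l rfl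
  have h5 : 1 < ‖l‖ := (le_max_right _ _).trans_lt h1
  have e1 : c'.eval l = c'.divX.eval l * l + c'.coeff 0 := by
    conv_lhs => rw [← divX_mul_X_add c']
    simp
  have h6 : ‖c'.eval l‖ < ‖l‖ := by
    rw [← h3, norm_mul, norm_pow]
    have : ‖φ b‖ ^ n < 1 := pow_lt_one₀ (norm_nonneg _) hn (by omega)
    nlinarith
  have h7 : ‖c'.divX.eval l‖ * ‖l‖ - ‖c'.coeff 0‖ ≤ ‖c'.eval l‖ := by
    rw [e1, ← norm_mul]
    have := norm_sub_norm_le (c'.divX.eval l * l) (-c'.coeff 0)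
    rwa [norm_neg, sub_neg_eq_add] at this
  simp only [id] at h4
  nlinarith [norm_nonneg (c'.coeff 0)]

end TransSection


section CaseC

theorem aff_iter (f : ℂ[X]) (a x : ℂ) (hf : ∀ z, f.eval z = a * (z - x) + x) (n : ℕ) (z : ℂ) :
    (fun y => f.eval y)^[n] z = a ^ n * (z - x) + x := by
  induction n with
  | zero => simp
  | succ n ih => rw [Function.iterate_succ_apply', ih, hf]; ring

theorem aff_not_root {f g c : ℂ[X]} (h : Hyp f g c) (a x : ℂ) (hf : ∀ z, f.eval z = a * (z - x) + x)
    (k : ℕ) (hk : 1 ≤ k) : a ^ k ≠ 1 := by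
  intro ha
  refine h.free (List.replicate (k + 1) true) (List.replicate 1 true) (by simp) (by simp) ?_ ?_
  · intro h1
    have := congrArg List.length h1
    simp at this
    omega
  · rw [wd_rep_true, wd_rep_true]
    funext z
    rw [aff_iter f a x hf, aff_iter f a x hf, pow_succ, ha, one_mul, pow_one]

theorem caseC_gen {a b : ℂ} {f g c : ℂ[X]} (h : Hyp f g c) (ha0 : a ≠ 0) (hb0 : b ≠ 0)
    (hf : ∀ z, f.eval z = a * (z - 0) + 0) (hg : ∀ z, g.eval z = b * (z - 1) + 1) :
    (SolM 1 f g c).Finite := by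
  have key : {l | ∃ m n, LS a b c m n l}.Finite := by
    refine lin_fin ha0 hb0 (aff_not_root h a 0 hf) (aff_not_root h.symm b 1 hg) ?_ ?_ ?_
    · intro m hm
      refine (h.fin_f m hm).subset ?_
      intro l hl
      simp only [Set.mem_setOf_eq] at hl ⊢
      rw [aff_iter f a 0 hf, ← hl]; ring
    · intro n hn
      refine (h.fin_g n hn).subset ?_
      intro l hl
      simp only [Set.mem_setOf_eq] at hl ⊢
      rw [aff_iter g b 1 hg, ← hl]
    · intro m n hm hn hab
      obtain ⟨m, rfl⟩ : ∃ k, m = k + 1 := ⟨m - 1, by omega⟩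
      obtain ⟨n, rfl⟩ : ∃ k, n = k + 1 := ⟨n - 1, by omega⟩
      refine h.free
        (List.replicate (m + 1) true ++ (List.replicate (n + 1) false ++
          (List.replicate (n + 1) false ++ List.replicate (m + 1) true)))
        (List.replicate (n + 1) false ++ (List.replicate (m + 1) true ++
          (List.replicate (m + 1) true ++ List.replicate (n + 1) false)))
        (by simp) (by simp) ?_ ?_
      · simp [List.replicate_succ]
      · simp only [wd_append, wd_rep_true, wd_rep_false]
        funext z
        simp only [Function.comp_apply]
        simp only [aff_iter f a 0 hf, aff_iter g b 1 hg]
        generalize a ^ (m + 1) = A at *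
        generalize b ^ (n + 1) = B at *
        linear_combination ((A * B - 1) * z - (A * B) * z + z + 1 - B + A - 1 + (A * B + 1 - 2 * A)) * hab
  refine key.subset ?_
  rintro l ⟨m, n, hm, hn, h1, h2⟩
  refine ⟨m, n, hm, hn, ?_, ?_⟩
  · rw [← h1, aff_iter f a 0 hf]; ring
  · rw [← h2, aff_iter g b 1 hg]

theorem caseC_trans {b p q : ℂ} {f g c : ℂ[X]} (h : Hyp f g c) (hb : b ≠ 1)
    (hf : f = X + C p) (hg : g = C b * X + C q) : (SolM 1 f g c).Finite := by
  have hp : p ≠ 0 := by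
    rintro rfl
    refine h.free [true] [true, true] (by simp) (by simp) (by simp) ?_
    funext z
    simp [wd_true, wd_nil, hf]
  have h1b : (1 - b) ≠ 0 := sub_ne_zero.2 (Ne.symm hb)
  have h1 := h.cj p (q / (1 - b)) hp
  apply SolM_cj p (q / (1 - b)) hp
  have e1 : cjp p (q / (1 - b)) f = X + 1 := by
    apply Polynomial.funext
    intro z
    simp [cjp, hf]
    field_simp
    ring
  have e2 : cjp p (q / (1 - b)) g = C b * X := by
    apply Polynomial.funext
    intro z
    simp [cjp, hg]
    field_simp
    ring
  rw [e1, e2] at h1 ⊢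
  exact caseTrans _ _ h1

theorem caseC {f g c : ℂ[X]} (h : Hyp f g c) (hf : f.natDegree = 1) (hg : g.natDegree = 1) :
    (SolM 1 f g c).Finite := by
  obtain ⟨a, ha0, p, hf'⟩ : ∃ a, a ≠ 0 ∧ ∃ p, f = C a * X + C p := by
    refine ⟨f.coeff 1, ?_, f.coeff 0, eq_X_add_C_of_natDegree_le_one hf.le⟩
    rw [← hf]
    exact leadingCoeff_ne_zero.2 (by rintro rfl; simp at hf)
  obtain ⟨b, hb0, q, hg'⟩ : ∃ b, b ≠ 0 ∧ ∃ q, g = C b * X + C q := by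
    refine ⟨g.coeff 1, ?_, g.coeff 0, eq_X_add_C_of_natDegree_le_one hg.le⟩
    rw [← hg]
    exact leadingCoeff_ne_zero.2 (by rintro rfl; simp at hg)
  have hcomm : a * q + p ≠ b * p + q := by
    intro h1
    refine h.free [true, false] [false, true] (by simp) (by simp) (by simp) ?_
    funext z
    simp [wd_true, wd_false, wd_nil, hf', hg']
    linear_combination h1
  by_cases ha : a = 1
  · subst ha
    have hb : b ≠ 1 := by
      rintro rfl
      apply hcomm
      ring
    exact caseC_trans (p := p) h hb (by rw [hf', C_1, one_mul]) hg'
  by_cases hb : b = 1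
  · subst hb
    rw [← SolM_symm]
    exact caseC_trans (p := q) h.symm ha (by rw [hg', C_1, one_mul]) hf'
  have h1a : (1 - a) ≠ 0 := sub_ne_zero.2 (Ne.symm ha)
  have h1b : (1 - b) ≠ 0 := sub_ne_zero.2 (Ne.symm hb)
  obtain ⟨x, hx⟩ : ∃ x, x * (1 - a) = p := ⟨p / (1 - a), by field_simp⟩
  obtain ⟨y, hy⟩ : ∃ y, y * (1 - b) = q := ⟨q / (1 - b), by field_simp⟩
  have hα : y - x ≠ 0 := by
    intro h0
    have hyx : y = x := sub_eq_zero.1 h0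
    apply hcomm
    rw [← hx, ← hy, hyx]
    ring
  apply SolM_cj (y - x) x hα
  refine caseC_gen (a := a) (b := b) (h.cj (y - x) x hα) ha0 hb0 ?_ ?_
  · intro z
    simp [cjp, hf', ← hx]
    field_simp
    ring
  · intro z
    simp [cjp, hg', ← hy]
    field_simp
    ring

end CaseC

end StmtHelpers

/-- Theorem 1.7: finiteness of common solutions of `f^m(λ) = g^n(λ) = c(λ)`
for compositionally independent polynomials `f, g` with `c` not an iterate of either. -/
theorem stmt2 (f g c : Polynomial ℂ)
    (hcf : ∀ n : ℕ, 1 ≤ n → c ≠ (fun q : Polynomial ℂ => q.comp f)^[n] Polynomial.X)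
    (hcg : ∀ n : ℕ, 1 ≤ n → c ≠ (fun q : Polynomial ℂ => q.comp g)^[n] Polynomial.X)
    (hfree : ∀ w₁ w₂ : List Bool, w₁ ≠ [] → w₂ ≠ [] → w₁ ≠ w₂ →
      (w₁.map fun b => if b then (fun x => f.eval x) else (fun x => g.eval x)).foldr
          (· ∘ ·) id ≠
      (w₂.map fun b => if b then (fun x => f.eval x) else (fun x => g.eval x)).foldr
          (· ∘ ·) id) :
    {l : ℂ | ∃ m n : ℕ, 1 ≤ m ∧ 1 ≤ n ∧
      (fun x => f.eval x)^[m] l = (fun x => g.eval x)^[n] l ∧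
      (fun x => g.eval x)^[n] l = c.eval l}.Finite := by
  have h : Hyp f g c := stmt_of_hyp f g c hcf hcg hfree
  have key : (SolM 1 f g c).Finite := by
    have d1 := h.natDegree_pos
    have d2 := h.symm.natDegree_pos
    by_cases e1 : f.natDegree = 1
    · by_cases e2 : g.natDegree = 1
      · exact caseC h e1 e2
      · exact caseB h e1 (by omega)
    · by_cases e2 : g.natDegree = 1
      · rw [← SolM_symm]
        exact caseB h.symm e2 (by omega)
      · exact caseA h (by omega) (by omega)
  refine key.subset ?_
  rintro l ⟨m, n, hm, hn, h1, h2⟩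
  exact ⟨m, n, hm, hn, h1.trans h2, h2⟩
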